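/- There is an absolute constant C > 0 with the following property. Let p be a prime and let P, Q ∈ F_p[x] be such that the bivariate polynomial φ(P,Q), of total degree d ≥ 1, is not divisible by any polynomial of the form b₁x + b₂y + c with b₁, b₂, c ∈ F_p and (b₁, b₂) ≠ (0,0). Let I ⊆ F_p be the image of a finite arithmetic progression. Then |J_I(P,Q) − (|I|²/p²)·J(P,Q)| ≤ C·d²·√p·(log p)², where J(P,Q) is the number of pairs (x,y) ∈ F_p × F_p with φ(P,Q)(x,y) = 0 and J_I(P,Q) is the number of pairs (x,y) ∈ I × I with φ(P,Q)(x,y) = 0. -/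

import Mathlib

open MvPolynomial

/-- The image in `ZMod p` of the arithmetic progression `{s, s+r, …, s+(m-1)r}`. -/
def apImage (p : ℕ) (s r : ZMod p) (m : ℕ) : Finset (ZMod p) :=
  (Finset.range m).image (fun i : ℕ => s + (i : ZMod p) * r)

open scoped Polynomial nonZeroDivisors

section InftyRing

variable (k : Type*) [Field k]

/-- The valuation ring of `RatFunc k` at infinity. -/
noncomputable def inftyRing : Subalgebra k (RatFunc k) where
  carrier := {f | f.intDegree ≤ 0}
  mul_mem' {a b} ha hb := by
    simp only [Set.mem_ofPred_eq] at *
    by_cases h : a = 0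
    · simp [h]
    by_cases h' : b = 0
    · simp [h']
    rw [RatFunc.intDegree_mul h h']; omega
  add_mem' {a b} ha hb := by
    simp only [Set.mem_ofPred_eq] at *
    by_cases h' : b = 0
    · simpa [h'] using ha
    by_cases h : a + b = 0
    · simp [h]
    have := RatFunc.intDegree_add_le h' h
    omega
  algebraMap_mem' c := by
    rw [RatFunc.algebraMap_eq_C]; simp

variable {k}

theorem mem_inftyRing {f : RatFunc k} : f ∈ inftyRing k ↔ f.intDegree ≤ 0 := Iff.rfl

theorem X_zpow_intDegree (m : ℤ) : ((RatFunc.X : RatFunc k) ^ m).intDegree = m := by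
  have h : ∀ n : ℕ, ((RatFunc.X : RatFunc k) ^ n).intDegree = n := by
    intro n
    induction n with
    | zero => simp
    | succ n ih =>
      rw [pow_succ, RatFunc.intDegree_mul (pow_ne_zero _ RatFunc.X_ne_zero) RatFunc.X_ne_zero, ih]
      simp
  obtain ⟨n, rfl | rfl⟩ := m.eq_nat_or_neg
  · simpa using h n
  · simp [h]

theorem X_zpow_mem_inftyRing {m : ℤ} (hm : m ≤ 0) : (RatFunc.X : RatFunc k) ^ m ∈ inftyRing k := by
  rw [mem_inftyRing, X_zpow_intDegree]; exact hm

theorem X_zpow_mul_mem_inftyRing {f : RatFunc k} {m : ℤ} (hm : f.intDegree ≤ -m) :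
    (RatFunc.X : RatFunc k) ^ m * f ∈ inftyRing k := by
  by_cases hf : f = 0
  · simp [hf]
  · rw [mem_inftyRing, RatFunc.intDegree_mul (zpow_ne_zero _ RatFunc.X_ne_zero) hf,
      X_zpow_intDegree]
    omega

instance : IsFractionRing (inftyRing k) (RatFunc k) := by
  refine IsFractionRing.of_field _ _ fun z => ?_
  by_cases hz : z.intDegree ≤ 0
  · exact ⟨⟨z, hz⟩, 1, by simp⟩
  · refine ⟨1, ⟨z⁻¹, ?_⟩, ?_⟩
    · rw [mem_inftyRing, RatFunc.intDegree_inv]; omega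
    · show z = 1 / z⁻¹
      simp

/-- The uniformizer at infinity. -/
noncomputable def inftyUnif (k : Type*) [Field k] : inftyRing k :=
  ⟨(RatFunc.X : RatFunc k) ^ (-1 : ℤ), X_zpow_mem_inftyRing (by norm_num)⟩

theorem inftyUnif_pow_coe (n : ℕ) :
    ((inftyUnif k ^ n : inftyRing k) : RatFunc k) = RatFunc.X ^ (-(n : ℤ)) := by
  simp [inftyUnif]

theorem inftyUnif_pow_dvd_iff {n : ℕ} {f : inftyRing k} (hf : f ≠ 0) :
    inftyUnif k ^ n ∣ f ↔ (f : RatFunc k).intDegree ≤ -n := by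
  have hf' : (f : RatFunc k) ≠ 0 := by simpa using hf
  constructor
  · rintro ⟨g, rfl⟩
    have hg : (g : RatFunc k) ≠ 0 := by rintro h; simp [h] at hf'
    rw [MulMemClass.coe_mul, inftyUnif_pow_coe, RatFunc.intDegree_mul
      (zpow_ne_zero _ RatFunc.X_ne_zero) hg, X_zpow_intDegree]
    have := mem_inftyRing.1 g.2
    omega
  · intro h
    have hm : (RatFunc.X : RatFunc k) ^ (n : ℤ) * f ∈ inftyRing k :=
      X_zpow_mul_mem_inftyRing h
    refine ⟨⟨_, hm⟩, Subtype.ext ?_⟩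
    rw [MulMemClass.coe_mul, inftyUnif_pow_coe, ← mul_assoc, ← zpow_add₀ RatFunc.X_ne_zero,
      neg_add_cancel, zpow_zero, one_mul]

theorem isUnit_inftyRing_iff {f : inftyRing k} (hf : f ≠ 0) :
    IsUnit f ↔ (f : RatFunc k).intDegree = 0 := by
  have hf' : (f : RatFunc k) ≠ 0 := by simpa using hf
  constructor
  · rintro ⟨u, rfl⟩
    have h1 := mem_inftyRing.1 u.1.2
    have h2 := mem_inftyRing.1 u⁻¹.1.2
    have h3 : ((u.1 : inftyRing k) : RatFunc k) * (u⁻¹.1 : inftyRing k) = 1 := by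
      rw [← MulMemClass.coe_mul]; simp
    have h4 := congrArg RatFunc.intDegree h3
    rw [RatFunc.intDegree_mul hf' (right_ne_zero_of_mul_eq_one h3)] at h4
    simp at h4
    omega
  · intro h
    refine IsUnit.of_mul_eq_one ⟨(f : RatFunc k)⁻¹, ?_⟩ (Subtype.ext ?_)
    · rw [mem_inftyRing, RatFunc.intDegree_inv]; omega
    · simp [hf']

theorem irreducible_inftyUnif : Irreducible (inftyUnif k) := by
  have h0 : inftyUnif k ≠ 0 := by
    intro h
    have := congrArg (Subtype.val) h
    simp [inftyUnif, RatFunc.X_ne_zero] at this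
  have h1 : ((inftyUnif k : inftyRing k) : RatFunc k).intDegree = -1 := X_zpow_intDegree _
  constructor
  · rw [isUnit_inftyRing_iff h0, h1]; norm_num
  · rintro a b hab
    have ha : a ≠ 0 := by rintro rfl; simp [hab] at h0
    have hb : b ≠ 0 := by rintro rfl; simp [hab] at h0
    rw [isUnit_inftyRing_iff ha, isUnit_inftyRing_iff hb]
    rw [hab, MulMemClass.coe_mul, RatFunc.intDegree_mul (by simpa using ha) (by simpa using hb)]
      at h1
    have h2 := mem_inftyRing.1 a.2
    have h3 := mem_inftyRing.1 b.2
    omega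

instance : IsDiscreteValuationRing (inftyRing k) := by
  refine IsDiscreteValuationRing.ofHasUnitMulPowIrreducibleFactorization
    ⟨inftyUnif k, irreducible_inftyUnif, fun {f} hf => ?_⟩
  have hf0 := mem_inftyRing.1 f.2
  obtain ⟨n, hn⟩ := Int.eq_ofNat_of_zero_le (a := -(f : RatFunc k).intDegree) (by omega)
  have hd := (inftyUnif_pow_dvd_iff (n := n) hf).2 (by omega)
  obtain ⟨u, rfl⟩ := hd
  have hu : u ≠ 0 := by rintro rfl; simp at hf
  refine ⟨n, ?_⟩
  have : IsUnit u := by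
    rw [isUnit_inftyRing_iff hu]
    rw [MulMemClass.coe_mul, inftyUnif_pow_coe, RatFunc.intDegree_mul
      (zpow_ne_zero _ RatFunc.X_ne_zero) (by simpa using hu), X_zpow_intDegree] at hn
    omega
  obtain ⟨v, rfl⟩ := this
  exact ⟨v, rfl⟩

theorem exists_residue_at_infty (f : inftyRing k) :
    ∃ c : k, inftyUnif k ∣ f - algebraMap k (inftyRing k) c := by
  set g : RatFunc k := f.1
  have hg : g.num.natDegree ≤ g.denom.natDegree := by
    have : g.intDegree ≤ 0 := mem_inftyRing.1 f.2
    unfold RatFunc.intDegree at this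
    omega
  refine ⟨g.num.coeff g.denom.natDegree, ?_⟩
  set c := g.num.coeff g.denom.natDegree
  by_cases h0 : f - algebraMap k (inftyRing k) c = 0
  · rw [h0]; exact dvd_zero _
  rw [← pow_one (inftyUnif k), inftyUnif_pow_dvd_iff h0]
  have e : ((f - algebraMap k (inftyRing k) c : inftyRing k) : RatFunc k) =
      algebraMap k[X] (RatFunc k) (g.num - Polynomial.C c * g.denom) /
        algebraMap k[X] (RatFunc k) g.denom := by
    have hd : algebraMap k[X] (RatFunc k) g.denom ≠ 0 := by
      simpa using g.denom_ne_zero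
    rw [eq_div_iff hd, map_sub, map_mul]
    have h1 : algebraMap k[X] (RatFunc k) g.num = g * algebraMap k[X] (RatFunc k) g.denom := by
      rw [← div_eq_iff hd, RatFunc.num_div_denom]
    rw [h1]
    simp [g, sub_mul, RatFunc.algebraMap_eq_C, ← RatFunc.algebraMap_C]
  have hne : g.num - Polynomial.C c * g.denom ≠ 0 := by
    intro h
    rw [h] at e
    apply h0
    apply Subtype.ext
    simpa using e
  rw [e, RatFunc.intDegree_div (RatFunc.algebraMap_ne_zero hne)
    (RatFunc.algebraMap_ne_zero g.denom_ne_zero),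
    RatFunc.intDegree_polynomial, RatFunc.intDegree_polynomial]
  have hlt : (g.num - Polynomial.C c * g.denom).natDegree < g.denom.natDegree := by
    have hle : (g.num - Polynomial.C c * g.denom).natDegree ≤ g.denom.natDegree :=
      (Polynomial.natDegree_sub_le _ _).trans
        (max_le hg (Polynomial.natDegree_C_mul_le _ _))
    refine lt_of_le_of_ne hle fun h => hne ?_
    rw [← Polynomial.leadingCoeff_eq_zero, Polynomial.leadingCoeff, h]
    have := (RatFunc.monic_denom g).coeff_natDegree
    simp [c, this]
  push_cast
  omega

theorem algebraMap_residue_bijective :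
    Function.Bijective (algebraMap k (inftyRing k ⧸ Ideal.span {inftyUnif k})) := by
  have hnt : Nontrivial (inftyRing k ⧸ Ideal.span {inftyUnif k}) := by
    rw [Ideal.Quotient.nontrivial_iff, Ne, Ideal.span_singleton_eq_top]
    exact irreducible_inftyUnif.not_isUnit
  refine ⟨RingHom.injective _, fun y => ?_⟩
  obtain ⟨f, rfl⟩ := Ideal.Quotient.mk_surjective y
  obtain ⟨c, hc⟩ := exists_residue_at_infty f
  refine ⟨c, ?_⟩
  rw [IsScalarTower.algebraMap_apply k (inftyRing k), Ideal.Quotient.algebraMap_eq, eq_comm,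
    Ideal.Quotient.mk_eq_mk_iff_sub_mem, Ideal.mem_span_singleton]
  exact hc

/-- The residue map at infinity. -/
noncomputable def inftyResidue (k : Type*) [Field k] : inftyRing k →ₐ[k] k :=
  (AlgEquiv.ofBijective (Algebra.ofId k (inftyRing k ⧸ Ideal.span {inftyUnif k}))
    algebraMap_residue_bijective).symm.toAlgHom.comp (Ideal.Quotient.mkₐ k _)

theorem inftyResidue_eq_zero_iff (f : inftyRing k) :
    inftyResidue k f = 0 ↔ inftyUnif k ∣ f := by
  rw [← Ideal.mem_span_singleton, ← Ideal.Quotient.eq_zero_iff_mem]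
  exact EmbeddingLike.map_eq_zero_iff
    (f := (AlgEquiv.ofBijective (Algebra.ofId k (inftyRing k ⧸ Ideal.span {inftyUnif k}))
      algebraMap_residue_bijective).symm)

end InftyRing

section Residue

variable {k R : Type*} (K L : Type*) [Field k] [CommRing R] [IsDomain R] [IsPrincipalIdealRing R]
  [Field K] [Field L] [Algebra R K] [IsFractionRing R K] [Algebra K L] [Algebra R L]
  [IsScalarTower R K L] [FiniteDimensional K L] [Algebra.IsSeparable K L]
  [Algebra k R] [Algebra k L] [IsScalarTower k R L]

theorem exists_integralClosure_residue (res : R →ₗ[k] k) (t : R) (hsurj : Function.Surjective res)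
    (hres : ∀ f, res f = 0 ↔ t ∣ f) :
    ∃ ρ : integralClosure R L →ₗ[k] (Fin (Module.finrank K L) → k), Function.Surjective ρ ∧
      ∀ f, ρ f = 0 ↔ ∃ g : integralClosure R L, t • (g : L) = f := by
  set O := integralClosure R L
  have : Module.IsTorsionFree R L := .trans_faithfulSMul _ K L
  have : Module.Free R O := IsIntegralClosure.module_free _ K L O
  have : Module.Finite R O := IsIntegralClosure.finite _ K L O
  have hr : Module.finrank R O = Module.finrank K L := IsIntegralClosure.rank _ K L O
  have b := Module.finBasisOfFinrankEq R O hr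
  let co : O →ₗ[k] (Fin (Module.finrank K L) → R) :=
    (b.equivFun : O →ₗ[R] _).restrictScalars k
  refine ⟨(res.compLeft _).comp co, fun v => ?_, fun f => ?_⟩
  · choose c hc using fun i => hsurj (v i)
    obtain ⟨g, hg⟩ := b.equivFun.surjective c
    refine ⟨g, ?_⟩
    funext i
    show res (b.equivFun g i) = v i
    rw [hg, hc]
  · have h1 : (res.compLeft _).comp co f = 0 ↔ ∀ i, t ∣ b.equivFun f i := by
      rw [_root_.funext_iff]
      exact forall_congr' fun i => hres _
    rw [h1]
    constructor
    · intro h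
      choose c hc using h
      refine ⟨b.equivFun.symm c, ?_⟩
      have h3 : f = t • b.equivFun.symm c := by
        apply b.equivFun.injective
        rw [map_smul, LinearEquiv.apply_symm_apply]
        funext i
        exact hc i
      rw [h3]; rfl
    · rintro ⟨g, hg⟩ i
      have h3 : f = t • g := Subtype.ext hg.symm
      rw [h3, map_smul]
      exact ⟨_, rfl⟩

end Residue

section PoleSpace

variable (k L : Type*) [Field k] [Field L] [Algebra (RatFunc k) L] [Algebra k L]
  [IsScalarTower k (RatFunc k) L]

/-- Elements of `L` with poles at infinity of order at most `m`, relative to `RatFunc k`. -/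
noncomputable def poleSpace (m : ℤ) : Submodule k L where
  carrier := {f | IsIntegral (inftyRing k) (algebraMap (RatFunc k) L (RatFunc.X ^ (-m)) * f)}
  zero_mem' := by
    rw [Set.mem_ofPred_eq, mul_zero]; exact isIntegral_zero
  add_mem' {a b} ha hb := by
    rw [Set.mem_ofPred_eq] at *
    rw [mul_add]; exact ha.add hb
  smul_mem' c f hf := by
    rw [Set.mem_ofPred_eq] at *
    rw [mul_smul_comm, Algebra.smul_def, IsScalarTower.algebraMap_apply k (RatFunc k) L]
    refine IsIntegral.mul ?_ hf
    exact isIntegral_algebraMap (R := inftyRing k) (x := algebraMap k (inftyRing k) c)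

variable {k L}

theorem mem_poleSpace {m : ℤ} {f : L} : f ∈ poleSpace k L m ↔
    IsIntegral (inftyRing k) (algebraMap (RatFunc k) L (RatFunc.X ^ (-m)) * f) := Iff.rfl

omit [Algebra k L] [IsScalarTower k (RatFunc k) L] in
theorem isIntegral_algebraMap_of_mem_inftyRing {f : RatFunc k} (hf : f ∈ inftyRing k) :
    IsIntegral (inftyRing k) (algebraMap (RatFunc k) L f) :=
  isIntegral_algebraMap (R := inftyRing k) (x := ⟨f, hf⟩)

theorem algebraMap_mem_poleSpace {f : RatFunc k} {m : ℤ} (hf : f.intDegree ≤ m) :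
    algebraMap (RatFunc k) L f ∈ poleSpace k L m := by
  rw [mem_poleSpace, ← map_mul]
  exact isIntegral_algebraMap_of_mem_inftyRing (X_zpow_mul_mem_inftyRing (by simpa using hf))

theorem mul_mem_poleSpace {f g : L} {i j : ℤ} (hf : f ∈ poleSpace k L i)
    (hg : g ∈ poleSpace k L j) : f * g ∈ poleSpace k L (i + j) := by
  rw [mem_poleSpace] at *
  have e : algebraMap (RatFunc k) L (RatFunc.X ^ (-(i + j))) * (f * g) =
      algebraMap (RatFunc k) L (RatFunc.X ^ (-i)) * f *
        (algebraMap (RatFunc k) L (RatFunc.X ^ (-j)) * g) := by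
    rw [neg_add, zpow_add₀ RatFunc.X_ne_zero, map_mul]
    ring
  rw [e]
  exact hf.mul hg

theorem one_mem_poleSpace : (1 : L) ∈ poleSpace k L 0 := by
  have := algebraMap_mem_poleSpace (k := k) (L := L) (f := 1) (m := 0) (by simp)
  simpa using this

theorem pow_mem_poleSpace {f : L} {i : ℤ} (hf : f ∈ poleSpace k L i) (n : ℕ) :
    f ^ n ∈ poleSpace k L (n * i) := by
  induction n with
  | zero => simpa using one_mem_poleSpace
  | succ n ih =>
    have e : ((n + 1 : ℕ) : ℤ) * i = n * i + i := by push_cast; ring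
    rw [pow_succ, e]
    exact mul_mem_poleSpace ih hf

theorem poleSpace_mono : Monotone (poleSpace k L) := by
  intro i j hij f hf
  have h := mul_mem_poleSpace
    (algebraMap_mem_poleSpace (k := k) (L := L) (f := 1) (m := j - i) (by simpa using hij)) hf
  simpa using h

theorem X_zpow_mul_mem_poleSpace {f : L} {i j : ℤ} :
    algebraMap (RatFunc k) L (RatFunc.X ^ j) * f ∈ poleSpace k L i ↔
      f ∈ poleSpace k L (i - j) := by
  rw [mem_poleSpace, mem_poleSpace, ← mul_assoc, ← map_mul, ← zpow_add₀ RatFunc.X_ne_zero]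
  ring_nf

theorem map_mem_poleSpace {L' : Type*} [Field L'] [Algebra (RatFunc k) L'] [Algebra k L']
    [IsScalarTower k (RatFunc k) L'] (σ : L →ₐ[RatFunc k] L') {f : L} {m : ℤ}
    (hf : f ∈ poleSpace k L m) : σ f ∈ poleSpace k L' m := by
  rw [mem_poleSpace] at *
  have := hf.map (σ.restrictScalars (inftyRing k))
  simpa using this

variable [FiniteDimensional (RatFunc k) L]

theorem exists_mem_poleSpace (f : L) : ∃ m : ℕ, f ∈ poleSpace k L m := by
  obtain ⟨⟨y, hy⟩, h⟩ := IsIntegral.exists_multiple_integral_of_isLocalization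
    (nonZeroDivisors (inftyRing k)) f (Algebra.IsIntegral.isIntegral (R := RatFunc k) f)
  have hy0 : y ≠ 0 := nonZeroDivisors.ne_zero hy
  have hy0' : (y : RatFunc k) ≠ 0 := by simpa using hy0
  obtain ⟨n, hn⟩ := Int.eq_ofNat_of_zero_le (a := -(y : RatFunc k).intDegree)
    (by have := mem_inftyRing.1 y.2; omega)
  refine ⟨n, ?_⟩
  have h2 : ((y : RatFunc k)⁻¹).intDegree ≤ n := by
    rw [RatFunc.intDegree_inv]; omega
  have h3 : algebraMap (RatFunc k) L y * f ∈ poleSpace k L 0 := by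
    rw [mem_poleSpace, neg_zero, zpow_zero, map_one, one_mul]
    rw [Submonoid.smul_def, Algebra.smul_def] at h
    exact h
  have h4 := mul_mem_poleSpace (algebraMap_mem_poleSpace (L := L) h2) h3
  rwa [← mul_assoc, ← map_mul, inv_mul_cancel₀ hy0', map_one, one_mul, add_zero] at h4

variable [Algebra.IsSeparable (RatFunc k) L]

theorem exists_poleSpace_residue (m : ℤ) :
    ∃ ρ : poleSpace k L m →ₗ[k] (Fin (Module.finrank (RatFunc k) L) → k),
      Function.Surjective ρ ∧ ∀ f, ρ f = 0 ↔ (f : L) ∈ poleSpace k L (m - 1) := by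
  obtain ⟨r, hs, hk⟩ := exists_integralClosure_residue (k := k) (R := inftyRing k) (RatFunc k) L
    (inftyResidue k).toLinearMap (inftyUnif k) (fun c => ⟨_, (inftyResidue k).commutes c⟩)
    inftyResidue_eq_zero_iff
  let mulx : poleSpace k L m →ₗ[k] integralClosure (inftyRing k) L :=
    { toFun := fun f => ⟨_, f.2⟩
      map_add' := fun f g => Subtype.ext (by simp [mul_add])
      map_smul' := fun c f => Subtype.ext (mul_smul_comm _ _ _) }
  refine ⟨r.comp mulx, fun v => ?_, fun f => ?_⟩
  · obtain ⟨g, rfl⟩ := hs v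
    have hx : algebraMap (RatFunc k) L (RatFunc.X ^ (-m)) *
        (algebraMap (RatFunc k) L (RatFunc.X ^ m) * (g : L)) = g := by
      rw [← mul_assoc, ← map_mul, ← zpow_add₀ RatFunc.X_ne_zero]; simp
    refine ⟨⟨algebraMap (RatFunc k) L (RatFunc.X ^ m) * (g : L), ?_⟩, ?_⟩
    · rw [mem_poleSpace, hx]; exact g.2
    · exact congrArg r (Subtype.ext hx)
  · rw [LinearMap.comp_apply, hk, mem_poleSpace]
    have h2 : ∀ u : L, inftyUnif k • u = algebraMap (RatFunc k) L (RatFunc.X ^ (-m)) * (f : L) ↔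
        u = algebraMap (RatFunc k) L (RatFunc.X ^ (-(m - 1))) * (f : L) := by
      intro u
      have e1 : inftyUnif k • u = algebraMap (RatFunc k) L (RatFunc.X ^ (-1 : ℤ)) * u := by
        rw [Algebra.smul_def]; rfl
      have e2 : (RatFunc.X : RatFunc k) ^ (-m) =
          RatFunc.X ^ (-1 : ℤ) * RatFunc.X ^ (-(m - 1)) := by
        rw [← zpow_add₀ RatFunc.X_ne_zero]; ring_nf
      rw [e1, e2, map_mul, mul_assoc, mul_right_inj' (by simp [RatFunc.X_ne_zero])]
    constructor
    · rintro ⟨g, hg⟩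
      rw [← (h2 _).1 hg]
      exact g.2
    · intro h
      exact ⟨⟨_, h⟩, (h2 _).2 rfl⟩

theorem finrank_inf_poleSpace_succ_le (W : Submodule k L) (m : ℤ)
    [Module.Finite k (W ⊓ poleSpace k L (m - 1) : Submodule k L)] :
    Module.Finite k (W ⊓ poleSpace k L m : Submodule k L) ∧
    Module.finrank k (W ⊓ poleSpace k L m : Submodule k L) ≤
      Module.finrank k (W ⊓ poleSpace k L (m - 1) : Submodule k L) +
        Module.finrank (RatFunc k) L ∧
    (W ⊔ poleSpace k L (m - 1) = ⊤ → Module.finrank k (W ⊓ poleSpace k L m : Submodule k L) =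
      Module.finrank k (W ⊓ poleSpace k L (m - 1) : Submodule k L) +
        Module.finrank (RatFunc k) L) := by
  obtain ⟨ρ, hs, hk⟩ := exists_poleSpace_residue (k := k) (L := L) m
  let r : (W ⊓ poleSpace k L m : Submodule k L) →ₗ[k]
      (Fin (Module.finrank (RatFunc k) L) → k) := ρ.comp (Submodule.inclusion inf_le_right)
  have hle : poleSpace k L (m - 1) ≤ poleSpace k L m := poleSpace_mono (by omega)
  let e : r.ker ≃ₗ[k] (W ⊓ poleSpace k L (m - 1) : Submodule k L) :=
    { toFun := fun f => ⟨f.1.1, f.1.2.1, (hk ⟨f.1.1, f.1.2.2⟩).1 (LinearMap.mem_ker.1 f.2)⟩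
      invFun := fun f => ⟨⟨f.1, f.2.1, hle f.2.2⟩,
        LinearMap.mem_ker.2 ((hk ⟨f.1, hle f.2.2⟩).2 f.2.2)⟩
      left_inv := fun f => rfl
      right_inv := fun f => rfl
      map_add' := fun f g => rfl
      map_smul' := fun f g => rfl }
  have : Module.Finite k r.ker := Module.Finite.equiv e.symm
  have hfin : Module.Finite k (W ⊓ poleSpace k L m : Submodule k L) :=
    have := Module.Finite.equiv r.quotKerEquivRange.symm
    Module.Finite.of_submodule_quotient r.ker
  have h := r.finrank_range_add_finrank_ker
  rw [e.finrank_eq] at h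
  refine ⟨hfin, ?_, fun htop => ?_⟩
  · have : Module.finrank k r.range ≤ Module.finrank (RatFunc k) L := by
      simpa using Submodule.finrank_le r.range
    omega
  · have hsurj : Function.Surjective r := by
      intro v
      obtain ⟨f, rfl⟩ := hs v
      have hf : (f : L) ∈ W ⊔ poleSpace k L (m - 1) := by rw [htop]; trivial
      obtain ⟨w, hw, g, hg, hwg⟩ := Submodule.mem_sup.1 hf
      have hw' : w ∈ poleSpace k L m := by
        rw [eq_sub_of_add_eq hwg]
        exact sub_mem f.2 (hle hg)
      refine ⟨⟨w, hw, hw'⟩, ?_⟩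
      show ρ ⟨w, hw'⟩ = ρ f
      rw [← sub_eq_zero, ← map_sub, hk]
      have : w - (f : L) = - g := by rw [← hwg]; ring
      show w - (f : L) ∈ _
      rw [this]; exact neg_mem hg
    rw [LinearMap.range_eq_top.2 hsurj, finrank_top] at h
    simp at h
    omega

theorem finrank_inf_poleSpace_add_le (W : Submodule k L) (m : ℤ) (j : ℕ)
    [Module.Finite k (W ⊓ poleSpace k L m : Submodule k L)] :
    Module.Finite k (W ⊓ poleSpace k L (m + j) : Submodule k L) ∧
    Module.finrank k (W ⊓ poleSpace k L (m + j) : Submodule k L) ≤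
      Module.finrank k (W ⊓ poleSpace k L m : Submodule k L) +
        Module.finrank (RatFunc k) L * j := by
  induction j with
  | zero =>
    have e : m + (0 : ℕ) = m := by simp
    rw [e]
    exact ⟨inferInstance, by simp⟩
  | succ j ih =>
    obtain ⟨h1, h2⟩ := ih
    have e : m + j = m + (j + 1 : ℕ) - 1 := by push_cast; ring
    rw [e] at h1 h2
    obtain ⟨h3, h4, -⟩ := finrank_inf_poleSpace_succ_le W (m + (j + 1 : ℕ))
    refine ⟨h3, ?_⟩
    rw [mul_add, mul_one]
    omega

theorem finrank_inf_poleSpace_add (W : Submodule k L) (m : ℤ) (j : ℕ)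
    [Module.Finite k (W ⊓ poleSpace k L m : Submodule k L)]
    (htop : W ⊔ poleSpace k L m = ⊤) :
    Module.finrank k (W ⊓ poleSpace k L (m + j) : Submodule k L) =
      Module.finrank k (W ⊓ poleSpace k L m : Submodule k L) +
        Module.finrank (RatFunc k) L * j := by
  induction j with
  | zero =>
    have e : m + (0 : ℕ) = m := by simp
    rw [e]; simp
  | succ j ih =>
    have h1 := (finrank_inf_poleSpace_add_le W m j).1
    have htop' : W ⊔ poleSpace k L (m + j) = ⊤ :=
      top_le_iff.1 (htop ▸ sup_le_sup_left (poleSpace_mono (by omega)) _)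
    have e : m + j = m + (j + 1 : ℕ) - 1 := by push_cast; ring
    rw [e] at h1 htop' ih
    obtain ⟨-, -, h4⟩ := finrank_inf_poleSpace_succ_le W (m + (j + 1 : ℕ))
    have := h4 htop'
    rw [mul_add, mul_one]
    omega

end PoleSpace

theorem exists_eq_polynomial_add {k : Type*} [Field k] (a : RatFunc k) :
    ∃ (q : k[X]) (r : RatFunc k), a = algebraMap k[X] (RatFunc k) q + r ∧
      (r = 0 ∨ r.intDegree < 0) := by
  have hd := a.denom_ne_zero
  refine ⟨a.num / a.denom, algebraMap _ _ (a.num % a.denom) / algebraMap _ _ a.denom, ?_, ?_⟩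
  · have hd' := RatFunc.algebraMap_ne_zero hd
    conv_lhs => rw [← RatFunc.num_div_denom a]
    rw [div_eq_iff hd', add_mul, div_mul_cancel₀ _ hd', ← map_mul, ← map_add]
    congr 1
    rw [mul_comm]
    exact (EuclideanDomain.div_add_mod _ _).symm
  · by_cases h : a.num % a.denom = 0
    · left; rw [h]; simp
    · right
      rw [RatFunc.intDegree_div (RatFunc.algebraMap_ne_zero h) (RatFunc.algebraMap_ne_zero hd),
        RatFunc.intDegree_polynomial, RatFunc.intDegree_polynomial]
      have h1 := Polynomial.natDegree_lt_natDegree h (EuclideanDomain.mod_lt a.num hd)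
      omega

section IntegralSpace

variable (k L : Type*) [Field k] [Field L] [Algebra (RatFunc k) L] [Algebra k L]
  [IsScalarTower k (RatFunc k) L] [Algebra k[X] L] [IsScalarTower k[X] (RatFunc k) L]

theorem isScalarTower_polynomial : IsScalarTower k k[X] L :=
  IsScalarTower.of_algebraMap_eq fun x => by
    rw [IsScalarTower.algebraMap_apply k (RatFunc k) L,
      IsScalarTower.algebraMap_apply k[X] (RatFunc k) L,
      ← IsScalarTower.algebraMap_apply k k[X] (RatFunc k)]

/-- The elements of `L` integral over `k[X]`, as a `k`-space. -/
noncomputable def integralSpace : Submodule k L where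
  carrier := {f | IsIntegral k[X] f}
  zero_mem' := isIntegral_zero
  add_mem' ha hb := IsIntegral.add ha hb
  smul_mem' c f hf := by
    have := isScalarTower_polynomial k L
    exact IsIntegral.smul c hf

variable {k L}

theorem mem_integralSpace {f : L} : f ∈ integralSpace k L ↔ IsIntegral k[X] f := Iff.rfl

variable [FiniteDimensional (RatFunc k) L]

omit [Algebra k[X] L] [IsScalarTower k[X] (RatFunc k) L] in
theorem intDegree_norm_le {f : L} {m : ℤ} (hf : f ∈ poleSpace k L m) (h0 : f ≠ 0) :
    (Algebra.norm (RatFunc k) f).intDegree ≤ Module.finrank (RatFunc k) L * m := by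
  rw [mem_poleSpace] at hf
  have h1 := Algebra.isIntegral_norm (RatFunc k) hf
  rw [IsIntegrallyClosed.isIntegral_iff] at h1
  obtain ⟨⟨y, hy⟩, hyy⟩ := h1
  change y = _ at hyy
  rw [map_mul, Algebra.norm_algebraMap] at hyy
  rw [hyy, mem_inftyRing, RatFunc.intDegree_mul (pow_ne_zero _ (zpow_ne_zero _ RatFunc.X_ne_zero))
    ((Algebra.norm_ne_zero_iff (R := RatFunc k)).2 h0),
    ← zpow_natCast, ← zpow_mul, X_zpow_intDegree] at hy
  linarith

omit [FiniteDimensional (RatFunc k) L] in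
theorem exists_norm_eq_polynomial {f : L} (hf : f ∈ integralSpace k L) :
    ∃ g : k[X], algebraMap k[X] (RatFunc k) g = Algebra.norm (RatFunc k) f :=
  IsIntegrallyClosed.isIntegral_iff.1 (Algebra.isIntegral_norm (RatFunc k) hf)

theorem integralSpace_inf_poleSpace_eq_bot {m : ℤ} (hm : m < 0) :
    integralSpace k L ⊓ poleSpace k L m = ⊥ := by
  rw [eq_bot_iff]
  rintro f ⟨h1, h2⟩
  by_contra h0
  have h0 : f ≠ 0 := h0
  obtain ⟨g, hg⟩ := exists_norm_eq_polynomial h1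
  have h3 := intDegree_norm_le h2 h0
  rw [← hg, RatFunc.intDegree_polynomial] at h3
  have : 0 < (Module.finrank (RatFunc k) L : ℤ) := by exact_mod_cast Module.finrank_pos
  nlinarith

variable [Algebra.IsSeparable (RatFunc k) L]

theorem finite_integralSpace_inf (m : ℤ) :
    Module.Finite k (integralSpace k L ⊓ poleSpace k L m : Submodule k L) := by
  rcases lt_or_ge m 0 with h | h
  · rw [integralSpace_inf_poleSpace_eq_bot h]; infer_instance
  · have : Module.Finite k (integralSpace k L ⊓ poleSpace k L (-1) : Submodule k L) := by
      rw [integralSpace_inf_poleSpace_eq_bot (by norm_num)]; infer_instance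
    obtain ⟨j, hj⟩ := Int.eq_ofNat_of_zero_le (a := m + 1) (by omega)
    have := (finrank_inf_poleSpace_add_le (integralSpace k L) (-1) j).1
    rwa [show (-1 : ℤ) + j = m by omega] at this

theorem finrank_integralSpace_inf_le (j : ℕ) :
    Module.finrank k (integralSpace k L ⊓ poleSpace k L j : Submodule k L) ≤
      Module.finrank (RatFunc k) L * (j + 1) := by
  have e := integralSpace_inf_poleSpace_eq_bot (k := k) (L := L) (m := -1) (by norm_num)
  have : Module.Finite k (integralSpace k L ⊓ poleSpace k L (-1) : Submodule k L) := by
    rw [e]; infer_instance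
  have := (finrank_inf_poleSpace_add_le (integralSpace k L) (-1) (j + 1)).2
  rwa [e, finrank_bot, zero_add, show (-1 : ℤ) + (j + 1 : ℕ) = j by push_cast; ring] at this

omit [FiniteDimensional (RatFunc k) L] [Algebra.IsSeparable (RatFunc k) L] in
theorem integralSpace_sup_poleSpace_eq_top {ι : Type*} (ω : ι → L) {c : ℤ}
    (hspan : Submodule.span (RatFunc k) (Set.range ω) = ⊤)
    (hω : ∀ i, ω i ∈ integralSpace k L ⊓ poleSpace k L c) :
    integralSpace k L ⊔ poleSpace k L (c - 1) = ⊤ := by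
  rw [eq_top_iff]
  intro f _
  have hf : f ∈ Submodule.span (RatFunc k) (Set.range ω) := by rw [hspan]; trivial
  induction hf using Submodule.closure_induction with
  | zero => exact zero_mem _
  | add x y _ _ hx hy => exact add_mem (hx trivial) (hy trivial)
  | smul_mem a x hx =>
    obtain ⟨i, rfl⟩ := hx
    obtain ⟨q, r, rfl, hr⟩ := exists_eq_polynomial_add a
    rw [add_smul]
    refine add_mem (Submodule.mem_sup_left ?_) (Submodule.mem_sup_right ?_)
    · rw [algebraMap_smul, Algebra.smul_def]
      exact isIntegral_algebraMap.mul (hω i).1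
    · rw [Algebra.smul_def, show c - 1 = -1 + c by ring]
      refine mul_mem_poleSpace ?_ (hω i).2
      rcases hr with rfl | hr
      · rw [map_zero]; exact zero_mem _
      · exact algebraMap_mem_poleSpace (by omega)

theorem exists_integralSpace_sup_poleSpace_eq_top :
    ∃ c : ℕ, integralSpace k L ⊔ poleSpace k L c = ⊤ := by
  classical
  obtain ⟨s, b, hb⟩ := FiniteDimensional.exists_is_basis_integral k[X] (RatFunc k) L
  choose m hm using fun i => exists_mem_poleSpace (k := k) (b i)
  refine ⟨Finset.univ.sup m, ?_⟩
  have := integralSpace_sup_poleSpace_eq_top (k := k) b (c := (Finset.univ.sup m : ℕ)) b.span_eq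
    fun i => ⟨hb i, poleSpace_mono (by exact_mod_cast Finset.le_sup (Finset.mem_univ i)) (hm i)⟩
  exact top_le_iff.1 (this ▸ sup_le_sup_left (poleSpace_mono (by omega)) _)

/-- The ring of integral elements has the expected quotients. -/
theorem finrank_quotient_span_le {D : ℕ} (H : integralClosure k[X] L) (h0 : H ≠ 0)
    [Algebra k (integralClosure k[X] L)] [IsScalarTower k k[X] (integralClosure k[X] L)]
    (hD : (H : L) ∈ poleSpace k L D) :
    Module.finrank k (integralClosure k[X] L ⧸ Ideal.span {H}) ≤
      Module.finrank (RatFunc k) L * D := by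
  have : Module.IsTorsionFree k[X] L := .trans_faithfulSMul _ (RatFunc k) L
  have : Module.Free k[X] (integralClosure k[X] L) :=
    IsIntegralClosure.module_free _ (RatFunc k) L _
  have : Module.Finite k[X] (integralClosure k[X] L) := IsIntegralClosure.finite _ (RatFunc k) L _
  have : IsLocalization (Algebra.algebraMapSubmonoid (integralClosure k[X] L)
    (nonZeroDivisors k[X])) L := IsIntegralClosure.isLocalization _ (RatFunc k) L _
  rw [finrank_quotient_span_eq_natDegree_norm (Module.Free.chooseBasis k[X] _) h0]
  have h1 := Algebra.norm_localization k[X] (nonZeroDivisors k[X]) (Rₘ := RatFunc k) (Sₘ := L) H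
  have h2 := intDegree_norm_le hD (by simpa using h0)
  change Algebra.norm (RatFunc k) (H : L) = _ at h1
  rw [h1, RatFunc.intDegree_polynomial] at h2
  exact_mod_cast h2

omit [Algebra k L] [IsScalarTower k (RatFunc k) L] in
theorem finite_quotient_integralClosure (I : Ideal (integralClosure k[X] L)) (hI : I ≠ ⊥)
    [Algebra k (integralClosure k[X] L)] [IsScalarTower k k[X] (integralClosure k[X] L)] :
    Module.Finite k (integralClosure k[X] L ⧸ I) := by
  have : Module.IsTorsionFree k[X] L := .trans_faithfulSMul _ (RatFunc k) L
  have : Module.Free k[X] (integralClosure k[X] L) :=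
    IsIntegralClosure.module_free _ (RatFunc k) L _
  have : Module.Finite k[X] (integralClosure k[X] L) := IsIntegralClosure.finite _ (RatFunc k) L _
  exact Module.Finite.equiv
    (Ideal.quotientEquivDirectSum k (Module.Free.chooseBasis k[X] _) hI).symm

end IntegralSpace

theorem Finset.card_algHom_le_finrank_quotient {k A Ω : Type*} [Field k] [CommRing A] [Algebra k A]
    [Field Ω] [Algebra k Ω] (I : Ideal A) [Module.Finite k (A ⧸ I)] (s : Finset (A →ₐ[k] Ω))
    (hs : ∀ h ∈ s, ∀ a ∈ I, h a = 0) : s.card ≤ Module.finrank k (A ⧸ I) := by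
  classical
  refine le_trans ?_ (card_algHom_le_finrank k (A ⧸ I) Ω)
  have : Finite ((A ⧸ I) →ₐ[k] Ω) := inferInstance
  rw [← Nat.card_eq_finsetCard]
  refine Nat.card_le_card_of_injective (fun h : s => Ideal.Quotient.liftₐ I h.1 (hs h.1 h.2)) ?_
  intro h h' e
  apply Subtype.ext
  ext a
  exact congrArg (fun g : (A ⧸ I) →ₐ[k] Ω => g (Ideal.Quotient.mk I a)) e

section FrobeniusCount

variable {k L : Type*} [Field k] [Field L] [Algebra (RatFunc k) L] [Algebra k L]
  [IsScalarTower k (RatFunc k) L] [Algebra k[X] L] [IsScalarTower k[X] (RatFunc k) L]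
  [IsScalarTower k k[X] L]
  [FiniteDimensional (RatFunc k) L] [Algebra.IsSeparable (RatFunc k) L]

theorem eq_zero_of_X_pow_dvd (τ : integralClosure k[X] L →ₐ[k[X]] PowerSeries k) {m Q : ℕ}
    (hm : Module.finrank (RatFunc k) L * m < Q) {U : integralClosure k[X] L}
    (hU : (U : L) ∈ poleSpace k L m) (hdvd : PowerSeries.X ^ Q ∣ τ U) : U = 0 := by
  by_contra h0
  have h1 := finrank_quotient_span_le U h0 hU
  have := finite_quotient_integralClosure (k := k) (Ideal.span {U}) (by simpa using h0)
  let I : Ideal (PowerSeries k) := Ideal.span {PowerSeries.X ^ Q}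
  let π : integralClosure k[X] L →ₗ[k] (Fin Q → k) :=
    { toFun := fun a i => PowerSeries.coeff i (τ a)
      map_add' := fun a b => by ext; simp
      map_smul' := fun c a => by
        ext i
        have : τ (c • a) = c • τ a := map_smul (τ.restrictScalars k) c a
        simp [this] }
  have hker : (Ideal.span {U}).restrictScalars k ≤ π.ker := by
    intro a ha
    obtain ⟨b, rfl⟩ := Ideal.mem_span_singleton.1 ha
    rw [LinearMap.mem_ker]
    ext i
    show PowerSeries.coeff i (τ (U * b)) = 0
    rw [map_mul]
    exact PowerSeries.X_pow_dvd_iff.1 (hdvd.mul_right _) i i.2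
  let π' := ((Ideal.span {U}).restrictScalars k).liftQ π hker
  have hs : Function.Surjective π' := by
    intro v
    refine ⟨Submodule.Quotient.mk (algebraMap k[X] _ (∑ i : Fin Q, Polynomial.monomial (i : ℕ) (v i))), ?_⟩
    ext i
    show PowerSeries.coeff i (τ (algebraMap k[X] _ (∑ i : Fin Q, Polynomial.monomial (i : ℕ) (v i)))) = _
    rw [AlgHom.commutes]
    show PowerSeries.coeff i ((∑ i : Fin Q, Polynomial.monomial (i : ℕ) (v i) : k[X]) : PowerSeries k) = _
    rw [Polynomial.coeff_coe, Polynomial.finset_sum_coeff]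
    simp [Polynomial.coeff_monomial, Fin.val_inj]
  have : Module.Finite k (integralClosure k[X] L ⧸ (Ideal.span {U}).restrictScalars k) := this
  have h2 := LinearMap.finrank_le_finrank_of_surjective hs
  have h3 : Module.finrank k (integralClosure k[X] L ⧸ (Ideal.span {U}).restrictScalars k) =
    Module.finrank k (integralClosure k[X] L ⧸ (Ideal.span {U})) := rfl
  simp only [Module.finrank_fin_fun] at h2
  omega

end FrobeniusCount

section FrobeniusCount

variable {k L : Type*} [Field k] [Field L] [Algebra (RatFunc k) L] [Algebra k L]
  [IsScalarTower k (RatFunc k) L] [Algebra k[X] L] [IsScalarTower k[X] (RatFunc k) L]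
  [IsScalarTower k k[X] L]
  [FiniteDimensional (RatFunc k) L] [Algebra.IsSeparable (RatFunc k) L]

theorem injective_of_algHom_powerSeries (τ : integralClosure k[X] L →ₐ[k[X]] PowerSeries k) :
    Function.Injective τ := by
  rw [injective_iff_map_eq_zero]
  intro a ha
  obtain ⟨m, hm⟩ := exists_mem_poleSpace (k := k) (a : L)
  exact eq_zero_of_X_pow_dvd τ (Nat.lt_succ_self _) hm (by rw [ha]; exact dvd_zero _)

theorem sum_mul_pow_ne_zero (τ : integralClosure k[X] L →ₐ[k[X]] PowerSeries k) {p j : ℕ}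
    [Fact p.Prime] [CharP k p] {m r : ℕ} (hm : Module.finrank (RatFunc k) L * m < p ^ j)
    (u : Fin r → integralClosure k[X] L) (hu : ∀ i, (u i : L) ∈ poleSpace k L m)
    (hli : LinearIndependent k (fun i => (u i : L)))
    (g : Fin r → integralClosure k[X] L) (hg : g ≠ 0) : ∑ i, u i * g i ^ (p ^ j) ≠ 0 := by
  intro h0
  have hinj := injective_of_algHom_powerSeries τ
  have hchar : CharP (PowerSeries k) p := charP_of_injective_algebraMap
    (FaithfulSMul.algebraMap_injective k (PowerSeries k)) p
  have hp : p.Prime := Fact.out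
  obtain ⟨i1, hi1⟩ := Function.ne_iff.1 hg
  have hex : ∃ v : ℕ, ∃ i, PowerSeries.coeff v (τ (g i)) ≠ 0 := by
    by_contra! hc
    exact hi1 (hinj (by rw [Pi.zero_apply, map_zero]; ext v; simpa using hc v i1))
  classical
  obtain ⟨i0, hi0⟩ := Nat.find_spec hex
  have hmin := fun w (hw : w < Nat.find hex) => Nat.find_min hex hw
  generalize Nat.find hex = v at hi0 hmin
  push Not at hmin
  have hdiv : ∀ i, ∃ w, τ (g i) =
      PowerSeries.X ^ v * (PowerSeries.C (PowerSeries.coeff v (τ (g i))) + PowerSeries.X * w) := by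
    intro i
    obtain ⟨w, hw⟩ := PowerSeries.X_pow_dvd_iff.2 fun a ha => hmin a ha i
    have hc : PowerSeries.coeff v (τ (g i)) = PowerSeries.constantCoeff w := by
      rw [hw, PowerSeries.coeff_X_pow_mul']; simp
    obtain ⟨w', hw'⟩ := PowerSeries.X_dvd_iff.2
      (show PowerSeries.constantCoeff (w - PowerSeries.C (PowerSeries.constantCoeff w)) = 0 by simp)
    refine ⟨w', ?_⟩
    rw [hc, ← hw', hw]
    ring
  choose w hw using hdiv
  let γ := fun i => PowerSeries.coeff v (τ (g i))
  let U : integralClosure k[X] L := ∑ i, γ i ^ (p ^ j) • u i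
  have hU : U = 0 := by
    refine eq_zero_of_X_pow_dvd τ hm (U := U) ?_ ?_
    · have : (U : L) = ∑ i, γ i ^ (p ^ j) • (u i : L) := by simp [U]
      rw [this]
      exact Submodule.sum_mem _ fun i _ => Submodule.smul_mem _ _ (hu i)
    · have h1 := congrArg τ h0
      have h2 : τ U = ∑ i, PowerSeries.C (γ i) ^ (p ^ j) * τ (u i) := by
        simp only [U, map_sum]
        refine Finset.sum_congr rfl fun i _ => ?_
        have : τ ((γ i ^ (p ^ j)) • u i) = (γ i ^ (p ^ j)) • τ (u i) :=
          map_smul (τ.restrictScalars k) _ _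
        rw [this, PowerSeries.smul_eq_C_mul, map_pow]
      have h3 : PowerSeries.X ^ (v * p ^ j) *
          (τ U + PowerSeries.X ^ (p ^ j) * ∑ i, w i ^ (p ^ j) * τ (u i)) = 0 := by
        rw [← map_zero τ, ← h1, h2, map_sum, Finset.mul_sum, ← Finset.sum_add_distrib,
          Finset.mul_sum]
        refine Finset.sum_congr rfl fun i _ => ?_
        rw [map_mul, map_pow, hw i, mul_pow, add_pow_char_pow, mul_pow, ← pow_mul]
        ring
      have h4 := (mul_eq_zero.1 h3).resolve_left (pow_ne_zero _ PowerSeries.X_ne_zero)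
      rw [eq_neg_of_add_eq_zero_left h4]
      exact (dvd_mul_right _ _).neg_right
  have h5 : ∑ i, γ i ^ (p ^ j) • (u i : L) = 0 := by
    have : ((U : integralClosure k[X] L) : L) = 0 := by rw [hU]; rfl
    simpa [U] using this
  have h6 := Fintype.linearIndependent_iff.1 hli _ h5 i0
  exact hi0 (pow_eq_zero_iff (pow_ne_zero _ hp.ne_zero) |>.1 h6)

theorem exists_frobenius_relation (σ : L ≃ₐ[RatFunc k] L) {m ℓ Q : ℕ}
    (hdim : Module.finrank k (integralSpace k L ⊓ poleSpace k L (m * Q + ℓ : ℕ) : Submodule k L) <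
      Module.finrank k (integralSpace k L ⊓ poleSpace k L m : Submodule k L) *
      Module.finrank k (integralSpace k L ⊓ poleSpace k L ℓ : Submodule k L))
    (u : Fin (Module.finrank k (integralSpace k L ⊓ poleSpace k L m : Submodule k L)) →
      integralClosure k[X] L) (hu : ∀ i, (u i : L) ∈ poleSpace k L m) :
    ∃ g : Fin (Module.finrank k (integralSpace k L ⊓ poleSpace k L m : Submodule k L)) →
      integralClosure k[X] L, g ≠ 0 ∧ (∀ i, (g i : L) ∈ poleSpace k L ℓ) ∧
      ∑ i, (u i : L) ^ Q * σ (g i) = 0 := by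
  generalize Module.finrank k (integralSpace k L ⊓ poleSpace k L m : Submodule k L) = r at *
  let V (m : ℕ) : Submodule k L := integralSpace k L ⊓ poleSpace k L m
  have hfin := fun m : ℕ => finite_integralSpace_inf (k := k) (L := L) m
  let σk : L →ₐ[k] L := (σ : L →ₐ[RatFunc k] L).restrictScalars k
  let Φ : (Fin r → V ℓ) →ₗ[k] V (m * Q + ℓ) :=
    LinearMap.codRestrict _ (∑ i, (LinearMap.mulLeft k ((u i : L) ^ Q)) ∘ₗ σk.toLinearMap ∘ₗ
      (V ℓ).subtype ∘ₗ LinearMap.proj i) (by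
    intro g
    rw [LinearMap.sum_apply]
    refine Submodule.sum_mem _ fun i _ => ⟨?_, ?_⟩
    · exact ((u i).2.pow Q).mul (IsIntegral.map ((σ : L →ₐ[RatFunc k] L).restrictScalars k[X])
        (g i).2.1)
    · have h1 := pow_mem_poleSpace (hu i) Q
      have h2 := map_mem_poleSpace (σ : L →ₐ[RatFunc k] L) (g i).2.2
      have h3 := mul_mem_poleSpace h1 h2
      have e : (Q : ℤ) * m + ℓ = (m * Q + ℓ : ℕ) := by push_cast; ring
      rw [e] at h3
      exact h3)
  have hker : LinearMap.ker Φ ≠ ⊥ := by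
    have : Module.Finite k (V ℓ) := hfin ℓ
    have : Module.Finite k (V (m * Q + ℓ)) := hfin _
    apply LinearMap.ker_ne_bot_of_finrank_lt
    rw [Module.finrank_pi_fintype]
    simp only [Finset.sum_const, Finset.card_univ, Fintype.card_fin, smul_eq_mul]
    exact hdim
  obtain ⟨g, hg, hg0⟩ := Submodule.exists_mem_ne_zero_of_ne_bot hker
  refine ⟨fun i => ⟨g i, (g i).2.1⟩, ?_, fun i => (g i).2.2, ?_⟩
  · intro h
    apply hg0
    funext i
    exact Subtype.ext (congrArg (fun f => ((f i : integralClosure k[X] L) : L)) h)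
  · have := congrArg Subtype.val (LinearMap.mem_ker.1 hg)
    simp only [Φ, LinearMap.codRestrict_apply, LinearMap.sum_apply] at this
    exact this

variable {Ω : Type*} [Field Ω] [Algebra k Ω]

theorem card_frobenius_le (τ : integralClosure k[X] L →ₐ[k[X]] PowerSeries k) {p : ℕ}
    [Fact p.Prime] [CharP k p] :
    ∃ C Q0 : ℕ, ∀ (σ : L ≃ₐ[RatFunc k] L) (j : ℕ), Q0 ≤ p ^ j →
      ∀ s : Finset (integralClosure k[X] L →ₐ[k] Ω),
      (∀ h ∈ s, ∀ a a' : integralClosure k[X] L, (a' : L) = σ a → h a' = h a ^ (p ^ j) ^ 2) →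
      s.card ≤ (p ^ j) ^ 2 + C * p ^ j := by
  have hcharΩ : CharP Ω p := charP_of_injective_algebraMap
    (FaithfulSMul.algebraMap_injective k Ω) p
  obtain ⟨c, hc⟩ := exists_integralSpace_sup_poleSpace_eq_top (k := k) (L := L)
  have hfin := fun m : ℤ => finite_integralSpace_inf (k := k) (L := L) m
  have hV := fun j : ℕ => finrank_inf_poleSpace_add (integralSpace k L) (c : ℤ) j hc
  have hn : 0 < Module.finrank (RatFunc k) L := Module.finrank_pos
  have hf := fun D : ℕ => finrank_quotient_span_le (k := k) (L := L) (D := D)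
  have hsub := fun (τ' : integralClosure k[X] L →ₐ[k[X]] PowerSeries k) =>
    @sum_mul_pow_ne_zero k L _ _ _ _ _ _ _ _ _ _ τ' p
  generalize hnn : Module.finrank (RatFunc k) L = n at *
  generalize Module.finrank k (integralSpace k L ⊓ poleSpace k L c : Submodule k L) = D at *
  let a := D + n * c
  let w := 2 * a + 3
  refine ⟨n * w, n * (c + 1) + n + (a + 1) * (n * w + 1) + 1, fun σ j hj s hs => ?_⟩
  generalize hQ : p ^ j = Q at *
  let m := (Q - 1) / n
  have hm1 : n * m ≤ Q - 1 := Nat.mul_div_le _ _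
  have hm2 : Q - 1 < n * m + n := by
    have := Nat.lt_mul_div_succ (Q - 1) hn
    rwa [mul_add, mul_one] at this
  have hQ1 : 1 ≤ Q := by omega
  have hmc : c ≤ m := by
    by_contra! h
    have h1 : n * m ≤ n * c := Nat.mul_le_mul_left _ h.le
    have h2 := Nat.zero_le ((a + 1) * (n * w + 1))
    have h3 : Q ≤ n * m + n := by omega
    linarith
  have hV' : ∀ i, c ≤ i → (Module.finrank k
      (integralSpace k L ⊓ poleSpace k L (i : ℕ) : Submodule k L) : ℤ) = D + n * i - n * c := by
    intro i hi
    obtain ⟨i, rfl⟩ := Nat.exists_eq_add_of_le hi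
    have := hV i
    rw [← Nat.cast_add] at this
    rw [this]; push_cast; ring
  have hdim : Module.finrank k
      (integralSpace k L ⊓ poleSpace k L (m * Q + (m + w) : ℕ) : Submodule k L) <
      Module.finrank k (integralSpace k L ⊓ poleSpace k L m : Submodule k L) *
      Module.finrank k (integralSpace k L ⊓ poleSpace k L (m + w : ℕ) : Submodule k L) := by
    rw [← Nat.cast_lt (α := ℤ), Nat.cast_mul, hV' m hmc, hV' (m + w) (by omega),
      hV' (m * Q + (m + w)) (by omega)]
    have e1 : (n : ℤ) * m ≤ Q - 1 := by zify [hQ1] at hm1; exact hm1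
    have e2 : (Q : ℤ) ≤ n * m + n := by zify [hQ1] at hm2; omega
    have e3 : ((a : ℤ) + 1) * (n * w + 1) < n * m := by
      zify at hj; nlinarith [(by positivity : (0 : ℤ) ≤ n * c)]
    have e4 : (D : ℤ) - n * c ≤ a := by simp only [a]; push_cast; nlinarith
    have e5 : -(a : ℤ) ≤ D - n * c := by simp only [a]; push_cast; nlinarith
    have e6 : (w : ℤ) = 2 * a + 3 := by simp only [w]; push_cast; ring
    have e7 : (1 : ℤ) ≤ n := by exact_mod_cast hn
    push_cast
    rw [show (D : ℤ) + n * (m * Q + (m + w)) - n * c =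
        (n * m) * Q + (n * m + (D - n * c) + n * w) by ring,
      show ((D : ℤ) + n * m - n * c) * (D + n * (m + w) - n * c) =
        (n * m + (D - n * c)) * (n * m + (D - n * c) + n * w) by ring]
    clear_value a w m
    generalize (D : ℤ) - n * c = c0 at *
    generalize (n : ℤ) * m = M at *
    have e8 : (0 : ℤ) ≤ a := by positivity
    have e9 : (0 : ℤ) ≤ n * w := by positivity
    have e10 : 0 ≤ M := by nlinarith
    have f1 : M * Q ≤ M * (M + n) := mul_le_mul_of_nonneg_left e2 e10
    have f2 : -(a : ℤ) * (n * w) ≤ c0 * (n * w) := mul_le_mul_of_nonneg_right e5 e9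
    have f3 : M * 1 ≤ M * (n * w - 2 * a - 1 - n) :=
      mul_le_mul_of_nonneg_left (by rw [e6]; nlinarith) e10
    have f4 : M * -(a : ℤ) ≤ M * c0 := mul_le_mul_of_nonneg_left e5 e10
    nlinarith [sq_nonneg c0]
  let V (m : ℕ) : Submodule k L := integralSpace k L ⊓ poleSpace k L m
  have : Module.Finite k (V m) := hfin m
  let b := Module.finBasis k (V m)
  let u : Fin (Module.finrank k (V m)) → integralClosure k[X] L := fun i => ⟨b i, (b i).2.1⟩
  have hu : ∀ i, (u i : L) ∈ poleSpace k L m := fun i => (b i).2.2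
  obtain ⟨g, hg0, hgm, hg⟩ := exists_frobenius_relation σ hdim u hu
  have hli : LinearIndependent k (fun i => (u i : L)) :=
    b.linearIndependent.map' (V m).subtype (Submodule.ker_subtype _)
  have hH := hsub τ (m := m) (j := j) (by omega) u hu hli g hg0
  rw [hQ] at hH
  generalize hHH : ∑ i, u i * g i ^ Q = H at hH
  have hHm : (H : L) ∈ poleSpace k L (m + (m + w) * Q : ℕ) := by
    have : (H : L) = ∑ i, (u i : L) * (g i : L) ^ Q := by simp [← hHH]
    rw [this]
    refine Submodule.sum_mem _ fun i _ => ?_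
    have h3 := mul_mem_poleSpace (hu i) (pow_mem_poleSpace (hgm i) Q)
    have e : (m : ℤ) + Q * (m + w : ℕ) = (m + (m + w) * Q : ℕ) := by push_cast; ring
    rw [e] at h3
    exact h3
  have hker : ∀ h ∈ s, h H = 0 := by
    intro h hh
    have h1 : h H ^ Q = 0 := by
      let σg (i) : integralClosure k[X] L := ⟨σ (g i), IsIntegral.map
        ((σ : L →ₐ[RatFunc k] L).restrictScalars k[X]) (g i).2⟩
      have h2 : ∑ i, u i ^ Q * σg i = 0 := by
        apply Subtype.ext
        simpa [σg] using hg
      rw [← hHH, map_sum, ← hQ, sum_pow_char_pow, ← map_zero h, ← h2, map_sum]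
      refine Finset.sum_congr rfl fun i _ => ?_
      rw [map_mul, map_mul, mul_pow, hQ, hs h hh (g i) (σg i) rfl, map_pow, map_pow, ← pow_mul,
        sq]
    exact pow_eq_zero_iff (by omega) |>.1 h1
  have := finite_quotient_integralClosure (k := k) (Ideal.span {H}) (by simpa using hH)
  have h1 := Finset.card_algHom_le_finrank_quotient (Ideal.span {H}) s (by
    intro h hh x hx
    obtain ⟨y, rfl⟩ := Ideal.mem_span_singleton.1 hx
    rw [map_mul, hker h hh, zero_mul])
  have h2 := hf _ H hH hHm
  have h3 : n * (m + (m + w) * Q) ≤ Q ^ 2 + n * w * Q := by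
    have : n * m + n * m * Q ≤ (Q - 1) + (Q - 1) * Q := by gcongr
    obtain ⟨q, rfl⟩ : ∃ q, Q = q + 1 := ⟨Q - 1, by omega⟩
    simp only [Nat.add_sub_cancel] at this
    nlinarith
  omega

end FrobeniusCount

theorem nonempty_algHom_of_isIntegral {R A Ω : Type*} [CommRing R] [CommRing A] [Algebra R A]
    [Algebra.IsIntegral R A] [FaithfulSMul R A] [Field Ω] [IsAlgClosed Ω] [Algebra R Ω] :
    Nonempty (A →ₐ[R] Ω) := by
  let P : Ideal R := RingHom.ker (algebraMap R Ω)
  have hP : P.IsPrime := RingHom.ker_isPrime _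
  have hker : RingHom.ker (algebraMap R A) = ⊥ :=
    (RingHom.injective_iff_ker_eq_bot _).1 (FaithfulSMul.algebraMap_injective R A)
  obtain ⟨J, -, hJ, hJP⟩ := Ideal.exists_ideal_over_prime_of_isIntegral P (⊥ : Ideal A)
    (by rw [← RingHom.ker_eq_comap_bot, hker]; exact bot_le)
  have : J.LiesOver P := ⟨hJP.symm⟩
  let f : R ⧸ P →+* Ω := Ideal.Quotient.lift P (algebraMap R Ω) fun a ha => ha
  let : Algebra (R ⧸ P) Ω := f.toAlgebra
  have hinj : Function.Injective f := RingHom.kerLift_injective (algebraMap R Ω)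
  have : FaithfulSMul (R ⧸ P) Ω := (faithfulSMul_iff_algebraMap_injective _ _).2 hinj
  have : Algebra.IsIntegral (R ⧸ P) (A ⧸ J) := inferInstance
  have : FaithfulSMul (R ⧸ P) (A ⧸ J) := inferInstance
  have : Module.IsTorsionFree (R ⧸ P) (A ⧸ J) := Module.isTorsionFree_iff_faithfulSMul.2 this
  let g : A ⧸ J →ₐ[R ⧸ P] Ω := IsAlgClosed.lift
  refine ⟨{ toRingHom := g.toRingHom.comp (Ideal.Quotient.mk J), commutes' := fun r => ?_ }⟩
  exact g.commutes (Ideal.Quotient.mk P r)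

section Fibres

variable {R K A L Ω : Type*} [CommRing R] [IsDomain R] [Field K] [Algebra R K]
  [IsFractionRing R K] [Field L] [Algebra K L] [Algebra R L] [IsScalarTower R K L] [CommRing A]
  [Algebra R A] [Algebra A L] [IsScalarTower R A L] [IsIntegralClosure A R L]
  [FiniteDimensional K L] [IsGalois K L] [Field Ω] [IsAlgClosed Ω]

include K L in
/-- Away from a hypersurface, the fibres of a finite Galois cover are torsors. -/
theorem exists_bijective_comp_galRestrict [IsDomain A] [Module.Free R A] [Module.Finite R A]
    [IsIntegrallyClosed A] [FaithfulSMul R A] :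
    ∃ D : R, D ≠ 0 ∧ ∀ [Algebra R Ω], algebraMap R Ω D ≠ 0 → ∃ h : A →ₐ[R] Ω,
      Function.Bijective fun σ : L ≃ₐ[K] L => h.comp (galRestrict R K L A σ : A →ₐ[R] A) := by
  classical
  have hne : ∀ σ : L ≃ₐ[K] L, ∃ a : A, σ ≠ 1 → galRestrict R K L A σ a ≠ a := by
    intro σ
    by_contra! h
    have : galRestrict R K L A σ = 1 := by ext a; exact (h a).2
    exact (h 0).1 (by simpa using this)
  choose a ha using hne
  let δ : A := ∏ σ ∈ Finset.univ.erase (1 : L ≃ₐ[K] L), (galRestrict R K L A σ (a σ) - a σ)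
  have hδ : δ ≠ 0 := Finset.prod_ne_zero_iff.2 fun σ hσ =>
    sub_ne_zero.2 (ha σ (Finset.ne_of_mem_erase hσ))
  have hal : Algebra.IsIntegral R A := inferInstance
  have : Algebra.IsAlgebraic R A := inferInstance
  obtain ⟨b, D, hD, hb⟩ : ∃ b : A, ∃ D : R, D ≠ 0 ∧ algebraMap R A D = δ * b := by
    have : IsAlgebraic R δ := Algebra.IsAlgebraic.isAlgebraic δ
    obtain ⟨y, hy, h⟩ := this.exists_nonzero_dvd (mem_nonZeroDivisors_of_ne_zero hδ)
    obtain ⟨b, hb⟩ := h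
    exact ⟨b, y, hy, hb⟩
  refine ⟨D, hD, fun {_} hDΩ => ?_⟩
  obtain ⟨h⟩ := nonempty_algHom_of_isIntegral (R := R) (A := A) (Ω := Ω)
  refine ⟨h, ?_⟩
  have hδ0 : h δ ≠ 0 := by
    intro h0
    apply hDΩ
    rw [← h.commutes, hb, map_mul, h0, zero_mul]
  have hinj : Function.Injective
      fun σ : L ≃ₐ[K] L => h.comp (galRestrict R K L A σ : A →ₐ[R] A) := by
    intro σ τ hστ
    by_contra hc
    have h1 : τ⁻¹ * σ ≠ 1 := by simpa [inv_mul_eq_one, eq_comm] using hc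
    have h3 : h (galRestrict R K L A (σ * τ⁻¹) (a (σ * τ⁻¹)) - a (σ * τ⁻¹)) = 0 := by
      rw [map_sub, sub_eq_zero, map_mul]
      have := congrArg (fun f : A →ₐ[R] Ω => f (galRestrict R K L A τ⁻¹ (a (σ * τ⁻¹)))) hστ
      refine this.trans ?_
      simp only [AlgHom.comp_apply, AlgEquiv.coe_toAlgHom]
      congr 1
      rw [← AlgEquiv.mul_apply, ← map_mul, mul_inv_cancel, map_one, AlgEquiv.one_apply]
    apply hδ0
    rw [map_prod]
    refine Finset.prod_eq_zero (i := σ * τ⁻¹) ?_ h3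
    simp [mul_inv_eq_one, hc]
  have hfin : Finite (A →ₐ[R] Ω) := inferInstance
  have hcard : Nat.card (A →ₐ[R] Ω) ≤ Nat.card (L ≃ₐ[K] L) := by
    refine (card_algHom_le_finrank R A Ω).trans_eq ?_
    have : IsLocalization (Algebra.algebraMapSubmonoid A (nonZeroDivisors R)) L :=
      IsIntegralClosure.isLocalization R K L A
    rw [IsGalois.card_aut_eq_finrank,
      Module.finrank_of_isLocalizedModule_of_free K (nonZeroDivisors R)
        (IsScalarTower.toAlgHom R A L).toLinearMap]
  exact (Nat.bijective_iff_injective_and_card _).2 ⟨hinj,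
    le_antisymm (Nat.card_le_card_of_injective _ hinj) hcard⟩

end Fibres

section FixedPoints

variable (Ω : Type*) [Field Ω]

/-- The elements of `Ω` fixed by the `q`-power map. -/
noncomputable def powFixed (q : ℕ) : Finset Ω :=
  letI := Classical.decEq Ω
  (Polynomial.X ^ q - Polynomial.X : Polynomial Ω).roots.toFinset

variable {Ω}

theorem mem_powFixed {q : ℕ} (hq : 1 < q) {x : Ω} : x ∈ powFixed Ω q ↔ x ^ q = x := by
  classical
  have h0 : (Polynomial.X ^ q - Polynomial.X : Polynomial Ω) ≠ 0 := FiniteField.X_pow_card_sub_X_ne_zero Ω hq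
  unfold powFixed
  rw [Multiset.mem_toFinset, Polynomial.mem_roots h0]
  simp [sub_eq_zero]

theorem card_powFixed [IsAlgClosed Ω] (p : ℕ) [CharP Ω p] {q : ℕ} (hq : 1 < q) (hp : p ∣ q) :
    (powFixed Ω q).card = q := by
  classical
  unfold powFixed
  rw [Multiset.toFinset_card_of_nodup
    (Polynomial.nodup_roots (galois_poly_separable p q hp)),
    ← (IsAlgClosed.splits _).natDegree_eq_card_roots,
    FiniteField.X_pow_card_sub_X_natDegree_eq Ω hq]

end FixedPoints

section FrobeniusCount

variable {k L : Type*} [Field k] [Field L] [Algebra (RatFunc k) L] [Algebra k L]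
  [IsScalarTower k (RatFunc k) L] [Algebra k[X] L] [IsScalarTower k[X] (RatFunc k) L]
  [IsScalarTower k k[X] L]
  [FiniteDimensional (RatFunc k) L] [IsGalois (RatFunc k) L]
  {Ω : Type*} [Field Ω] [Algebra k Ω] [IsAlgClosed Ω]

omit [IsScalarTower k (RatFunc k) L] in
theorem exists_algHom_comp_galRestrict :
    ∃ D : k[X], D ≠ 0 ∧ ∀ x : Ω, Polynomial.aeval x D ≠ 0 →
      ∃ h : integralClosure k[X] L →ₐ[k] Ω, h (algebraMap k[X] _ Polynomial.X) = x ∧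
      (∀ σ τ : L ≃ₐ[RatFunc k] L, (∀ a, h (galRestrict k[X] (RatFunc k) L _ σ a) =
        h (galRestrict k[X] (RatFunc k) L _ τ a)) → σ = τ) ∧
      ∀ h' : integralClosure k[X] L →ₐ[k] Ω, h' (algebraMap k[X] _ Polynomial.X) = x →
        ∃ σ, ∀ a, h' a = h (galRestrict k[X] (RatFunc k) L (integralClosure k[X] L) σ a) := by
  have : Module.IsTorsionFree k[X] L := .trans_faithfulSMul _ (RatFunc k) L
  have : Module.Free k[X] (integralClosure k[X] L) :=
    IsIntegralClosure.module_free _ (RatFunc k) L _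
  have : Module.Finite k[X] (integralClosure k[X] L) := IsIntegralClosure.finite _ (RatFunc k) L _
  have : IsIntegrallyClosed (integralClosure k[X] L) :=
    integralClosure.isIntegrallyClosedOfFiniteExtension (RatFunc k)
  obtain ⟨D, hD, hh⟩ := exists_bijective_comp_galRestrict (R := k[X]) (K := RatFunc k)
    (A := integralClosure k[X] L) (L := L) (Ω := Ω)
  refine ⟨D, hD, fun x hx => ?_⟩
  let : Algebra k[X] Ω := (Polynomial.aeval x : k[X] →ₐ[k] Ω).toRingHom.toAlgebra
  have : IsScalarTower k k[X] Ω := IsScalarTower.of_algebraMap_eq fun c => by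
    change _ = Polynomial.aeval x (Polynomial.C c); simp
  obtain ⟨h, hb⟩ := hh hx
  refine ⟨h.restrictScalars k, ?_, fun σ τ e => hb.1 (AlgHom.ext e), fun h' hx' => ?_⟩
  · refine (h.commutes _).trans ?_
    change Polynomial.aeval x Polynomial.X = x
    simp
  · have hc : ∀ r : k[X], h' (algebraMap k[X] _ r) = algebraMap k[X] Ω r := by
      intro r
      change (h'.comp ((Algebra.ofId k[X] (integralClosure k[X] L)).restrictScalars k)) r =
        Polynomial.aeval x r
      congr 1
      ext
      simpa using hx'
    obtain ⟨σ, hσ⟩ := hb.2 { toRingHom := h'.toRingHom, commutes' := hc }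
    exact ⟨σ, fun a => congrArg (fun f : _ →ₐ[k[X]] Ω => f a) hσ.symm⟩

theorem norm_sum_mul_le_of_sum_eq_zero {G : Type*} [Fintype G] (N : G → ℕ) (q D : ℕ) {b : ℝ}
    (hN : ∀ σ, (N σ : ℝ) ≤ q + b) (hb : 0 ≤ b) (hsum : (Fintype.card G : ℝ) * (q - D) ≤ ∑ σ, N σ)
    (g : G → ℂ) {M : ℝ} (hg : ∀ σ, ‖g σ‖ ≤ M) (hg0 : ∑ σ, g σ = 0) :
    ‖∑ σ, (N σ : ℂ) * g σ‖ ≤ M * (2 * Fintype.card G * b + Fintype.card G * D) := by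
  have e : ∑ σ, (N σ : ℂ) * g σ = ∑ σ, ((N σ - q : ℝ) : ℂ) * g σ := by
    rw [← sub_eq_zero, ← Finset.sum_sub_distrib, ← mul_zero (q : ℂ), ← hg0, Finset.mul_sum]
    refine Finset.sum_congr rfl fun σ _ => ?_
    push_cast; ring
  have h1 : ∀ σ, |(N σ : ℝ) - q| ≤ 2 * b - (N σ - q) := fun σ => by
    rw [abs_le]; constructor <;> linarith [hN σ]
  rcases isEmpty_or_nonempty G with hG | ⟨⟨σ0⟩⟩
  · simp
  have hM : 0 ≤ M := (norm_nonneg _).trans (hg σ0)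
  rw [e]
  calc _ ≤ ∑ σ, ‖((N σ - q : ℝ) : ℂ) * g σ‖ := norm_sum_le _ _
    _ ≤ ∑ σ, (2 * b - (N σ - q)) * M := by
      refine Finset.sum_le_sum fun σ _ => ?_
      rw [norm_mul, Complex.norm_real, Real.norm_eq_abs]
      exact mul_le_mul (h1 σ) (hg σ) (norm_nonneg _) ((abs_nonneg _).trans (h1 σ))
    _ ≤ _ := by
      rw [← Finset.sum_mul, Finset.sum_sub_distrib, Finset.sum_sub_distrib]
      simp only [Finset.sum_const, Finset.card_univ, nsmul_eq_mul]
      rw [mul_comm]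
      refine mul_le_mul_of_nonneg_left ?_ hM
      push_cast at hsum
      linarith

theorem exists_norm_sum_powFixed_le (τ : integralClosure k[X] L →ₐ[k[X]] PowerSeries k) {p : ℕ}
    [Fact p.Prime] [CharP k p] (B : k[X]) (hB : B ≠ 0) :
    ∃ C Q0 : ℕ, ∀ j, Q0 ≤ p ^ j → (∀ c : k, c ^ (p ^ j) ^ 2 = c) →
      ∀ (F : Ω → ℂ) (g : (L ≃ₐ[RatFunc k] L) → ℂ) (M : ℝ), (∀ σ, ‖g σ‖ ≤ M) → (∀ x, ‖F x‖ ≤ M) →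
      ∑ σ, g σ = 0 →
      (∀ (h : integralClosure k[X] L →ₐ[k] Ω) (σ : L ≃ₐ[RatFunc k] L),
        Polynomial.aeval (h (algebraMap k[X] _ Polynomial.X)) B ≠ 0 →
        h (algebraMap k[X] _ Polynomial.X) ^ (p ^ j) ^ 2 = h (algebraMap k[X] _ Polynomial.X) →
        (∀ a a' : integralClosure k[X] L, (a' : L) = σ a → h a' = h a ^ (p ^ j) ^ 2) →
        F (h (algebraMap k[X] _ Polynomial.X)) = g σ) →
      ‖∑ x ∈ powFixed Ω ((p ^ j) ^ 2), F x‖ ≤ C * M * p ^ j := by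
  classical
  have hchar : CharP Ω p := charP_of_injective_algebraMap
    (FaithfulSMul.algebraMap_injective k Ω) p
  obtain ⟨C, Q0, hC⟩ := card_frobenius_le (L := L) (Ω := Ω) τ (p := p)
  obtain ⟨D, hD, hfib⟩ := exists_algHom_comp_galRestrict (k := k) (L := L) (Ω := Ω)
  let n := Fintype.card (L ≃ₐ[RatFunc k] L)
  have hn : 1 ≤ n := Fintype.card_pos
  let d := (B * D).natDegree
  refine ⟨2 * C + d + d, max Q0 2, fun j hj hk F g M hg hF hg0 hcomp => ?_⟩
  have hM : 0 ≤ M := (norm_nonneg _).trans (hg 1)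
  have hp : p.Prime := Fact.out
  have hj0 : j ≠ 0 := by rintro rfl; simp at hj
  generalize hQ : p ^ j = Q at *
  have hQ1 : 1 < Q ^ 2 := by nlinarith [le_of_max_le_right hj]
  have hcard : (powFixed Ω (Q ^ 2)).card = Q ^ 2 :=
    card_powFixed p hQ1 (by rw [← hQ]; exact dvd_pow (dvd_pow_self p hj0) two_ne_zero)
  have hBD : (B * D).map (algebraMap k Ω) ≠ 0 := by
    rw [Ne, Polynomial.map_eq_zero]; exact mul_ne_zero hB hD
  let S := (powFixed Ω (Q ^ 2)).filter fun x => Polynomial.aeval x (B * D) ≠ 0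
  let S' := (powFixed Ω (Q ^ 2)).filter fun x => ¬ Polynomial.aeval x (B * D) ≠ 0
  have hS' : S'.card ≤ d := by
    refine le_trans ?_ ((Polynomial.card_roots' _).trans
      (Polynomial.natDegree_map_le (p := B * D) (f := algebraMap k Ω)))
    refine le_trans (Finset.card_le_card ?_) (Multiset.toFinset_card_le _)
    intro x hx
    rw [Multiset.mem_toFinset, Polynomial.mem_roots hBD, Polynomial.IsRoot,
      Polynomial.eval_map_algebraMap]
    exact not_not.1 (Finset.mem_filter.1 hx).2
  have hSS' : S.card + S'.card = Q ^ 2 := by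
    rw [← hcard]; exact Finset.card_filter_add_card_filter_not _
  have hne : Nonempty (integralClosure k[X] L →ₐ[k] Ω) := by
    by_contra hc
    have : Infinite Ω := inferInstance
    apply hD
    rw [← Polynomial.map_eq_zero (algebraMap k Ω)]
    refine Polynomial.funext fun x => ?_
    rw [Polynomial.eval_map_algebraMap, Polynomial.eval_zero]
    by_contra hx
    exact hc ⟨(hfib x hx).choose⟩
  have hx : ∀ x ∈ S, ∃ h : integralClosure k[X] L →ₐ[k] Ω,
      h (algebraMap k[X] _ Polynomial.X) = x ∧
      (∀ σ τ : L ≃ₐ[RatFunc k] L, (∀ a, h (galRestrict k[X] (RatFunc k) L _ σ a) =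
        h (galRestrict k[X] (RatFunc k) L _ τ a)) → σ = τ) ∧
      ∀ h' : integralClosure k[X] L →ₐ[k] Ω, h' (algebraMap k[X] _ Polynomial.X) = x →
        ∃ σ, ∀ a, h' a = h (galRestrict k[X] (RatFunc k) L (integralClosure k[X] L) σ a) := by
    intro x hx
    have := (Finset.mem_filter.1 hx).2
    rw [map_mul] at this
    exact hfib x (right_ne_zero_of_mul this)
  choose! h hhx hhinj hhsurj using hx
  let φ (x : Ω) (ρ : L ≃ₐ[RatFunc k] L) : integralClosure k[X] L →ₐ[k] Ω :=
    AlgHom.comp (h x) ((galRestrict k[X] (RatFunc k) L (integralClosure k[X] L) ρ :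
      integralClosure k[X] L →ₐ[k[X]] integralClosure k[X] L).restrictScalars k)
  have hφ : ∀ x ρ a, φ x ρ a = h x (galRestrict k[X] (RatFunc k) L _ ρ a) := fun _ _ _ => rfl
  have hφx : ∀ x ∈ S, ∀ ρ, φ x ρ (algebraMap k[X] _ Polynomial.X) = x := by
    intro x hx ρ
    rw [hφ, AlgEquiv.commutes, hhx x hx]
  have hgal : ∀ (σ : L ≃ₐ[RatFunc k] L) (a : integralClosure k[X] L),
      (galRestrict k[X] (RatFunc k) L (integralClosure k[X] L) σ a : L) = σ a :=
    fun σ a => algebraMap_galRestrict_apply k[X] σ a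
  have hfrob : ∀ x ∈ S, ∀ ρ, ∃ σ : L ≃ₐ[RatFunc k] L, ∀ a a' : integralClosure k[X] L,
      (a' : L) = σ a → φ x ρ a' = φ x ρ a ^ Q ^ 2 := by
    intro x hx ρ
    have e : Q ^ 2 = p ^ (j * 2) := by rw [← hQ, pow_mul]
    obtain ⟨σ, hσ⟩ := hhsurj x hx
      { toRingHom := (iterateFrobenius Ω p (j * 2)).comp (φ x ρ).toRingHom
        commutes' := fun c => by
          change iterateFrobenius Ω p (j * 2) (φ x ρ (algebraMap k _ c)) = _
          rw [AlgHom.commutes, iterateFrobenius_def, ← e, ← map_pow, hk] }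
      (by
        change iterateFrobenius Ω p (j * 2) (φ x ρ (algebraMap k[X] _ Polynomial.X)) = _
        rw [hφx x hx, iterateFrobenius_def, ← e]
        exact (mem_powFixed hQ1).1 (Finset.mem_filter.1 hx).1)
    refine ⟨ρ⁻¹ * σ, fun a a' haa => ?_⟩
    have h1 : φ x ρ a ^ Q ^ 2 = h x (galRestrict k[X] (RatFunc k) L _ σ a) := by
      rw [← hσ a]
      change _ = iterateFrobenius Ω p (j * 2) (φ x ρ a)
      rw [iterateFrobenius_def, ← e]
    rw [h1, hφ]
    congr 1
    apply Subtype.ext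
    rw [hgal, hgal, haa]
    rw [AlgEquiv.mul_apply, ← AlgEquiv.mul_apply, mul_inv_cancel, AlgEquiv.one_apply]
  choose! s hs using hfrob
  have hFg : ∀ x ∈ S, ∀ ρ, F x = g (s x ρ) := by
    intro x hx ρ
    have h1 := hcomp (φ x ρ) (s x ρ)
    rw [hφx x hx] at h1
    refine h1 ?_ ((mem_powFixed hQ1).1 (Finset.mem_filter.1 hx).1) (hs x hx ρ)
    have := (Finset.mem_filter.1 hx).2
    rw [map_mul] at this
    exact left_ne_zero_of_mul this
  let T (σ : L ≃ₐ[RatFunc k] L) := (S ×ˢ Finset.univ).filter fun xρ => s xρ.1 xρ.2 = σ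
  have hT : ∀ σ, ((T σ).card : ℝ) ≤ (Q ^ 2 : ℕ) + C * Q := by
    intro σ
    have h1 := hC σ j (by rw [hQ]; exact le_of_max_le_left hj)
      ((T σ).image fun xρ => φ xρ.1 xρ.2) (by
        intro f hf
        obtain ⟨⟨x, ρ⟩, hxρ, rfl⟩ := Finset.mem_image.1 hf
        obtain ⟨h2, h3⟩ := Finset.mem_filter.1 hxρ
        rw [← h3, hQ]
        exact hs x (Finset.mem_product.1 h2).1 ρ)
    rw [Finset.card_image_of_injOn] at h1
    · rw [hQ] at h1; exact_mod_cast h1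
    · rintro ⟨x, ρ⟩ hxρ ⟨x', ρ'⟩ hxρ' e
      have h2 := (Finset.mem_product.1 (Finset.mem_filter.1 hxρ).1).1
      have h3 := (Finset.mem_product.1 (Finset.mem_filter.1 hxρ').1).1
      simp only at e h2 h3
      have h4 : x = x' := by rw [← hφx x h2 ρ, e, hφx x' h3 ρ']
      subst h4
      rw [hhinj x h2 ρ ρ' fun a => congrArg (fun f : _ →ₐ[k] Ω => f a) e]
  have hTsum : ∑ σ, (T σ).card = S.card * n := by
    rw [← Finset.card_eq_sum_card_fiberwise (f := fun xρ => s xρ.1 xρ.2) (s := S ×ˢ Finset.univ)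
      (fun _ _ => Finset.mem_coe.2 (Finset.mem_univ _)), Finset.card_product, Finset.card_univ]
  have hmain := norm_sum_mul_le_of_sum_eq_zero (fun σ => (T σ).card) (Q ^ 2) d hT (by positivity)
    (by
      have : ∑ σ, ((T σ).card : ℝ) = S.card * n := by exact_mod_cast hTsum
      push_cast
      rw [this, mul_comm]
      refine mul_le_mul_of_nonneg_right ?_ (by positivity)
      have : (S.card : ℝ) + S'.card = Q ^ 2 := by exact_mod_cast hSS'
      have : (S'.card : ℝ) ≤ d := by exact_mod_cast hS'
      linarith) g hg hg0
  have hsumS : ∑ σ, ((T σ).card : ℂ) * g σ = n * ∑ x ∈ S, F x := by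
    have h1 : ∑ xρ ∈ S ×ˢ (Finset.univ : Finset (L ≃ₐ[RatFunc k] L)), F xρ.1 =
        n * ∑ x ∈ S, F x := by
      rw [Finset.sum_product, Finset.mul_sum]
      simp [n]
    rw [← h1, ← Finset.sum_fiberwise _ (fun xρ : Ω × (L ≃ₐ[RatFunc k] L) => s xρ.1 xρ.2)]
    refine Finset.sum_congr rfl fun σ _ => ?_
    rw [← nsmul_eq_mul, ← Finset.sum_const]
    refine Finset.sum_congr rfl fun xρ hxρ => ?_
    obtain ⟨h2, h3⟩ := Finset.mem_filter.1 hxρ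
    rw [hFg xρ.1 (Finset.mem_product.1 h2).1 xρ.2, h3]
  rw [hsumS, norm_mul, Complex.norm_natCast] at hmain
  have hn0 : (0 : ℝ) < n := by exact_mod_cast hn
  have h1 : ‖∑ x ∈ S, F x‖ ≤ M * (2 * (C * Q) + d) := by
    refine le_of_mul_le_mul_left (hmain.trans_eq ?_) hn0
    change M * (2 * n * (C * Q) + n * d) = _
    ring
  have h2 : ‖∑ x ∈ S', F x‖ ≤ d * M := by
    refine (norm_sum_le _ _).trans ((Finset.sum_le_card_nsmul _ _ M fun x _ => hF x).trans ?_)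
    rw [nsmul_eq_mul]
    exact mul_le_mul_of_nonneg_right (by exact_mod_cast hS') hM
  have h3 : ∑ x ∈ powFixed Ω (Q ^ 2), F x = ∑ x ∈ S, F x + ∑ x ∈ S', F x :=
    (Finset.sum_filter_add_sum_filter_not _ _ _).symm
  rw [h3]
  refine (norm_add_le _ _).trans ((add_le_add h1 h2).trans ?_)
  have hQ2 : (1 : ℝ) ≤ Q := by exact_mod_cast (show 1 ≤ Q by linarith [le_of_max_le_right hj])
  have h4 : M * d * 1 ≤ M * d * Q := mul_le_mul_of_nonneg_left hQ2 (by positivity)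
  rw [← hQ] at *
  push_cast at *
  nlinarith

end FrobeniusCount

section HenselSplitting

variable {k : Type*} [Field k]

theorem exists_powerSeries_root (G : Polynomial (PowerSeries k)) (hG : G.Monic) (a : k)
    (ha : (G.map (PowerSeries.constantCoeff (R := k))).eval a = 0)
    (ha' : (G.map (PowerSeries.constantCoeff (R := k))).derivative.eval a ≠ 0) :
    ∃ b : PowerSeries k, G.IsRoot b ∧ PowerSeries.constantCoeff b = a := by
  have key : ∀ H : Polynomial (PowerSeries k),
      PowerSeries.constantCoeff (H.eval (PowerSeries.C a)) =
        (H.map (PowerSeries.constantCoeff (R := k))).eval a := fun H => by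
    rw [Polynomial.eval_map, Polynomial.eval, Polynomial.hom_eval₂]
    simp
  obtain ⟨b, hb, hb'⟩ := HenselianRing.is_henselian
    (I := (Ideal.span {PowerSeries.X} : Ideal (PowerSeries k))) G hG (PowerSeries.C a)
    (by rw [Ideal.mem_span_singleton, PowerSeries.X_dvd_iff, key, ha])
    (by
      refine IsUnit.map _ ?_
      rw [PowerSeries.isUnit_iff_constantCoeff, key, ← Polynomial.derivative_map]
      exact ha'.isUnit)
  refine ⟨b, hb, ?_⟩
  rw [Ideal.mem_span_singleton, PowerSeries.X_dvd_iff, map_sub, sub_eq_zero] at hb'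
  simpa using hb'

/-- A polynomial over `k[X]` whose specialization at `0` keeps its degree and has distinct roots,
all in `k`, splits into distinct linear factors over the Laurent series. -/
theorem splits_and_nodup_roots_laurentSeries (F : Polynomial (Polynomial k))
    (hdeg : (F.map (Polynomial.evalRingHom (0 : k))).natDegree = F.natDegree) (hF : F ≠ 0)
    (hsep : (F.map (Polynomial.evalRingHom (0 : k))).Separable)
    (hspl : (F.map (Polynomial.evalRingHom (0 : k))).Splits) :
    (F.map (algebraMap k[X] (LaurentSeries k))).Splits ∧
      (F.map (algebraMap k[X] (LaurentSeries k))).roots.Nodup := by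
  classical
  let F0 := F.map (Polynomial.evalRingHom (0 : k))
  have hF00 : F0 ≠ 0 := hsep.ne_zero
  have hcc : (PowerSeries.constantCoeff (R := k)).comp (algebraMap k[X] (PowerSeries k)) =
      Polynomial.evalRingHom (0 : k) := by
    ext <;> simp [PowerSeries.algebraMap_apply']
  have hlc : (algebraMap k[X] (PowerSeries k) F.leadingCoeff).constantCoeff ≠ 0 := by
    have h1 : (algebraMap k[X] (PowerSeries k) F.leadingCoeff).constantCoeff =
        F0.leadingCoeff := by
      rw [← RingHom.comp_apply, hcc, Polynomial.leadingCoeff, Polynomial.leadingCoeff, hdeg,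
        Polynomial.coeff_map]
    rw [h1]
    exact Polynomial.leadingCoeff_ne_zero.2 hF00
  have hu : IsUnit (algebraMap k[X] (PowerSeries k) F.leadingCoeff) :=
    PowerSeries.isUnit_iff_constantCoeff.2 hlc.isUnit
  obtain ⟨v, hv⟩ := hu.exists_left_inv
  let G : Polynomial (PowerSeries k) :=
    Polynomial.C v * F.map (algebraMap k[X] (PowerSeries k))
  have hGm : G.Monic := by
    refine Polynomial.monic_C_mul_of_mul_leadingCoeff_eq_one ?_
    rw [Polynomial.leadingCoeff_map_of_leadingCoeff_ne_zero]
    · exact hv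
    · exact hu.ne_zero
  have hv0 : v.constantCoeff ≠ 0 := by
    intro h
    have := congrArg (PowerSeries.constantCoeff (R := k)) hv
    simp [h] at this
  have hG0 : G.map (PowerSeries.constantCoeff (R := k)) = Polynomial.C v.constantCoeff * F0 := by
    simp only [G, Polynomial.map_mul, Polynomial.map_C, Polynomial.map_map, hcc, F0]
  have hroot : ∀ a ∈ F0.roots.toFinset, ∃ b : PowerSeries k,
      G.IsRoot b ∧ PowerSeries.constantCoeff b = a := by
    intro a ha
    rw [Multiset.mem_toFinset, Polynomial.mem_roots hF00] at ha
    refine exists_powerSeries_root G hGm a ?_ ?_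
    · rw [hG0, Polynomial.eval_mul, ha.eq_zero, mul_zero]
    · rw [hG0, Polynomial.derivative_C_mul, Polynomial.eval_mul, Polynomial.eval_C]
      refine mul_ne_zero hv0 ?_
      have := hsep.eval₂_derivative_ne_zero (RingHom.id k) (x := a)
        (by rw [Polynomial.eval₂_id]; exact ha.eq_zero)
      rwa [Polynomial.eval₂_id] at this
  choose! b hb using hroot
  let H := F.map (algebraMap k[X] (LaurentSeries k))
  have hinj : Function.Injective (algebraMap k[X] (LaurentSeries k)) :=
    FaithfulSMul.algebraMap_injective _ _
  have hH0 : H ≠ 0 := (Polynomial.map_ne_zero_iff hinj).2 hF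
  have hHd : H.natDegree = F.natDegree := Polynomial.natDegree_map_eq_of_injective hinj F
  have hsub : F0.roots.toFinset.image (fun a => algebraMap (PowerSeries k) (LaurentSeries k) (b a))
      ⊆ H.roots.toFinset := by
    intro z hz
    obtain ⟨a, ha, rfl⟩ := Finset.mem_image.1 hz
    rw [Multiset.mem_toFinset, Polynomial.mem_roots hH0]
    have h1 := (hb a ha).1
    have h2 : (F.map (algebraMap k[X] (PowerSeries k))).eval (b a) = 0 := by
      have := h1.eq_zero
      simp only [G, Polynomial.eval_mul, Polynomial.eval_C] at this
      rcases mul_eq_zero.1 this with h | h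
      · exact absurd h (by rintro rfl; exact hv0 (map_zero _))
      · exact h
    have h3 : H = (F.map (algebraMap k[X] (PowerSeries k))).map
        (algebraMap (PowerSeries k) (LaurentSeries k)) := by
      rw [Polynomial.map_map]
      congr 1
    rw [Polynomial.IsRoot, h3, Polynomial.eval_map_apply, h2, map_zero]
  have hcard : F.natDegree ≤ H.roots.toFinset.card := by
    refine le_trans (le_of_eq ?_) (Finset.card_le_card hsub)
    rw [Finset.card_image_of_injOn, Multiset.toFinset_card_of_nodup (Polynomial.nodup_roots hsep),
      Polynomial.splits_iff_card_roots.1 hspl, hdeg]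
    intro a ha a' ha' haa
    have := IsFractionRing.injective (PowerSeries k) (LaurentSeries k) haa
    rw [← (hb a ha).2, ← (hb a' ha').2, this]
  have h1 := Multiset.toFinset_card_le H.roots
  have h2 := Polynomial.card_roots' H
  refine ⟨Polynomial.splits_iff_card_roots.2 (by change H.roots.card = H.natDegree; omega), ?_⟩
  exact Multiset.toFinset_card_eq_card_iff_nodup.1 (by change H.roots.toFinset.card = H.roots.card; omega)

end HenselSplitting

section PowerSeriesPoint

variable {k L : Type*} [Field k] [Field L] [Algebra k[X] L]

/-- Embeddings into Laurent series send integral elements to power series. -/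
theorem nonempty_algHom_powerSeries (s : L →ₐ[k[X]] LaurentSeries k) :
    Nonempty (integralClosure k[X] L →ₐ[k[X]] PowerSeries k) := by
  have hinj := IsFractionRing.injective (PowerSeries k) (LaurentSeries k)
  have : IsScalarTower k[X] (PowerSeries k) (LaurentSeries k) :=
    IsScalarTower.of_algebraMap_eq fun _ => rfl
  have hex : ∀ a : integralClosure k[X] L,
      ∃ b : PowerSeries k, algebraMap (PowerSeries k) (LaurentSeries k) b = s a := by
    intro a
    have h1 : IsIntegral k[X] (s a) := a.2.map s
    have h2 : IsIntegral (PowerSeries k) (s a) := h1.tower_top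
    exact IsIntegrallyClosed.isIntegral_iff.1 h2
  choose b hb using hex
  refine ⟨{ toFun := b, map_one' := ?_, map_mul' := ?_, map_zero' := ?_, map_add' := ?_,
            commutes' := ?_ }⟩
  · apply hinj; rw [hb]; simp
  · intro x y; apply hinj; rw [hb, map_mul, hb, hb]; simp
  · apply hinj; rw [hb]; simp
  · intro x y; apply hinj; rw [hb, map_add, hb, hb]; simp
  · intro r; apply hinj; rw [hb]
    rw [← IsScalarTower.algebraMap_apply]
    exact s.commutes r

end PowerSeriesPoint

section ArtinSchreier

variable {k : Type*} [Field k]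

theorem ratFunc_pow_sub_ne_X {p : ℕ} (hp : 1 < p) (u : RatFunc k) : u ^ p - u ≠ RatFunc.X := by
  intro h
  have hu : u ≠ 0 := by
    rintro rfl
    rw [zero_pow (by omega), sub_zero] at h
    exact RatFunc.X_ne_zero h.symm
  have hpow : ∀ n : ℕ, (u ^ n).intDegree = n * u.intDegree := by
    intro n
    induction n with
    | zero => simp
    | succ n ih => rw [pow_succ, RatFunc.intDegree_mul (pow_ne_zero _ hu) hu, ih]; push_cast; ring
  have hX : (RatFunc.X : RatFunc k) ≠ 0 := RatFunc.X_ne_zero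
  rcases le_or_gt u.intDegree 0 with hd | hd
  · have h1 := RatFunc.intDegree_add_le (x := u ^ p) (y := -u) (neg_ne_zero.2 hu)
      (by rw [← sub_eq_add_neg, h]; exact hX)
    rw [← sub_eq_add_neg, h, RatFunc.intDegree_X, RatFunc.intDegree_neg, hpow] at h1
    rcases le_max_iff.1 h1 with h2 | h2
    · nlinarith
    · omega
  · have h3 : RatFunc.X + u = u ^ p := by rw [← h]; ring
    have h1 := RatFunc.intDegree_add_le (x := (RatFunc.X : RatFunc k)) (y := u) hu
      (by rw [h3]; exact pow_ne_zero _ hu)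
    rw [h3, RatFunc.intDegree_X, hpow] at h1
    rcases le_max_iff.1 h1 with h2 | h2 <;> nlinarith

variable {L : Type*} [Field L] [Algebra (RatFunc k) L] [FiniteDimensional (RatFunc k) L]
  [IsGalois (RatFunc k) L] {p : ℕ} [Fact p.Prime] [CharP L p]

theorem pow_eq_self_of_artinSchreier {z w a : L} (hz : z ^ p - z = a) (hw : w ^ p - w = a) :
    (w - z) ^ p = w - z := by
  rw [sub_pow_char]
  linear_combination hw - hz

/-- A root of `z^p - z = X` does not lie in an extension of degree `< p`. -/
theorem exists_algEquiv_fix_ne {z : L} (hz : z ^ p - z = algebraMap (RatFunc k) L RatFunc.X)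
    {f : Polynomial (RatFunc k)} (hf : f ≠ 0) (hfp : f.natDegree < p) {y : L}
    (hy : Polynomial.aeval y f = 0) :
    ∃ σ : L ≃ₐ[RatFunc k] L, σ y = y ∧ σ z ≠ z := by
  by_contra! hcon
  have hzy : z ∈ IntermediateField.adjoin (RatFunc k) {y} := by
    rw [← IsGalois.fixedField_fixingSubgroup (IntermediateField.adjoin (RatFunc k) {y})]
    rintro ⟨σ, hσ⟩
    exact hcon σ (hσ ⟨y, IntermediateField.mem_adjoin_simple_self _ y⟩)
  have hiy : IsIntegral (RatFunc k) y := Algebra.IsIntegral.isIntegral y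
  have hiz : IsIntegral (RatFunc k) z := Algebra.IsIntegral.isIntegral z
  have hm : (minpoly (RatFunc k) z).natDegree < p := by
    rw [← IntermediateField.adjoin.finrank hiz]
    refine lt_of_le_of_lt (b := Module.finrank (RatFunc k)
      (IntermediateField.adjoin (RatFunc k) {y})) ?_ ?_
    · exact IntermediateField.finrank_le_of_le_right
        (IntermediateField.adjoin_simple_le_iff.2 hzy)
    · rw [IntermediateField.adjoin.finrank hiy]
      exact lt_of_le_of_lt (Polynomial.natDegree_le_of_dvd (minpoly.dvd _ _ hy) hf) hfp
  have hm0 : 0 < (minpoly (RatFunc k) z).natDegree := minpoly.natDegree_pos hiz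
  let g := (minpoly (RatFunc k) z).map (algebraMap _ L)
  have hgs : g.Splits := Normal.splits inferInstance z
  have hgm : g.Monic := (minpoly.monic hiz).map _
  have hsum : g.nextCoeff = -g.roots.sum := hgs.nextCoeff_eq_neg_sum_roots_of_monic hgm
  have hroot : ∀ w ∈ g.roots, (w - z) ^ p = w - z := by
    intro w hw
    refine pow_eq_self_of_artinSchreier hz ?_
    rw [Polynomial.mem_roots hgm.ne_zero, Polynomial.IsRoot, Polynomial.eval_map_algebraMap] at hw
    have hd : minpoly (RatFunc k) z ∣
        Polynomial.X ^ p - Polynomial.X - Polynomial.C RatFunc.X := by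
      refine minpoly.dvd _ _ ?_
      simp [hz]
    obtain ⟨r, hr⟩ := hd
    have := congrArg (Polynomial.aeval w) hr
    rw [map_mul, hw, zero_mul] at this
    simpa [sub_eq_zero] using this
  have key : ∀ s : Multiset L, (∀ w ∈ s, (w - z) ^ p = w - z) →
      (s.sum - s.card * z) ^ p = s.sum - s.card * z := by
    intro s
    induction s using Multiset.induction_on with
    | empty => intro _; simp [(Fact.out : p.Prime).ne_zero]
    | cons w s ih =>
      intro hs
      have h1 := hs w (Multiset.mem_cons_self _ _)
      have h2 := ih fun w hw => hs w (Multiset.mem_cons_of_mem hw)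
      have e : (w ::ₘ s).sum - ((w ::ₘ s).card : L) * z = (w - z) + (s.sum - s.card * z) := by
        rw [Multiset.sum_cons, Multiset.card_cons]; push_cast; ring
      rw [e, add_pow_char, h1, h2]
  have hk := key _ hroot
  have hcard : g.roots.card = (minpoly (RatFunc k) z).natDegree := by
    rw [Polynomial.splits_iff_card_roots.1 hgs, Polynomial.natDegree_map]
  have hnext : g.nextCoeff = algebraMap _ L (minpoly (RatFunc k) z).nextCoeff :=
    Polynomial.nextCoeff_map (algebraMap (RatFunc k) L).injective _
  have hs' : g.roots.sum = algebraMap _ L (-(minpoly (RatFunc k) z).nextCoeff) := by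
    rw [map_neg, ← hnext, hsum, neg_neg]
  let m := (minpoly (RatFunc k) z).natDegree
  have hmL : (m : L) ≠ 0 := by
    rw [Ne, CharP.cast_eq_zero_iff L p]
    exact fun h => absurd (Nat.le_of_dvd hm0 h) (by omega)
  have hmp : (m : L) ^ p = m := by
    have := ZMod.pow_card (m : ZMod p)
    have := congrArg (ZMod.castHom (dvd_refl p) L) this
    rwa [map_pow, map_natCast] at this
  let v : RatFunc k := -(minpoly (RatFunc k) z).nextCoeff / m
  refine ratFunc_pow_sub_ne_X (Fact.out : p.Prime).one_lt v ?_
  apply (algebraMap (RatFunc k) L).injective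
  have hv : algebraMap _ L v = g.roots.sum / m := by
    rw [hs', map_div₀, map_natCast]
  rw [map_sub, map_pow, hv, ← hz, div_pow, hmp]
  rw [hcard, sub_pow_char, mul_pow] at hk
  change _ - (m : L) ^ p * z ^ p = _ - (m : L) * z at hk
  rw [hmp] at hk
  field_simp
  linear_combination hk

end ArtinSchreier

section SplittingExtension

theorem isGalois_of_isSplittingField_mul {K L : Type*} [Field K] [Field L] [Algebra K L]
    {f g : Polynomial K} (hf : f.Separable) (hg : g.Separable)
    [hfg : Polynomial.IsSplittingField K L (f * g)] : IsGalois K L := by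
  have hn : Normal K L := Normal.of_isSplittingField (f * g)
  refine { __ := hn, to_isSeparable := ?_ }
  have hroot : ∀ x ∈ (f * g).rootSet L, IsSeparable K x := by
    intro x hx
    rw [Polynomial.mem_rootSet] at hx
    rw [map_mul] at hx
    rcases mul_eq_zero.1 hx.2 with h | h
    · exact hf.of_dvd (minpoly.dvd _ _ h)
    · exact hg.of_dvd (minpoly.dvd _ _ h)
  have h1 : IntermediateField.adjoin K ((f * g).rootSet L) = ⊤ := by
    rw [← top_le_iff, ← IntermediateField.toSubalgebra_le_toSubalgebra,
      IntermediateField.top_toSubalgebra, ← Polynomial.IsSplittingField.adjoin_rootSet L (f * g)]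
    exact IntermediateField.algebra_adjoin_le_adjoin _ _
  have h2 := (IntermediateField.isSeparable_adjoin_iff_isSeparable K L).2 hroot
  rw [h1] at h2
  exact Algebra.IsSeparable.of_algHom K _ (IntermediateField.topEquiv (F := K) (E := L)).symm.toAlgHom

variable {k : Type*} [Field k]

/-- The polynomial `Y^p - Y - X`. -/
noncomputable def artinSchreierPoly (k : Type*) [Field k] (p : ℕ) : Polynomial (Polynomial k) :=
  Polynomial.X ^ p - Polynomial.X - Polynomial.C Polynomial.X

theorem natDegree_artinSchreierPoly {p : ℕ} (hp : 1 < p) :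
    (artinSchreierPoly k p).natDegree = p := by
  unfold artinSchreierPoly
  rw [Polynomial.natDegree_sub_C, Polynomial.natDegree_sub_eq_left_of_natDegree_lt,
    Polynomial.natDegree_X_pow]
  rwa [Polynomial.natDegree_X_pow, Polynomial.natDegree_X]

theorem map_artinSchreierPoly {R : Type*} [Field R] (φ : k[X] →+* R) (p : ℕ) :
    (artinSchreierPoly k p).map φ =
      Polynomial.X ^ p - Polynomial.X - Polynomial.C (φ Polynomial.X) := by
  simp [artinSchreierPoly]

theorem splits_X_pow_sub_X {p : ℕ} [Fact p.Prime] [CharP k p] :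
    (Polynomial.X ^ p - Polynomial.X : Polynomial k).Splits := by
  let _ : Algebra (ZMod p) k := ZMod.algebra k p
  have h := (FiniteField.isSplittingField_sub (ZMod p) (ZMod p)).splits'
  rw [ZMod.card, Algebra.algebraMap_self, Polynomial.map_id] at h
  have := h.map (algebraMap (ZMod p) k)
  simpa using this

theorem exists_splitting_extension {p : ℕ} [Fact p.Prime] [CharP k p]
    (f : Polynomial (Polynomial k)) (hf : f ≠ 0)
    (hdeg : (f.map (Polynomial.evalRingHom (0 : k))).natDegree = f.natDegree)
    (hsep : (f.map (Polynomial.evalRingHom (0 : k))).Separable)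
    (hspl : (f.map (Polynomial.evalRingHom (0 : k))).Splits) :
    let h := f.map (algebraMap k[X] (RatFunc k)) *
      (artinSchreierPoly k p).map (algebraMap k[X] (RatFunc k))
    (f.map (algebraMap k[X] (RatFunc k))).Separable ∧ IsGalois (RatFunc k) h.SplittingField ∧
    (f.map (algebraMap k[X] h.SplittingField)).Splits ∧
    (∃ z : h.SplittingField, z ^ p - z = algebraMap (RatFunc k) _ RatFunc.X) ∧
    Nonempty (integralClosure k[X] h.SplittingField →ₐ[k[X]] PowerSeries k) := by
  intro h
  let _ : Algebra (RatFunc k) (LaurentSeries k) := RatFunc.liftAlgebra k (LaurentSeries k)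
  have _ : IsScalarTower k[X] (RatFunc k) (LaurentSeries k) :=
    RatFunc.isScalarTower_liftAlgebra k (LaurentSeries k)
  have hp := (Fact.out : p.Prime).one_lt
  have hinj : Function.Injective (algebraMap k[X] (RatFunc k)) := IsFractionRing.injective _ _
  have hA0 : artinSchreierPoly k p ≠ 0 := by
    intro h0
    have := natDegree_artinSchreierPoly (k := k) hp
    rw [h0, Polynomial.natDegree_zero] at this
    omega
  have sepL : ∀ F : Polynomial (Polynomial k), F ≠ 0 →
      (F.map (algebraMap k[X] (LaurentSeries k))).Splits ∧
      (F.map (algebraMap k[X] (LaurentSeries k))).roots.Nodup →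
      (F.map (algebraMap k[X] (RatFunc k))).Separable := by
    intro F hF hs
    have e : F.map (algebraMap k[X] (LaurentSeries k)) =
        (F.map (algebraMap k[X] (RatFunc k))).map (algebraMap (RatFunc k) (LaurentSeries k)) := by
      rw [Polynomial.map_map, ← IsScalarTower.algebraMap_eq]
    rw [e] at hs
    rw [← Polynomial.separable_map (algebraMap (RatFunc k) (LaurentSeries k)),
      ← Polynomial.nodup_roots_iff_of_splits _ hs.1]
    · exact hs.2
    · rw [← e]
      exact (Polynomial.map_ne_zero_iff (FaithfulSMul.algebraMap_injective _ _)).2 hF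
  have h1 := splits_and_nodup_roots_laurentSeries f hdeg hf hsep hspl
  have hA : (artinSchreierPoly k p).map (Polynomial.evalRingHom (0 : k)) =
      Polynomial.X ^ p - Polynomial.X := by
    rw [map_artinSchreierPoly]; simp
  have h2 := splits_and_nodup_roots_laurentSeries (artinSchreierPoly k p)
    (by rw [hA, natDegree_artinSchreierPoly hp]; exact FiniteField.X_pow_card_sub_X_natDegree_eq _ hp)
    hA0 (by rw [hA]; exact galois_poly_separable p p dvd_rfl) (by rw [hA]; exact splits_X_pow_sub_X)
  have hfs := sepL _ hf h1
  have hAs := sepL _ hA0 h2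
  have hspl' : (h.map (algebraMap (RatFunc k) h.SplittingField)).Splits :=
    Polynomial.SplittingField.splits h
  have hh0 : h ≠ 0 := mul_ne_zero ((Polynomial.map_ne_zero_iff hinj).2 hf)
    ((Polynomial.map_ne_zero_iff hinj).2 hA0)
  have hh0' : h.map (algebraMap (RatFunc k) h.SplittingField) ≠ 0 :=
    (Polynomial.map_ne_zero_iff (algebraMap (RatFunc k) h.SplittingField).injective).2 hh0
  refine ⟨hfs, isGalois_of_isSplittingField_mul hfs hAs, ?_, ?_, ?_⟩
  · refine hspl'.of_dvd hh0' ?_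
    rw [IsScalarTower.algebraMap_eq k[X] (RatFunc k) h.SplittingField, ← Polynomial.map_map]
    exact Polynomial.map_dvd _ (dvd_mul_right _ _)
  · have hAspl : (((artinSchreierPoly k p).map (algebraMap k[X] (RatFunc k))).map
        (algebraMap (RatFunc k) h.SplittingField)).Splits :=
      hspl'.of_dvd hh0' (Polynomial.map_dvd _ (dvd_mul_left _ _))
    obtain ⟨z, hz⟩ := hAspl.exists_eval_eq_zero (by
      rw [Polynomial.degree_map, Polynomial.degree_map_eq_of_injective hinj,
        Polynomial.degree_eq_natDegree hA0, natDegree_artinSchreierPoly hp]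
      exact_mod_cast (by omega : p ≠ 0))
    refine ⟨z, ?_⟩
    rw [map_artinSchreierPoly] at hz
    simpa [sub_eq_zero] using hz
  · have hL : (h.map (algebraMap (RatFunc k) (LaurentSeries k))).Splits := by
      simp only [h, Polynomial.map_mul, Polynomial.map_map]
      rw [← IsScalarTower.algebraMap_eq]
      exact h1.1.mul h2.1
    let s := (Polynomial.SplittingField.lift h hL)
    have _ : IsScalarTower k[X] (RatFunc k) h.SplittingField := inferInstance
    exact nonempty_algHom_powerSeries (s.restrictScalars k[X])

end SplittingExtension

section TraceCharacter

variable {p : ℕ} {Ω : Type*} [Field Ω] [CharP Ω p]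

/-- `ψ` composed with `x ↦ x + x^p + ⋯ + x^(p^(s-1))`, where this lies in the prime field. -/
noncomputable def psiTr (ψ : AddChar (ZMod p) ℂ) (s : ℕ) (x : Ω) : ℂ :=
  open Classical in
  if h : ∃ c : ZMod p, ZMod.castHom (dvd_refl p) Ω c = ∑ i ∈ Finset.range s, x ^ p ^ i
  then ψ h.choose else 0

variable [Fact p.Prime]

theorem psiTr_eq (ψ : AddChar (ZMod p) ℂ) {s : ℕ} {x : Ω} {c : ZMod p}
    (h : ZMod.castHom (dvd_refl p) Ω c = ∑ i ∈ Finset.range s, x ^ p ^ i) :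
    psiTr ψ s x = ψ c := by
  have hex : ∃ c : ZMod p, ZMod.castHom (dvd_refl p) Ω c = ∑ i ∈ Finset.range s, x ^ p ^ i :=
    ⟨c, h⟩
  unfold psiTr
  rw [dif_pos hex]
  congr 1
  exact (ZMod.castHom (dvd_refl p) Ω).injective (hex.choose_spec.trans h.symm)

theorem norm_psiTr_le (ψ : AddChar (ZMod p) ℂ) (s : ℕ) (x : Ω) : ‖psiTr ψ s x‖ ≤ 1 := by
  unfold psiTr
  split_ifs
  · rw [AddChar.norm_apply]
  · simp

omit [CharP Ω p] [Fact p.Prime] in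
theorem pow_sub_self_eq_sum {z x : Ω} [Fact p.Prime] [CharP Ω p] (h : z ^ p - z = x) (s : ℕ) :
    z ^ p ^ s - z = ∑ i ∈ Finset.range s, x ^ p ^ i := by
  induction s with
  | zero => simp
  | succ s ih =>
    rw [Finset.sum_range_succ, ← ih, ← h, sub_pow_char_pow, ← pow_mul, ← pow_succ']
    ring

theorem exists_cast_eq_of_pow_eq {x : Ω} (h : x ^ p = x) :
    ∃ c : ZMod p, ZMod.castHom (dvd_refl p) Ω c = x := by
  have h1 := (Subfield.mem_bot_iff_pow_eq_self (F := Ω) (p := p)).2 h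
  exact (bot_le : ⊥ ≤ (ZMod.castHom (dvd_refl p) Ω).fieldRange) h1

end TraceCharacter

section RootCount

variable {k L : Type*} [Field k] [Field L] [Algebra (RatFunc k) L] [Algebra k L]
  [Algebra k[X] L] [IsScalarTower k[X] (RatFunc k) L] [IsScalarTower k k[X] L]
  {Ω : Type*} [Field Ω] [Algebra k Ω]

omit [Algebra (RatFunc k) L] [IsScalarTower k[X] (RatFunc k) L] in
theorem algHom_algebraMap_polynomial (h : integralClosure k[X] L →ₐ[k] Ω) (B : k[X]) :
    h (algebraMap k[X] _ B) = Polynomial.aeval (h (algebraMap k[X] _ Polynomial.X)) B := by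
  change (h.comp ((Algebra.ofId k[X] (integralClosure k[X] L)).restrictScalars k)) B = _
  congr 1
  ext
  simp

theorem exists_separating_polynomial (f : Polynomial (Polynomial k)) (hf : f ≠ 0) :
    ∃ B : k[X], B ≠ 0 ∧ ∀ h : integralClosure k[X] L →ₐ[k] Ω,
      Polynomial.aeval (h (algebraMap k[X] _ Polynomial.X)) B ≠ 0 →
      Polynomial.aeval (h (algebraMap k[X] _ Polynomial.X)) f.leadingCoeff ≠ 0 ∧
      ∀ y ∈ f.rootSet L, ∀ y' ∈ f.rootSet L, y ≠ y' → ∀ a a' : integralClosure k[X] L,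
        (a : L) = algebraMap k[X] L f.leadingCoeff * y →
        (a' : L) = algebraMap k[X] L f.leadingCoeff * y' → h a ≠ h a' := by
  classical
  have hinj : Function.Injective (algebraMap k[X] L) := by
    rw [IsScalarTower.algebraMap_eq k[X] (RatFunc k) L]
    exact (algebraMap (RatFunc k) L).injective.comp (IsFractionRing.injective _ _)
  have _ : FaithfulSMul k[X] L := (faithfulSMul_iff_algebraMap_injective _ _).2 hinj
  have hlc : f.leadingCoeff ≠ 0 := Polynomial.leadingCoeff_ne_zero.2 hf
  have hD : ∀ a : integralClosure k[X] L, ∃ D : k[X], a ≠ 0 → D ≠ 0 ∧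
      a ∣ algebraMap k[X] _ D := by
    intro a
    by_cases ha : a = 0
    · exact ⟨0, fun h => absurd ha h⟩
    · have hint : IsIntegral k[X] a := Algebra.IsIntegral.isIntegral a
      obtain ⟨D, hD0, hD⟩ := hint.isAlgebraic.exists_nonzero_dvd (mem_nonZeroDivisors_of_ne_zero ha)
      exact ⟨D, fun _ => ⟨hD0, hD⟩⟩
  choose D hD using hD
  have hu : ∀ y ∈ f.rootSet L, ∃ a : integralClosure k[X] L,
      (a : L) = algebraMap k[X] L f.leadingCoeff * y := by
    intro y hy
    rw [Polynomial.mem_rootSet] at hy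
    have := isIntegral_leadingCoeff_smul f y hy.2
    rw [Algebra.smul_def] at this
    exact ⟨⟨_, this⟩, rfl⟩
  choose! u hu using hu
  let R := (f.rootSet L).toFinset
  refine ⟨f.leadingCoeff * ∏ w ∈ R.offDiag, D (u w.1 - u w.2), ?_, fun h hB => ?_⟩
  · refine mul_ne_zero hlc (Finset.prod_ne_zero_iff.2 fun w hw => ?_)
    rw [Finset.mem_offDiag, Set.mem_toFinset, Set.mem_toFinset] at hw
    refine (hD _ fun h0 => hw.2.2 ?_).1
    have h1 : ((u w.1 : L)) = u w.2 := congrArg Subtype.val (sub_eq_zero.1 h0)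
    rw [hu _ hw.1, hu _ hw.2.1] at h1
    exact mul_left_cancel₀ (fun h => hlc (hinj (h.trans (map_zero _).symm))) h1
  · rw [map_mul] at hB
    refine ⟨left_ne_zero_of_mul hB, fun y hy y' hy' hne a a' ha ha' haa => ?_⟩
    have hB2 := right_ne_zero_of_mul hB
    rw [map_prod, Finset.prod_ne_zero_iff] at hB2
    have hw := hB2 (y, y') (by
      rw [Finset.mem_offDiag, Set.mem_toFinset, Set.mem_toFinset]; exact ⟨hy, hy', hne⟩)
    have e1 : a = u y := Subtype.ext (ha.trans (hu y hy).symm)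
    have e2 : a' = u y' := Subtype.ext (ha'.trans (hu y' hy').symm)
    have hne' : u y - u y' ≠ 0 := by
      intro h0
      have h1 : ((u y : L)) = u y' := congrArg Subtype.val (sub_eq_zero.1 h0)
      rw [hu _ hy, hu _ hy'] at h1
      exact hne (mul_left_cancel₀ (fun h => hlc (hinj (h.trans (map_zero _).symm))) h1)
    obtain ⟨c, hc⟩ := (hD _ hne').2
    apply hw
    rw [← algHom_algebraMap_polynomial, hc, map_mul, map_sub, ← e1, ← e2, haa, sub_self, zero_mul]

/-- The fixed roots of a specialization are counted by the fixed roots upstairs. -/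
theorem card_filter_roots_eq [DecidableEq Ω] [DecidableEq L] (f : Polynomial (Polynomial k))
    (hcard : (f.map (algebraMap k[X] L)).roots.toFinset.card = f.natDegree)
    (h : integralClosure k[X] L →ₐ[k] Ω) {x : Ω}
    (hx : h (algebraMap k[X] _ Polynomial.X) = x)
    (hlc : Polynomial.aeval x f.leadingCoeff ≠ 0)
    (hsep : ∀ y ∈ f.rootSet L, ∀ y' ∈ f.rootSet L, y ≠ y' → ∀ a a' : integralClosure k[X] L,
        (a : L) = algebraMap k[X] L f.leadingCoeff * y →
        (a' : L) = algebraMap k[X] L f.leadingCoeff * y' → h a ≠ h a')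
    (σ : L ≃ₐ[RatFunc k] L) (q : ℕ)
    (hσ : ∀ a a' : integralClosure k[X] L, (a' : L) = σ a → h a' = h a ^ q) :
    ((f.map (Polynomial.eval₂RingHom (algebraMap k Ω) x)).roots.toFinset.filter
        fun y => y ^ q = y).card =
      ((f.map (algebraMap k[X] L)).roots.toFinset.filter fun y => σ y = y).card := by
  let R := (f.map (algebraMap k[X] L)).roots.toFinset
  let ev := Polynomial.eval₂RingHom (algebraMap k Ω) x
  have hinj : Function.Injective (algebraMap k[X] L) := by
    rw [IsScalarTower.algebraMap_eq k[X] (RatFunc k) L]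
    exact (algebraMap (RatFunc k) L).injective.comp (IsFractionRing.injective _ _)
  have _ : FaithfulSMul k[X] L := (faithfulSMul_iff_algebraMap_injective _ _).2 hinj
  have hf : f ≠ 0 := by rintro rfl; simp at hlc
  have hR : ∀ y, y ∈ R ↔ y ∈ f.rootSet L := by
    intro y
    rw [Polynomial.mem_rootSet_of_ne hf, Multiset.mem_toFinset,
      Polynomial.mem_roots ((Polynomial.map_ne_zero_iff hinj).2 hf), Polynomial.IsRoot,
      Polynomial.eval_map_algebraMap]
  have hroot : ∀ y ∈ R, Polynomial.aeval y f = 0 := fun y hy =>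
    (Polynomial.mem_rootSet.1 ((hR y).1 hy)).2
  have hu : ∀ y ∈ R, ∃ a : integralClosure k[X] L,
      (a : L) = algebraMap k[X] L f.leadingCoeff * y := by
    intro y hy
    have := isIntegral_leadingCoeff_smul f y (hroot y hy)
    rw [Algebra.smul_def] at this
    exact ⟨⟨_, this⟩, rfl⟩
  choose! u hu using hu
  have hev : ∀ r : k[X], h (algebraMap k[X] _ r) = ev r := by
    intro r
    rw [algHom_algebraMap_polynomial, hx]
    rfl
  have hlc' : ev f.leadingCoeff ≠ 0 := hlc
  let η : L → Ω := fun y => h (u y) / ev f.leadingCoeff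
  have hη : ∀ y ∈ R, f.eval₂ ev (η y) = 0 := by
    intro y hy
    have h1 : (f.scaleRoots f.leadingCoeff).eval₂ (algebraMap k[X] (integralClosure k[X] L)) (u y)
        = 0 := by
      apply Subtype.val_injective
      change algebraMap (integralClosure k[X] L) L _ = algebraMap (integralClosure k[X] L) L 0
      rw [Polynomial.hom_eval₂, map_zero, ← IsScalarTower.algebraMap_eq]
      change Polynomial.eval₂ _ ((u y : L)) _ = 0
      rw [hu y hy, Polynomial.scaleRoots_eval₂_mul]
      have := hroot y hy
      rw [Polynomial.aeval_def] at this
      rw [this, mul_zero]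
    have h2 := congrArg h h1
    rw [map_zero] at h2
    change h.toRingHom _ = 0 at h2
    rw [Polynomial.hom_eval₂] at h2
    have e : h.toRingHom.comp (algebraMap k[X] (integralClosure k[X] L)) = ev :=
      RingHom.ext hev
    have e2 : h.toRingHom (u y) = ev f.leadingCoeff * η y := (mul_div_cancel₀ _ hlc').symm
    rw [e, e2, Polynomial.scaleRoots_eval₂_mul] at h2
    exact (mul_eq_zero.1 h2).resolve_left (pow_ne_zero _ hlc')
  have hηinj : Set.InjOn η R := by
    intro y hy y' hy' hyy
    by_contra hne
    refine hsep y ((hR y).1 hy) y' ((hR y').1 hy') hne _ _ (hu y hy) (hu y' hy') ?_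
    exact (div_left_inj' hlc').1 hyy
  have hf0 : f.map ev ≠ 0 := by
    intro h0
    have := congrArg (fun g : Polynomial Ω => g.coeff f.natDegree) h0
    simp only [Polynomial.coeff_map, Polynomial.coeff_zero] at this
    exact hlc' this
  have himg : R.image η = (f.map ev).roots.toFinset := by
    refine Finset.eq_of_subset_of_card_le ?_ ?_
    · intro z hz
      obtain ⟨y, hy, rfl⟩ := Finset.mem_image.1 hz
      rw [Multiset.mem_toFinset, Polynomial.mem_roots hf0, Polynomial.IsRoot, Polynomial.eval_map]
      exact hη y hy
    · rw [Finset.card_image_of_injOn hηinj, hcard]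
      exact (Multiset.toFinset_card_le _).trans
        ((Polynomial.card_roots' _).trans Polynomial.natDegree_map_le)
  change ((f.map ev).roots.toFinset.filter _).card = (R.filter _).card
  rw [← himg, Finset.filter_image, Finset.card_image_of_injOn
    (hηinj.mono (Finset.coe_subset.2 (Finset.filter_subset _ _)))]
  congr 1
  refine Finset.filter_congr fun y hy => ?_
  have hσR : σ y ∈ R := by
    rw [hR, Polynomial.mem_rootSet_of_ne hf]
    have := hroot y hy
    have e : Polynomial.aeval (σ y) f = (σ.restrictScalars k[X]) (Polynomial.aeval y f) := by
      rw [← Polynomial.aeval_algHom_apply]; rfl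
    rw [e, this, map_zero]
  have hσx : ev f.leadingCoeff ^ q = ev f.leadingCoeff := by
    rw [← hev]
    symm
    refine hσ _ _ ?_
    exact ((σ.restrictScalars k[X]).commutes f.leadingCoeff).symm
  have hσu : h (u (σ y)) = h (u y) ^ q := by
    refine hσ _ _ ?_
    rw [hu _ hσR, hu _ hy, map_mul]
    congr 1
    exact ((σ.restrictScalars k[X]).commutes f.leadingCoeff).symm
  have e : η y ^ q = η (σ y) := by
    change (h (u y) / ev f.leadingCoeff) ^ q = h (u (σ y)) / ev f.leadingCoeff
    rw [div_pow, hσx, hσu]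
  rw [e]
  exact ⟨fun hh => hηinj hσR hy hh, fun hh => by rw [hh]⟩

end RootCount

section StepanovBound

theorem AddChar.eq_zero_of_eq_one {p : ℕ} [Fact p.Prime] {ψ : AddChar (ZMod p) ℂ} (hψ : ψ ≠ 1)
    {a : ZMod p} (ha : ψ a = 1) : a = 0 := by
  by_contra h
  refine hψ (DFunLike.ext _ _ fun b => ?_)
  have : b = (b / a).val • a := by
    rw [nsmul_eq_mul, ZMod.natCast_zmod_val, div_mul_cancel₀ b h]
  rw [this, AddChar.map_nsmul_eq_pow, ha, one_pow, AddChar.one_apply]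

variable {k L : Type*} [Field k] [Field L] [Algebra (RatFunc k) L] [Algebra k L]
  [IsScalarTower k (RatFunc k) L] [Algebra k[X] L] [IsScalarTower k[X] (RatFunc k) L]
  [IsScalarTower k k[X] L] [FiniteDimensional (RatFunc k) L] [IsGalois (RatFunc k) L]
  {Ω : Type*} [Field Ω] [Algebra k Ω] [IsAlgClosed Ω] {p : ℕ} [Fact p.Prime] [CharP k p]
  [CharP L p] [CharP Ω p]

theorem exists_norm_sum_psiTr_le_of_splits
    (τ : integralClosure k[X] L →ₐ[k[X]] PowerSeries k)
    (f : Polynomial (Polynomial k)) (hf : f ≠ 0) (hfp : f.natDegree < p)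
    (hfs : (f.map (algebraMap k[X] (RatFunc k))).Separable)
    (hspl : (f.map (algebraMap k[X] L)).Splits)
    {z : L} (hz : z ^ p - z = algebraMap (RatFunc k) L RatFunc.X)
    (ψ : AddChar (ZMod p) ℂ) (hψ : ψ ≠ 1) [DecidableEq Ω] :
    ∃ C Q0 : ℕ, ∀ j, Q0 ≤ p ^ j → (∀ c : k, c ^ (p ^ j) ^ 2 = c) →
      ‖∑ x ∈ powFixed Ω ((p ^ j) ^ 2), psiTr ψ (2 * j) x *
        ((f.map (Polynomial.eval₂RingHom (algebraMap k Ω) x)).roots.toFinset.filter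
          fun y => y ^ (p ^ j) ^ 2 = y).card‖ ≤ C * p ^ j := by
  classical
  have hinj : Function.Injective (algebraMap k[X] L) := by
    rw [IsScalarTower.algebraMap_eq k[X] (RatFunc k) L]
    exact (algebraMap (RatFunc k) L).injective.comp (IsFractionRing.injective _ _)
  obtain ⟨B, hB0, hB⟩ := exists_separating_polynomial (L := L) (Ω := Ω) f hf
  obtain ⟨C, Q0, hC⟩ := exists_norm_sum_powFixed_le (L := L) (Ω := Ω) τ (p := p) B hB0
  let e := f.natDegree
  let R := (f.map (algebraMap k[X] L)).roots.toFinset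
  let f' := f.map (algebraMap k[X] (RatFunc k))
  have hf' : f' ≠ 0 := hfs.ne_zero
  have hfmap : f.map (algebraMap k[X] L) = f'.map (algebraMap (RatFunc k) L) := by
    rw [Polynomial.map_map, ← IsScalarTower.algebraMap_eq]
  have hRcard : R.card = e := by
    have h1 : (f.map (algebraMap k[X] L)).roots.Nodup := by
      rw [hfmap]; exact Polynomial.nodup_roots hfs.map
    change (Multiset.toFinset _).card = _
    rw [Multiset.toFinset_card_of_nodup h1, Polynomial.splits_iff_card_roots.1 hspl,
      Polynomial.natDegree_map_eq_of_injective hinj]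
  have hRroot : ∀ y ∈ R, Polynomial.aeval y f' = 0 := by
    intro y hy
    rw [Multiset.mem_toFinset, hfmap, Polynomial.mem_roots
      ((Polynomial.map_ne_zero_iff (algebraMap (RatFunc k) L).injective).2 hf'), Polynomial.IsRoot,
      Polynomial.eval_map_algebraMap] at hy
    exact hy
  have hc : ∀ σ : L ≃ₐ[RatFunc k] L, ∃ c : ZMod p,
      ZMod.castHom (dvd_refl p) L c = σ z - z := by
    intro σ
    refine exists_cast_eq_of_pow_eq (pow_eq_self_of_artinSchreier hz ?_)
    rw [← map_pow, ← map_sub, hz, AlgEquiv.commutes]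
  choose c hc using hc
  have hcmul : ∀ σ τ, c (σ * τ) = c σ + c τ := by
    intro σ τ
    apply (ZMod.castHom (dvd_refl p) L).injective
    have h1 : τ z = z + ZMod.castHom (dvd_refl p) L (c τ) := by rw [hc]; ring
    have h2 : ∀ a : ZMod p, σ (ZMod.castHom (dvd_refl p) L a) = ZMod.castHom (dvd_refl p) L a := by
      intro a
      obtain ⟨n, rfl⟩ := ZMod.natCast_zmod_surjective a
      rw [map_natCast, map_natCast]
    rw [map_add, hc (σ * τ), AlgEquiv.mul_apply, h1, map_add, h2, hc σ]
    ring
  let g : (L ≃ₐ[RatFunc k] L) → ℂ := fun σ => ψ (c σ) * (R.filter fun y => σ y = y).card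
  have hg0 : ∑ σ, g σ = 0 := by
    have h1 : ∀ σ, g σ = ∑ y ∈ R, if σ y = y then ψ (c σ) else 0 := by
      intro σ
      rw [← Finset.sum_filter, Finset.sum_const, nsmul_eq_mul, mul_comm]
    simp only [h1]
    rw [Finset.sum_comm]
    refine Finset.sum_eq_zero fun y hy => ?_
    obtain ⟨σ₀, hσ₀, hσz⟩ := exists_algEquiv_fix_ne hz hf'
      (by rw [Polynomial.natDegree_map_eq_of_injective (IsFractionRing.injective _ _)]; exact hfp)
      (hRroot y hy)
    have hne : ψ (c σ₀) ≠ 1 := by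
      intro h
      have := AddChar.eq_zero_of_eq_one hψ h
      have h2 := hc σ₀
      rw [this, map_zero] at h2
      exact hσz (sub_eq_zero.1 h2.symm)
    have hmul : (∑ σ : L ≃ₐ[RatFunc k] L, if σ y = y then ψ (c σ) else 0) =
        ψ (c σ₀) * ∑ σ : L ≃ₐ[RatFunc k] L, if σ y = y then ψ (c σ) else 0 := by
      rw [Finset.mul_sum]
      rw [← Equiv.sum_comp (Equiv.mulLeft σ₀)]
      refine Finset.sum_congr rfl fun σ _ => ?_
      have h3 : (σ₀ * σ) y = y ↔ σ y = y := by
        rw [AlgEquiv.mul_apply]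
        exact ⟨fun h => σ₀.injective (h.trans hσ₀.symm), fun h => by rw [h, hσ₀]⟩
      simp only [Equiv.coe_mulLeft, h3, hcmul, AddChar.map_add_eq_mul]
      split_ifs <;> simp
    have h4 : (1 - ψ (c σ₀)) * (∑ σ : L ≃ₐ[RatFunc k] L, if σ y = y then ψ (c σ) else 0) = 0 := by
      rw [sub_mul, one_mul, ← hmul, sub_self]
    exact (mul_eq_zero.1 h4).resolve_left (sub_ne_zero.2 hne.symm)
  have hzint : IsIntegral k[X] z := by
    refine ⟨artinSchreierPoly k p, ?_, ?_⟩
    · unfold artinSchreierPoly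
      rw [sub_sub]
      refine Polynomial.monic_X_pow_sub ?_
      rw [Polynomial.degree_X_add_C]
      exact_mod_cast (Fact.out : p.Prime).one_lt
    · rw [← Polynomial.eval_map, map_artinSchreierPoly]
      rw [IsScalarTower.algebraMap_apply k[X] (RatFunc k) L, RatFunc.algebraMap_X, ← hz]
      simp
  let zA : integralClosure k[X] L := ⟨z, hzint⟩
  have hzA : zA ^ p - zA = algebraMap k[X] _ Polynomial.X := by
    apply Subtype.val_injective
    change z ^ p - z = algebraMap k[X] L Polynomial.X
    rw [IsScalarTower.algebraMap_apply k[X] (RatFunc k) L, RatFunc.algebraMap_X, ← hz]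
  refine ⟨C * e, Q0, fun j hj hk => ?_⟩
  have hmain := hC j hj hk (fun x => psiTr ψ (2 * j) x *
        ((f.map (Polynomial.eval₂RingHom (algebraMap k Ω) x)).roots.toFinset.filter
          fun y => y ^ (p ^ j) ^ 2 = y).card) g e ?_ ?_ hg0 ?_
  · refine hmain.trans (le_of_eq ?_)
    push_cast; ring
  · intro σ
    simp only [g]
    rw [norm_mul, AddChar.norm_apply, one_mul, Complex.norm_natCast, ← hRcard]
    exact_mod_cast Finset.card_le_card (Finset.filter_subset _ _)
  · intro x
    rw [norm_mul, Complex.norm_natCast]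
    refine (mul_le_of_le_one_left (Nat.cast_nonneg _) (norm_psiTr_le _ _ _)).trans ?_
    exact_mod_cast (Finset.card_le_card (Finset.filter_subset _ _)).trans
      ((Multiset.toFinset_card_le _).trans
        ((Polynomial.card_roots' _).trans Polynomial.natDegree_map_le))
  · intro h σ hBx hxq hσ
    obtain ⟨hlc, hsep⟩ := hB h hBx
    simp only [g]
    rw [card_filter_roots_eq f hRcard h rfl hlc hsep σ _ hσ]
    congr 1
    refine psiTr_eq ψ ?_
    have h1 : h zA ^ p - h zA = h (algebraMap k[X] _ Polynomial.X) := by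
      rw [← map_pow, ← map_sub, hzA]
    rw [← pow_sub_self_eq_sum h1]
    have hpow : p ^ (2 * j) = (p ^ j) ^ 2 := by rw [← pow_mul, mul_comm]
    obtain ⟨n, hn⟩ := ZMod.natCast_zmod_surjective (c σ)
    have h2 : ((zA + (n : integralClosure k[X] L) : integralClosure k[X] L) : L) = σ zA := by
      have := hc σ
      rw [← hn, map_natCast] at this
      change z + algebraMap (integralClosure k[X] L) L n = σ z
      rw [map_natCast, this]; ring
    have h3 := hσ zA _ h2
    rw [map_add, map_natCast] at h3
    rw [← hn, map_natCast, hpow, ← h3]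
    ring

omit [Algebra (RatFunc k) L] [Algebra k L]
  [IsScalarTower k (RatFunc k) L] [Algebra k[X] L] [IsScalarTower k[X] (RatFunc k) L]
  [IsScalarTower k k[X] L] [FiniteDimensional (RatFunc k) L] [IsGalois (RatFunc k) L]
  [CharP L p] in
/-- Square-root cancellation over large square fields, for a curve which is completely split and
unramified above `x = 0`. -/
theorem exists_norm_sum_psiTr_le (f : Polynomial (Polynomial k)) (hf : f ≠ 0)
    (hfp : f.natDegree < p)
    (hdeg : (f.map (Polynomial.evalRingHom (0 : k))).natDegree = f.natDegree)
    (hsep : (f.map (Polynomial.evalRingHom (0 : k))).Separable)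
    (hspl : (f.map (Polynomial.evalRingHom (0 : k))).Splits)
    (ψ : AddChar (ZMod p) ℂ) (hψ : ψ ≠ 1) [DecidableEq Ω] :
    ∃ C Q0 : ℕ, ∀ j, Q0 ≤ p ^ j → (∀ c : k, c ^ (p ^ j) ^ 2 = c) →
      ‖∑ x ∈ powFixed Ω ((p ^ j) ^ 2), psiTr ψ (2 * j) x *
        ((f.map (Polynomial.eval₂RingHom (algebraMap k Ω) x)).roots.toFinset.filter
          fun y => y ^ (p ^ j) ^ 2 = y).card‖ ≤ C * p ^ j := by
  obtain ⟨hs, hG, hsp, ⟨z, hz⟩, ⟨τ⟩⟩ := exists_splitting_extension (p := p) f hf hdeg hsep hspl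
  let h := f.map (algebraMap k[X] (RatFunc k)) *
      (artinSchreierPoly k p).map (algebraMap k[X] (RatFunc k))
  have _ : IsScalarTower k k[X] h.SplittingField := IsScalarTower.of_algebraMap_eq fun c => by
    rw [IsScalarTower.algebraMap_apply k (RatFunc k) h.SplittingField,
      IsScalarTower.algebraMap_apply k[X] (RatFunc k) h.SplittingField,
      IsScalarTower.algebraMap_apply k k[X] (RatFunc k)]
  have _ : CharP h.SplittingField p :=
    charP_of_injective_algebraMap (algebraMap k h.SplittingField).injective p
  exact exists_norm_sum_psiTr_le_of_splits (L := h.SplittingField) τ f hf hfp hs hsp hz ψ hψ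

end StepanovBound

section PointSum

variable {k : Type*} [Field k]

theorem separable_map_ratFunc_of_irreducible {f : Polynomial (Polynomial k)} (hf : Irreducible f)
    {p : ℕ} [Fact p.Prime] [CharP k p] (h0 : 0 < f.natDegree) (hp : f.natDegree < p) :
    (f.map (algebraMap k[X] (RatFunc k))).Separable := by
  have hinj : Function.Injective (algebraMap k[X] (RatFunc k)) := IsFractionRing.injective _ _
  have hprim : f.IsPrimitive := hf.isPrimitive h0.ne'
  have hirr : Irreducible (f.map (algebraMap k[X] (RatFunc k))) :=
    hprim.irreducible_iff_irreducible_map_fraction_map.1 hf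
  rw [Polynomial.separable_iff_derivative_ne_zero hirr]
  intro hd
  have h1 := congrArg (fun g : Polynomial (RatFunc k) => g.coeff (f.natDegree - 1)) hd
  simp only [Polynomial.coeff_derivative, Polynomial.coeff_zero] at h1
  rw [Nat.sub_add_cancel h0, Polynomial.coeff_map, mul_eq_zero] at h1
  rcases h1 with h1 | h1
  · rw [map_eq_zero_iff _ hinj] at h1
    exact hf.ne_zero (Polynomial.leadingCoeff_eq_zero.1 h1)
  · have h2 : ((f.natDegree : ℕ) : RatFunc k) = 0 := by
      rw [← h1]
      conv_lhs => rw [← Nat.sub_add_cancel h0]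
      push_cast; rfl
    have _ : CharP (RatFunc k) p := charP_of_injective_algebraMap (algebraMap k (RatFunc k)).injective p
    rw [CharP.cast_eq_zero_iff (RatFunc k) p] at h2
    exact absurd (Nat.le_of_dvd h0 h2) (by omega)

/-- A discriminant-like element: away from its zeros the specializations of `f` are separable. -/
theorem exists_ne_zero_bezout_of_separable {f : Polynomial (Polynomial k)}
    (hf : (f.map (algebraMap k[X] (RatFunc k))).Separable) :
    ∃ (r : k[X]) (a b : Polynomial (Polynomial k)), r ≠ 0 ∧
      a * f + b * Polynomial.derivative f = Polynomial.C r := by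
  have hinj : Function.Injective (algebraMap k[X] (RatFunc k)) := IsFractionRing.injective _ _
  obtain ⟨A, B, hAB⟩ := hf
  obtain ⟨b₁, hb₁, h₁⟩ := IsLocalization.integerNormalization_spec (nonZeroDivisors k[X]) A
  obtain ⟨b₂, hb₂, h₂⟩ := IsLocalization.integerNormalization_spec (nonZeroDivisors k[X]) B
  refine ⟨b₁ * b₂,
    Polynomial.C b₂ * IsLocalization.integerNormalization (nonZeroDivisors k[X]) A,
    Polynomial.C b₁ * IsLocalization.integerNormalization (nonZeroDivisors k[X]) B,
    mul_ne_zero (nonZeroDivisors.ne_zero hb₁) (nonZeroDivisors.ne_zero hb₂), ?_⟩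
  apply Polynomial.map_injective _ hinj
  simp only [Polynomial.map_add, Polynomial.map_mul, Polynomial.map_C, h₁, h₂, map_mul]
  rw [← Polynomial.derivative_map, Algebra.smul_def, Algebra.smul_def,
    IsScalarTower.algebraMap_apply k[X] (RatFunc k) (Polynomial (RatFunc k)),
    IsScalarTower.algebraMap_apply k[X] (RatFunc k) (Polynomial (RatFunc k)),
    Polynomial.algebraMap_eq]
  linear_combination Polynomial.C (algebraMap k[X] (RatFunc k) b₁) *
    Polynomial.C (algebraMap k[X] (RatFunc k) b₂) * hAB

variable {p : ℕ} [Fact p.Prime] {Ω : Type*} [Field Ω] [CharP Ω p]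

/-- For `x` in the field with `p^s` elements, the partial trace lies in the prime field. -/
theorem exists_cast_eq_trace {s : ℕ} {x : Ω} (hx : x ^ p ^ s = x) :
    ∃ c : ZMod p, ZMod.castHom (dvd_refl p) Ω c = ∑ i ∈ Finset.range s, x ^ p ^ i := by
  refine exists_cast_eq_of_pow_eq ?_
  rw [sum_pow_char]
  have h1 := Finset.sum_range_succ' (fun i => x ^ p ^ i) s
  rw [Finset.sum_range_succ] at h1
  simp only [hx, pow_zero, pow_one] at h1
  have h2 := add_right_cancel h1
  rw [h2]
  exact Finset.sum_congr rfl fun i _ => by rw [pow_succ, pow_mul]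

theorem psiTr_add (ψ : AddChar (ZMod p) ℂ) {s : ℕ} {x y : Ω} (hx : x ^ p ^ s = x)
    (hy : y ^ p ^ s = y) : psiTr ψ s (x + y) = psiTr ψ s x * psiTr ψ s y := by
  obtain ⟨c, hc⟩ := exists_cast_eq_trace (p := p) hx
  obtain ⟨d, hd⟩ := exists_cast_eq_trace (p := p) hy
  rw [psiTr_eq ψ hc, psiTr_eq ψ hd, ← AddChar.map_add_eq_mul]
  refine psiTr_eq ψ ?_
  rw [map_add, hc, hd, ← Finset.sum_add_distrib]
  exact Finset.sum_congr rfl fun i _ => by rw [add_pow_char_pow]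

theorem norm_psiTr (ψ : AddChar (ZMod p) ℂ) {s : ℕ} {x : Ω} (hx : x ^ p ^ s = x) :
    ‖psiTr ψ s x‖ = 1 := by
  obtain ⟨c, hc⟩ := exists_cast_eq_trace (p := p) hx
  rw [psiTr_eq ψ hc, AddChar.norm_apply]

variable (Ω) in
/-- The sum of `ψ (Tr x)` over the points of the curve `f = 0` with coordinates in the field of
`p^s` elements. -/
noncomputable def pointSum [Algebra (ZMod p) Ω] (ψ : AddChar (ZMod p) ℂ)
    (f : Polynomial (Polynomial (ZMod p))) (s : ℕ) : ℂ :=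
  open Classical in
  ∑ x ∈ powFixed Ω (p ^ s), psiTr ψ s x *
    ((f.map (Polynomial.eval₂RingHom (algebraMap (ZMod p) Ω) x)).roots.toFinset.filter
      fun y => y ^ p ^ s = y).card

variable [Algebra (ZMod p) Ω] [IsAlgClosed Ω] [Algebra.IsAlgebraic (ZMod p) Ω]

theorem exists_norm_pointSum_le {f : Polynomial (Polynomial (ZMod p))} (hf : Irreducible f)
    (h0 : 0 < f.natDegree) (hp : f.natDegree < p) (ψ : AddChar (ZMod p) ℂ) (hψ : ψ ≠ 1) :
    ∃ C Q0 t : ℕ, 0 < t ∧ ∀ j, 0 < j → t ∣ j → Q0 ≤ p ^ j →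
      ‖pointSum Ω ψ f (2 * j)‖ ≤ C * p ^ j := by
  classical
  obtain ⟨r, a, b, hr, hab⟩ :=
    exists_ne_zero_bezout_of_separable (separable_map_ratFunc_of_irreducible hf h0 hp)
  have hinjΩ : Function.Injective (algebraMap (ZMod p) Ω) := (algebraMap (ZMod p) Ω).injective
  obtain ⟨x₁, hx₁⟩ : ∃ x₁ : Ω, (r * f.leadingCoeff).eval₂ (algebraMap (ZMod p) Ω) x₁ ≠ 0 := by
    have h1 : (r * f.leadingCoeff).map (algebraMap (ZMod p) Ω) ≠ 0 :=
      (Polynomial.map_ne_zero_iff hinjΩ).2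
        (mul_ne_zero hr (Polynomial.leadingCoeff_ne_zero.2 hf.ne_zero))
    have _ : Infinite Ω := IsAlgClosed.instInfinite
    by_contra! hcon
    exact h1 (Polynomial.funext fun x => by rw [Polynomial.eval_map, hcon, Polynomial.eval_zero])
  rw [Polynomial.eval₂_mul] at hx₁
  let ev := Polynomial.eval₂RingHom (algebraMap (ZMod p) Ω) x₁
  have hrx : ev r ≠ 0 := left_ne_zero_of_mul hx₁
  have hlx : ev f.leadingCoeff ≠ 0 := right_ne_zero_of_mul hx₁
  let S : Set Ω := insert x₁ ((f.map ev).roots.toFinset : Set Ω)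
  have hSfin : S.Finite := (Finset.finite_toSet _).insert _
  have _ : Finite S := hSfin
  let k := IntermediateField.adjoin (ZMod p) S
  have _ : FiniteDimensional (ZMod p) k :=
    IntermediateField.finiteDimensional_adjoin fun x _ => Algebra.IsIntegral.isIntegral x
  have _ : Finite k := Module.finite_of_finite (ZMod p)
  let _ : Fintype k := Fintype.ofFinite k
  have _ : CharP k p := charP_of_injective_algebraMap (algebraMap (ZMod p) k).injective p
  let x₀ : k := ⟨x₁, IntermediateField.subset_adjoin _ _ (Set.mem_insert _ _)⟩
  let φ : Polynomial (ZMod p) →+* Polynomial k :=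
    Polynomial.eval₂RingHom (Polynomial.C.comp (algebraMap (ZMod p) k))
      (Polynomial.X + Polynomial.C x₀)
  have hφev : ∀ x : Ω, (Polynomial.eval₂RingHom (algebraMap k Ω) x).comp φ =
      Polynomial.eval₂RingHom (algebraMap (ZMod p) Ω) (x + x₁) := by
    intro x
    refine Polynomial.ringHom_ext (fun c => ?_) ?_
    · simp only [φ, RingHom.comp_apply, Polynomial.coe_eval₂RingHom, Polynomial.eval₂_C]
      exact (IsScalarTower.algebraMap_apply (ZMod p) k Ω c).symm
    · simp only [φ, RingHom.comp_apply, Polynomial.coe_eval₂RingHom, Polynomial.eval₂_X,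
        Polynomial.eval₂_add, Polynomial.eval₂_C]
      rfl
  have hφ0 : (algebraMap k Ω).comp ((Polynomial.evalRingHom 0).comp φ) = ev := by
    have h := hφev 0
    rw [zero_add] at h
    refine Eq.trans ?_ h
    rw [← RingHom.comp_assoc]
    congr 1
    refine Polynomial.ringHom_ext (fun c => ?_) ?_ <;> simp
  let g := f.map φ
  have hg0 : (g.map (Polynomial.evalRingHom 0)).map (algebraMap k Ω) = f.map ev := by
    simp only [g, Polynomial.map_map, hφ0]
  have hdeg : (f.map ev).natDegree = f.natDegree :=
    Polynomial.natDegree_map_of_leadingCoeff_ne_zero _ hlx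
  have hd1 : (g.map (Polynomial.evalRingHom 0)).natDegree = f.natDegree := by
    rw [← hdeg, ← hg0]
    exact (Polynomial.natDegree_map (algebraMap k Ω)).symm
  have hd2 : g.natDegree = f.natDegree :=
    le_antisymm Polynomial.natDegree_map_le (hd1 ▸ Polynomial.natDegree_map_le)
  have hgne : g ≠ 0 := by
    intro h
    rw [h, Polynomial.natDegree_zero] at hd2
    omega
  have hsep : (f.map ev).Separable := by
    refine ⟨Polynomial.C (ev r)⁻¹ * a.map ev, Polynomial.C (ev r)⁻¹ * b.map ev, ?_⟩
    have := congrArg (Polynomial.map ev) hab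
    rw [Polynomial.map_add, Polynomial.map_mul, Polynomial.map_mul, Polynomial.map_C,
      ← Polynomial.derivative_map] at this
    rw [mul_assoc, mul_assoc, ← mul_add, this, ← Polynomial.C_mul, inv_mul_cancel₀ hrx,
      Polynomial.C_1]
  have hsep' : (g.map (Polynomial.evalRingHom 0)).Separable := by
    rw [← Polynomial.separable_map (algebraMap k Ω), hg0]; exact hsep
  have hspl : (g.map (Polynomial.evalRingHom 0)).Splits := by
    refine Polynomial.Splits.of_splits_map (algebraMap k Ω) (IsAlgClosed.splits _) fun y hy => ?_
    rw [hg0] at hy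
    exact ⟨⟨y, IntermediateField.subset_adjoin _ _ (Set.mem_insert_of_mem _ (by
      rw [Finset.mem_coe, Multiset.mem_toFinset]; exact hy))⟩, rfl⟩
  obtain ⟨C, Q0, hC⟩ := exists_norm_sum_psiTr_le (Ω := Ω) (p := p) g hgne (hd2.trans_lt hp)
    (hd1.trans hd2.symm) hsep' hspl ψ hψ
  obtain ⟨t, -, ht⟩ := FiniteField.card k p
  refine ⟨C, Q0, t, t.pos, fun j hpos hj hQ => ?_⟩
  have hk : ∀ c : k, c ^ (p ^ j) ^ 2 = c := by
    intro c
    obtain ⟨i, rfl⟩ := hj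
    have e : (p ^ ((t : ℕ) * i)) ^ 2 = Fintype.card k ^ (i * 2) := by
      rw [ht, ← pow_mul, ← pow_mul, mul_assoc]
    rw [e]
    exact FiniteField.pow_card_pow _ c
  have hq : p ^ (2 * j) = (p ^ j) ^ 2 := by rw [← pow_mul, mul_comm]
  have hx₁q : x₁ ^ p ^ (2 * j) = x₁ := by
    rw [hq]
    exact congrArg (algebraMap k Ω) (hk x₀)
  have hq1 : 1 < p ^ (2 * j) := Nat.one_lt_pow (by omega) (Fact.out : p.Prime).one_lt
  have hsum : pointSum Ω ψ f (2 * j) = psiTr ψ (2 * j) x₁ *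
      ∑ x ∈ powFixed Ω ((p ^ j) ^ 2), psiTr ψ (2 * j) x *
        ((g.map (Polynomial.eval₂RingHom (algebraMap k Ω) x)).roots.toFinset.filter
          fun y => y ^ (p ^ j) ^ 2 = y).card := by
    unfold pointSum
    rw [Finset.mul_sum, ← hq]
    symm
    refine Finset.sum_bij (fun x _ => x + x₁) ?_ ?_ ?_ ?_
    · intro x hx
      rw [mem_powFixed hq1] at hx ⊢
      rw [add_pow_char_pow, hx, hx₁q]
    · intro x _ y _ h
      exact add_right_cancel h
    · intro y hy
      refine ⟨y - x₁, ?_, by ring⟩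
      rw [mem_powFixed hq1] at hy ⊢
      rw [sub_pow_char_pow, hy, hx₁q]
    · intro x hx
      rw [mem_powFixed hq1] at hx
      rw [psiTr_add ψ hx hx₁q]
      simp only [g, Polynomial.map_map, hφev]
      ring
  rw [hsum, norm_mul, norm_psiTr ψ hx₁q, one_mul]
  exact hC j hQ hk

end PointSum

theorem isUnit_one_add_smul_of_isIntegral {R S : Type*} [CommRing R] [IsLocalRing R] [CommRing S]
    [Algebra R S] [Algebra.IsIntegral R S] {u : R} (hu : ¬ IsUnit u) (c : S) :
    IsUnit (1 + u • c) := by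
  by_contra h
  obtain ⟨M, hM, hmem⟩ := exists_max_ideal_of_mem_nonunits h
  have h1 : (M.comap (algebraMap R S)).IsMaximal :=
    Ideal.isMaximal_comap_of_isIntegral_of_isMaximal M
  have h2 : u ∈ M.comap (algebraMap R S) := by
    rw [IsLocalRing.eq_maximalIdeal h1]; exact hu
  have h3 : u • c ∈ M := by
    rw [Algebra.smul_def]; exact M.mul_mem_right _ h2
  exact hM.ne_top ((Ideal.eq_top_iff_one _).2 (by simpa using M.sub_mem hmem h3))

theorem exists_prod_one_add_mul_eq {ι A : Type*} [CommRing A] (B : Subring A) (u : A) (hu : u ∈ B)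
    (c : ι → A) (s : Finset ι) (hc : ∀ i ∈ s, c i ∈ B) :
    ∃ d ∈ B, ∏ i ∈ s, (1 + u * c i) = 1 + u * d := by
  classical
  induction s using Finset.induction_on with
  | empty => exact ⟨0, B.zero_mem, by simp⟩
  | insert a s ha ih =>
    obtain ⟨d, hd, e⟩ := ih fun i hi => hc i (Finset.mem_insert_of_mem hi)
    have hca := hc a (Finset.mem_insert_self a s)
    refine ⟨c a + d + u * c a * d, ?_, ?_⟩
    · exact B.add_mem (B.add_mem hca hd) (B.mul_mem (B.mul_mem hu hca) hd)
    · rw [Finset.prod_insert ha, e]; ring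

section InfinityUnits

variable {k L : Type*} [Field k] [Field L] [Algebra (RatFunc k) L] [Algebra k L]
  [IsScalarTower k (RatFunc k) L]

theorem not_isUnit_inftyUnif_pow {n : ℕ} (hn : n ≠ 0) : ¬ IsUnit (inftyUnif k ^ n) := by
  rw [isUnit_pow_iff hn]
  exact irreducible_inftyUnif.not_isUnit

omit [Algebra k L] [IsScalarTower k (RatFunc k) L] in
theorem algebraMap_inftyUnif_pow (n : ℕ) :
    algebraMap (inftyRing k) L (inftyUnif k ^ n) =
      algebraMap (RatFunc k) L (RatFunc.X ^ (-(n : ℤ))) := by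
  rw [← inftyUnif_pow_coe]; rfl

theorem inv_sub_one_mem_poleSpace {f : L} {n : ℕ} (hn : n ≠ 0)
    (hf : f - 1 ∈ poleSpace k L (-(n : ℤ))) :
    f ≠ 0 ∧ f⁻¹ - 1 ∈ poleSpace k L (-(n : ℤ)) := by
  have hc := hf
  rw [mem_poleSpace, neg_neg] at hc
  let c : integralClosure (inftyRing k) L := ⟨_, hc⟩
  have hu := isUnit_one_add_smul_of_isIntegral (not_isUnit_inftyUnif_pow (k := k) hn) c
  have e : ((1 + inftyUnif k ^ n • c : integralClosure (inftyRing k) L) : L) = f := by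
    show 1 + inftyUnif k ^ n • (c : L) = f
    rw [Algebra.smul_def, algebraMap_inftyUnif_pow]
    show 1 + _ * (_ * (f - 1)) = f
    rw [← mul_assoc, ← map_mul, ← zpow_add₀ RatFunc.X_ne_zero, neg_add_cancel, zpow_zero, map_one]
    ring
  obtain ⟨v, hv⟩ := hu.exists_right_inv
  have hv' : f * (v : L) = 1 := by
    rw [← e, ← MulMemClass.coe_mul, hv]; rfl
  have hf0 : f ≠ 0 := left_ne_zero_of_mul_eq_one hv'
  have hinv : f⁻¹ = v := (eq_inv_of_mul_eq_one_right hv').symm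
  refine ⟨hf0, ?_⟩
  have e2 : f⁻¹ - 1 = -(v : L) * (f - 1) := by
    rw [← hinv]; field_simp; ring
  rw [e2, ← zero_add (-(n : ℤ))]
  refine mul_mem_poleSpace (neg_mem ?_) hf
  rw [mem_poleSpace, neg_zero, zpow_zero, map_one, one_mul]
  exact v.2

theorem X_zpow_mul_norm_sub_one_mem_inftyRing [FiniteDimensional (RatFunc k) L]
    [Algebra.IsSeparable (RatFunc k) L] {f : L} {n : ℕ}
    (hf : f - 1 ∈ poleSpace k L (-(n : ℤ))) :
    RatFunc.X ^ (n : ℤ) * (Algebra.norm (RatFunc k) f - 1) ∈ inftyRing k := by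
  let E := AlgebraicClosure (RatFunc k)
  let B : Subring E := (integralClosure (inftyRing k) E).toSubring
  let u : E := algebraMap (RatFunc k) E (RatFunc.X ^ (-(n : ℤ)))
  let c : (L →ₐ[RatFunc k] E) → E := fun σ => algebraMap (RatFunc k) E (RatFunc.X ^ (n : ℤ)) *
    (σ f - 1)
  have hu : u ∈ B := isIntegral_algebraMap_of_mem_inftyRing (X_zpow_mem_inftyRing (by omega))
  have hcB : ∀ σ, c σ ∈ B := by
    intro σ
    have h := map_mem_poleSpace σ hf
    rw [mem_poleSpace, neg_neg, map_sub, map_one] at h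
    exact h
  obtain ⟨d, hd, e⟩ := exists_prod_one_add_mul_eq B u hu c Finset.univ fun σ _ => hcB σ
  have huc : ∀ y : E, u * (algebraMap (RatFunc k) E (RatFunc.X ^ (n : ℤ)) * y) = y := by
    intro y
    rw [← mul_assoc, ← map_mul, ← zpow_add₀ RatFunc.X_ne_zero, neg_add_cancel, zpow_zero, map_one,
      one_mul]
  have h1 : algebraMap (RatFunc k) E (Algebra.norm (RatFunc k) f) = 1 + u * d := by
    rw [Algebra.norm_eq_prod_embeddings (RatFunc k) E, ← e]
    refine Finset.prod_congr rfl fun σ _ => ?_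
    rw [huc]; ring
  have h2 : algebraMap (RatFunc k) E
      (RatFunc.X ^ (n : ℤ) * (Algebra.norm (RatFunc k) f - 1)) = d := by
    rw [map_mul, map_sub, h1, map_one, add_sub_cancel_left, mul_left_comm]
    exact huc d
  have h3 : IsIntegral (inftyRing k)
      (RatFunc.X ^ (n : ℤ) * (Algebra.norm (RatFunc k) f - 1)) := by
    have : IsIntegral (inftyRing k) (algebraMap (RatFunc k) E
      (RatFunc.X ^ (n : ℤ) * (Algebra.norm (RatFunc k) f - 1))) := h2 ▸ hd
    exact (isIntegral_algebraMap_iff (algebraMap (RatFunc k) E).injective).1 this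
  obtain ⟨y, hy⟩ := IsIntegrallyClosed.isIntegral_iff.1 h3
  rw [← hy]
  exact y.2

end InfinityUnits

section RelNormPrime

attribute [local instance] FractionRing.liftAlgebra

theorem isGalois_fractionRing (R K E T : Type*) [CommRing R] [IsDomain R] [CommRing T] [IsDomain T]
    [Field K] [Field E] [Algebra R K] [IsFractionRing R K] [Algebra T E] [IsFractionRing T E]
    [Algebra K E] [Algebra R T] [Algebra R E] [IsScalarTower R K E] [IsScalarTower R T E]
    [FaithfulSMul R T] [IsGalois K E] : IsGalois (FractionRing R) (FractionRing T) := by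
  refine IsGalois.of_equiv_equiv (F := K) (E := E)
    (f := (FractionRing.algEquiv R K).symm.toRingEquiv)
    (g := (FractionRing.algEquiv T E).symm.toRingEquiv) ?_
  ext
  simpa using! IsFractionRing.algEquiv_commutes (FractionRing.algEquiv R K).symm
    (FractionRing.algEquiv T E).symm _

theorem Ideal.relNorm_eq_pow_of_isGalois_tower (R S T K E : Type*) [CommRing R] [IsDedekindDomain R]
    [CommRing S] [IsDedekindDomain S] [CommRing T] [IsDedekindDomain T] [Algebra R S] [Algebra S T]
    [Algebra R T] [IsScalarTower R S T] [Module.Finite R S] [Module.Finite S T] [Module.Finite R T]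
    [Module.IsTorsionFree R S] [Module.IsTorsionFree S T] [Module.IsTorsionFree R T]
    [Field K] [Field E] [Algebra R K] [IsFractionRing R K] [Algebra T E] [IsFractionRing T E]
    [Algebra K E] [Algebra R E] [IsScalarTower R K E] [IsScalarTower R T E]
    [IsGalois K E] (P : Ideal S) (p : Ideal R) [P.LiesOver p] [P.IsMaximal] [p.IsMaximal] :
    Ideal.relNorm R P = p ^ P.inertiaDeg R := by
  have _ : IsGalois (FractionRing R) (FractionRing T) := isGalois_fractionRing R K E T
  obtain ⟨Q, hQ₁, hQ₂⟩ : ∃ Q : Ideal T, Q.IsMaximal ∧ Q.LiesOver P :=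
    Ideal.exists_maximal_ideal_liesOver_of_isIntegral P
  have : Q.LiesOver p := Ideal.LiesOver.trans Q P p
  have h := Ideal.relNorm_eq_pow_of_isPrime_isGalois Q p
  have : IsGalois (FractionRing S) (FractionRing T) :=
    IsGalois.tower_top_of_isGalois (FractionRing R) (FractionRing S) (FractionRing T)
  rwa [← Ideal.relNorm_relNorm R S, Ideal.relNorm_eq_pow_of_isPrime_isGalois Q P, map_pow,
    Ideal.inertiaDeg_tower (R := R) P Q, pow_mul, pow_left_inj (Ideal.inertiaDeg_pos Q S).ne'] at h

theorem Ideal.relNorm_integralClosure_eq_pow (R K L : Type*) [CommRing R] [IsDedekindDomain R]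
    [Field K] [Field L] [Algebra R K] [IsFractionRing R K] [Algebra K L] [Algebra R L]
    [IsScalarTower R K L] [FiniteDimensional K L] [Algebra.IsSeparable K L]
    [IsDedekindDomain (integralClosure R L)] [Module.Finite R (integralClosure R L)]
    [Module.IsTorsionFree R (integralClosure R L)]
    (P : Ideal (integralClosure R L)) (p : Ideal R) [P.LiesOver p] [P.IsMaximal] [p.IsMaximal] :
    Ideal.relNorm R P = p ^ P.inertiaDeg R := by
  let E := IntermediateField.normalClosure K L (AlgebraicClosure L)
  have _ : Algebra.IsSeparable K E := by
    have h : ∀ f : L →ₐ[K] AlgebraicClosure L, Algebra.IsSeparable K f.fieldRange := fun f =>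
      AlgEquiv.Algebra.isSeparable (AlgEquiv.ofInjectiveField f)
    exact IntermediateField.isSeparable_iSup (h := h)
  have _ : IsGalois K E := { }
  have : IsScalarTower R K E := inferInstance
  have : IsScalarTower R L E := IsScalarTower.to₁₃₄ R K L E
  let S := integralClosure R L
  let T := integralClosure R E
  let φ : S →ₐ[R] T := (IsScalarTower.toAlgHom R L E).mapIntegralClosure
  let _ : Algebra S T := φ.toAlgebra
  have _ : IsScalarTower R S T := IsScalarTower.of_algebraMap_eq fun x => (φ.commutes x).symm
  have hφ : Function.Injective φ := by
    intro a b h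
    have := congrArg Subtype.val h
    exact Subtype.ext ((algebraMap L E).injective this)
  have _ : FaithfulSMul S T := (faithfulSMul_iff_algebraMap_injective _ _).2 hφ
  have _ : Module.IsTorsionFree R E := .trans_faithfulSMul _ K E
  have _ : IsFractionRing T E := integralClosure.isFractionRing_of_finite_extension K E
  have _ : Module.Finite R T := IsIntegralClosure.finite R K E T
  have _ : Module.Finite S T := Module.Finite.of_restrictScalars_finite R S T
  have _ : IsDedekindDomain T := integralClosure.isDedekindDomain R K E
  exact Ideal.relNorm_eq_pow_of_isGalois_tower R S T K E P p

end RelNormPrime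

theorem trace_eq_of_natDegree_minpoly {k F E : Type*} [Field k] [Field F] [Field E] [Algebra k F]
    [Algebra k E] [Algebra F E] [IsScalarTower k F E] [FiniteDimensional k E] (x : E)
    (h : (minpoly k x).natDegree = Module.finrank k F) :
    (minpoly k x).natDegree * Module.finrank F E = Module.finrank k E ∧
    Algebra.trace k E x = Module.finrank F E * -(minpoly k x).nextCoeff := by
  have h1 := Module.finrank_mul_finrank k F E
  have h2 := Module.finrank_mul_finrank k (IntermediateField.adjoin k {x}) E
  have h3 := minpoly.natDegree_pos (Algebra.IsIntegral.isIntegral (R := k) x)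
  rw [IntermediateField.adjoin.finrank (Algebra.IsIntegral.isIntegral x)] at h2
  rw [← h] at h1
  have h4 := Nat.eq_of_mul_eq_mul_left h3 (h2.trans h1.symm)
  exact ⟨h1, by rw [trace_eq_finrank_mul_minpoly_nextCoeff, h4]⟩

section NormPoly

variable {k L : Type*} [Field k] [Field L] [Algebra (RatFunc k) L] [Algebra k[X] L]
  [IsScalarTower k[X] (RatFunc k) L]

instance instIsTorsionFreePolynomialRatFunc : Module.IsTorsionFree k[X] L :=
  .trans_faithfulSMul _ (RatFunc k) L

variable [FiniteDimensional (RatFunc k) L] [Algebra.IsSeparable (RatFunc k) L]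

instance instFiniteIntegralClosure : Module.Finite k[X] (integralClosure k[X] L) :=
  IsIntegralClosure.finite _ (RatFunc k) L _

instance instIsDedekindDomainIntegralClosure : IsDedekindDomain (integralClosure k[X] L) :=
  integralClosure.isDedekindDomain _ (RatFunc k) L

instance instIsFractionRingIntegralClosure : IsFractionRing (integralClosure k[X] L) L :=
  integralClosure.isFractionRing_of_finite_extension (RatFunc k) L

theorem exists_monic_span_eq_relNorm (I : Ideal (integralClosure k[X] L)) (hI : I ≠ ⊥) :
    ∃ g : k[X], g.Monic ∧ Ideal.span {g} = Ideal.relNorm k[X] I := by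
  obtain ⟨h, hh⟩ := (IsPrincipalIdealRing.principal (Ideal.relNorm k[X] I)).principal
  have h0 : h ≠ 0 := by
    rintro rfl
    apply hI
    rw [← Ideal.relNorm_eq_bot_iff (R := k[X]), hh]
    simp
  refine ⟨h * Polynomial.C h.leadingCoeff⁻¹, Polynomial.monic_mul_leadingCoeff_inv h0, ?_⟩
  rw [hh]
  refine Ideal.span_singleton_mul_right_unit ?_ _
  exact Polynomial.isUnit_C.2 (IsUnit.mk0 _ (inv_ne_zero (Polynomial.leadingCoeff_ne_zero.2 h0)))

open Classical in
/-- The monic generator of the relative norm of a nonzero ideal. -/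
noncomputable def normPoly (I : Ideal (integralClosure k[X] L)) : k[X] :=
  if h : I ≠ ⊥ then (exists_monic_span_eq_relNorm I h).choose else 0

theorem monic_normPoly {I : Ideal (integralClosure k[X] L)} (hI : I ≠ ⊥) : (normPoly I).Monic := by
  rw [normPoly, dif_pos hI]; exact (exists_monic_span_eq_relNorm I hI).choose_spec.1

theorem span_normPoly {I : Ideal (integralClosure k[X] L)} (hI : I ≠ ⊥) :
    Ideal.span {normPoly I} = Ideal.relNorm k[X] I := by
  rw [normPoly, dif_pos hI]; exact (exists_monic_span_eq_relNorm I hI).choose_spec.2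

theorem normPoly_eq {I : Ideal (integralClosure k[X] L)} (hI : I ≠ ⊥) {g : k[X]} (hg : g.Monic)
    (h : Ideal.span {g} = Ideal.relNorm k[X] I) : normPoly I = g := by
  refine Polynomial.eq_of_monic_of_associated (monic_normPoly hI) hg ?_
  rw [← Ideal.span_singleton_eq_span_singleton, h, span_normPoly hI]

theorem normPoly_mul {I J : Ideal (integralClosure k[X] L)} (hI : I ≠ ⊥) (hJ : J ≠ ⊥) :
    normPoly (I * J) = normPoly I * normPoly J := by
  refine normPoly_eq (mul_ne_zero hI hJ) ((monic_normPoly hI).mul (monic_normPoly hJ)) ?_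
  rw [map_mul, ← span_normPoly hI, ← span_normPoly hJ, Ideal.span_singleton_mul_span_singleton]

theorem normPoly_one : normPoly (1 : Ideal (integralClosure k[X] L)) = 1 := by
  refine normPoly_eq one_ne_zero Polynomial.monic_one ?_
  rw [map_one, Ideal.span_singleton_one, Ideal.one_eq_top]

theorem normPoly_mem (I : Ideal (integralClosure k[X] L)) (hI : I ≠ ⊥) :
    algebraMap k[X] (integralClosure k[X] L) (normPoly I) ∈ I := by
  have h : normPoly I ∈ Ideal.relNorm k[X] I := by
    rw [← span_normPoly hI]; exact Ideal.mem_span_singleton_self _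
  exact Ideal.relNorm_le_comap k[X] I h

variable [Algebra k L] [IsScalarTower k (RatFunc k) L]

omit [FiniteDimensional (RatFunc k) L] [Algebra.IsSeparable (RatFunc k) L] in
instance instIsScalarTowerPolynomialRatFunc : IsScalarTower k k[X] L := isScalarTower_polynomial k L

omit [FiniteDimensional (RatFunc k) L] [Algebra.IsSeparable (RatFunc k) L] in
instance instIsScalarTowerIntegralClosure : IsScalarTower k k[X] (integralClosure k[X] L) :=
  inferInstance

instance finite_quotient (I : Ideal (integralClosure k[X] L)) [NeZero I] :
    Module.Finite k (integralClosure k[X] L ⧸ I) :=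
  finite_quotient_integralClosure I (NeZero.ne I)

set_option maxHeartbeats 1000000 in
set_option synthInstance.maxHeartbeats 100000 in
theorem normPoly_prime (P : Ideal (integralClosure k[X] L)) (hP : P ≠ ⊥) [P.IsPrime] :
    (normPoly P).natDegree = Module.finrank k (integralClosure k[X] L ⧸ P) ∧
    (normPoly P).nextCoeff = - Algebra.trace k (integralClosure k[X] L ⧸ P)
      (algebraMap k[X] _ Polynomial.X) := by
  have hmax : P.IsMaximal := Ring.DimensionLEOne.maximalOfPrime hP inferInstance
  let _ : Field (integralClosure k[X] L ⧸ P) := Ideal.Quotient.field P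
  have _ : NeZero P := ⟨hP⟩
  let p := P.under k[X]
  have hp0 : p ≠ ⊥ := by
    intro h
    exact hP (Ideal.eq_bot_of_comap_eq_bot h)
  have _ : p.IsMaximal := Ideal.isMaximal_comap_of_isIntegral_of_isMaximal P
  have hrel := Ideal.relNorm_integralClosure_eq_pow k[X] (RatFunc k) L P p
  let _ : Field (k[X] ⧸ p) := Ideal.Quotient.field p
  have hin : P.inertiaDeg k[X] = Module.finrank (k[X] ⧸ p) (integralClosure k[X] L ⧸ P) := by
    rw [← Ideal.inertiaDeg'_eq_inertiaDeg p P, Ideal.inertiaDeg'_algebraMap]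
  obtain ⟨π, hπm, hπ⟩ : ∃ π : k[X], π.Monic ∧ Ideal.span {π} = p := by
    obtain ⟨h, hh⟩ := (IsPrincipalIdealRing.principal p).principal
    have h0 : h ≠ 0 := by
      rintro rfl
      exact hp0 (by rw [hh]; simp)
    refine ⟨h * Polynomial.C h.leadingCoeff⁻¹, Polynomial.monic_mul_leadingCoeff_inv h0, ?_⟩
    rw [hh]
    refine Ideal.span_singleton_mul_right_unit ?_ _
    exact Polynomial.isUnit_C.2 (IsUnit.mk0 _ (inv_ne_zero (Polynomial.leadingCoeff_ne_zero.2 h0)))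
  have hπirr : Irreducible π := by
    have : Prime π := by
      rw [← Ideal.span_singleton_prime hπm.ne_zero, hπ]; infer_instance
    exact this.irreducible
  have hnp : normPoly P = π ^ P.inertiaDeg k[X] := by
    refine normPoly_eq hP (hπm.pow _) ?_
    rw [hrel, ← hπ, Ideal.span_singleton_pow]
  let x : integralClosure k[X] L ⧸ P := algebraMap k[X] _ Polynomial.X
  have hmin : minpoly k x = π := by
    refine (minpoly.eq_of_irreducible_of_monic hπirr ?_ hπm).symm
    have e : Polynomial.aeval x π = algebraMap k[X] _ π := by
      have := Polynomial.aeval_algebraMap_apply (integralClosure k[X] L ⧸ P)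
        (Polynomial.X : k[X]) π
      rw [Polynomial.aeval_X_left_apply] at this
      exact this
    rw [e, IsScalarTower.algebraMap_apply k[X] (integralClosure k[X] L),
      Ideal.Quotient.algebraMap_eq, Ideal.Quotient.eq_zero_iff_mem]
    show π ∈ p
    rw [← hπ]; exact Ideal.mem_span_singleton_self π
  have hfin : Module.finrank k (k[X] ⧸ p) = π.natDegree := by
    rw [← hπ]; exact finrank_quotient_span_eq_natDegree
  have _ : IsScalarTower k (k[X] ⧸ p) (integralClosure k[X] L ⧸ P) :=
    IsScalarTower.of_algebraMap_eq fun c => by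
      rw [IsScalarTower.algebraMap_apply k k[X] (integralClosure k[X] L ⧸ P),
        IsScalarTower.algebraMap_apply k k[X] (k[X] ⧸ p),
        ← IsScalarTower.algebraMap_apply k[X] (k[X] ⧸ p)]
  obtain ⟨hdeg, htr⟩ := trace_eq_of_natDegree_minpoly (F := k[X] ⧸ p) x (hmin ▸ hfin.symm)
  rw [hmin, ← hin] at hdeg htr
  constructor
  · rw [hnp, Polynomial.natDegree_pow, mul_comm, hdeg]
  · rw [hnp, hπm.nextCoeff_pow]
    refine Eq.trans ?_ (congrArg Neg.neg htr.symm)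
    simp

end NormPoly

section PrincipalInvariance

theorem Polynomial.natDegree_eq_and_nextCoeff_eq {k : Type*} [Field k] {g g' : k[X]} (hg : g.Monic)
    (hg' : g'.Monic) {c : k} (hc : c ≠ 0)
    (h : ∀ n, g.natDegree ≤ n + 1 → (g' - Polynomial.C c * g).coeff n = 0) :
    g'.natDegree = g.natDegree ∧ g'.nextCoeff = g.nextCoeff := by
  have h1 : ∀ n, g.natDegree ≤ n + 1 → g'.coeff n = c * g.coeff n := by
    intro n hn
    have := h n hn
    rwa [Polynomial.coeff_sub, Polynomial.coeff_C_mul, sub_eq_zero] at this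
  have hlead : g'.coeff g.natDegree = c := by
    rw [h1 _ (by omega), hg.coeff_natDegree, mul_one]
  have hdeg : g'.natDegree = g.natDegree := by
    refine le_antisymm ?_ (Polynomial.le_natDegree_of_ne_zero (hlead ▸ hc))
    rw [Polynomial.natDegree_le_iff_coeff_eq_zero]
    intro n hn
    rw [h1 n (by omega), Polynomial.coeff_eq_zero_of_natDegree_lt hn, mul_zero]
  have hc1 : c = 1 := by
    rw [← hlead, ← hdeg, hg'.coeff_natDegree]
  refine ⟨hdeg, ?_⟩
  unfold Polynomial.nextCoeff
  rw [hdeg]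
  split_ifs with h0
  · rfl
  · rw [h1 _ (by omega), hc1, one_mul]

variable {k L : Type*} [Field k] [Field L] [Algebra (RatFunc k) L] [Algebra k[X] L]
  [IsScalarTower k[X] (RatFunc k) L] [FiniteDimensional (RatFunc k) L]
  [Algebra.IsSeparable (RatFunc k) L]

theorem exists_normPoly_eq_of_coe_eq {I I' : Ideal (integralClosure k[X] L)} (hI : I ≠ ⊥)
    (hI' : I' ≠ ⊥) {f : L}
    (h : (I' : FractionalIdeal (integralClosure k[X] L)⁰ L) =
      FractionalIdeal.spanSingleton (integralClosure k[X] L)⁰ f *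
        (I : FractionalIdeal (integralClosure k[X] L)⁰ L)) :
    ∃ c : k, c ≠ 0 ∧ algebraMap k[X] (RatFunc k) (normPoly I') =
      algebraMap k[X] (RatFunc k) (Polynomial.C c * normPoly I) * Algebra.norm (RatFunc k) f := by
  obtain ⟨u, v, hv, rfl⟩ := IsFractionRing.div_surjective (A := integralClosure k[X] L) f
  have hv0 : v ≠ 0 := nonZeroDivisors.ne_zero hv
  have hvL : algebraMap (integralClosure k[X] L) L v ≠ 0 := by
    rwa [Ne, FaithfulSMul.algebraMap_eq_zero_iff]
  have h1 : Ideal.span {v} * I' = Ideal.span {u} * I := by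
    rw [← FractionalIdeal.coeIdeal_inj (K := L), FractionalIdeal.coeIdeal_mul,
      FractionalIdeal.coeIdeal_mul, h, FractionalIdeal.coeIdeal_span_singleton,
      FractionalIdeal.coeIdeal_span_singleton, ← mul_assoc,
      FractionalIdeal.spanSingleton_mul_spanSingleton, mul_div_cancel₀ _ hvL]
  have h2 := congrArg (Ideal.relNorm k[X]) h1
  rw [map_mul, map_mul, Ideal.relNorm_singleton, Ideal.relNorm_singleton, ← span_normPoly hI,
    ← span_normPoly hI', Ideal.span_singleton_mul_span_singleton,
    Ideal.span_singleton_mul_span_singleton, Ideal.span_singleton_eq_span_singleton] at h2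
  obtain ⟨w, hw⟩ := h2.symm
  obtain ⟨c, hc, hcw⟩ := Polynomial.isUnit_iff.1 w.isUnit
  refine ⟨c, hc.ne_zero, ?_⟩
  have h3 := congrArg (algebraMap k[X] (RatFunc k)) hw
  rw [← hcw, map_mul, map_mul, map_mul, Algebra.algebraMap_intNorm (L := L),
    Algebra.algebraMap_intNorm (L := L)] at h3
  have hN : Algebra.norm (RatFunc k) (algebraMap (integralClosure k[X] L) L v) ≠ 0 :=
    Algebra.norm_ne_zero_iff.2 hvL
  refine mul_right_cancel₀ hN ?_
  rw [mul_assoc, ← map_mul, div_mul_cancel₀ _ hvL, map_mul]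
  linear_combination -h3

variable [Algebra k L] [IsScalarTower k (RatFunc k) L]

theorem normPoly_invariant {I I' : Ideal (integralClosure k[X] L)} (hI : I ≠ ⊥)
    (hI' : I' ≠ ⊥) {f : L} (hf : f - 1 ∈ poleSpace k L (-2))
    (h : (I' : FractionalIdeal (integralClosure k[X] L)⁰ L) =
      FractionalIdeal.spanSingleton (integralClosure k[X] L)⁰ f *
        (I : FractionalIdeal (integralClosure k[X] L)⁰ L)) :
    (normPoly I').natDegree = (normPoly I).natDegree ∧
      (normPoly I').nextCoeff = (normPoly I).nextCoeff := by
  obtain ⟨c, hc, e⟩ := exists_normPoly_eq_of_coe_eq hI hI' h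
  refine Polynomial.natDegree_eq_and_nextCoeff_eq (monic_normPoly hI) (monic_normPoly hI') hc ?_
  intro n hn
  by_contra hne
  have h1 := X_zpow_mul_norm_sub_one_mem_inftyRing (n := 2) hf
  let P : k[X] := normPoly I' - Polynomial.C c * normPoly I
  have hP0 : P ≠ 0 := by
    intro h0
    apply hne
    show P.coeff n = 0
    rw [h0, Polynomial.coeff_zero]
  have hgI : Polynomial.C c * normPoly I ≠ 0 :=
    mul_ne_zero (Polynomial.C_ne_zero.2 hc) (monic_normPoly hI).ne_zero
  have h2 : algebraMap k[X] (RatFunc k) P = algebraMap k[X] (RatFunc k) (Polynomial.C c * normPoly I)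
      * (RatFunc.X ^ (-2 : ℤ) *
        (RatFunc.X ^ ((2 : ℕ) : ℤ) * (Algebra.norm (RatFunc k) f - 1))) := by
    rw [← mul_assoc (RatFunc.X ^ (-2 : ℤ)), ← zpow_add₀ RatFunc.X_ne_zero]
    simp only [P]
    rw [map_sub, e]
    norm_num
    ring
  have hP0' : algebraMap k[X] (RatFunc k) P ≠ 0 := RatFunc.algebraMap_ne_zero hP0
  have h3 := congrArg RatFunc.intDegree h2
  rw [h2] at hP0'
  have ha := left_ne_zero_of_mul hP0'
  have hb := right_ne_zero_of_mul hP0'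
  rw [RatFunc.intDegree_mul ha hb, RatFunc.intDegree_mul (left_ne_zero_of_mul hb)
    (right_ne_zero_of_mul hb), X_zpow_intDegree, RatFunc.intDegree_polynomial,
    RatFunc.intDegree_polynomial, Polynomial.natDegree_C_mul hc] at h3
  have h4 := mem_inftyRing.1 h1
  have h5 : n ≤ P.natDegree := Polynomial.le_natDegree_of_ne_zero hne
  omega

end PrincipalInvariance

section FractionalIdealIndex

variable {R K : Type*} [CommRing R] [IsDedekindDomain R] [Field K] [Algebra R K]
  [IsFractionRing R K]

theorem FractionalIdeal.relIndex_mul_coeIdeal_of_isMaximal {J : FractionalIdeal R⁰ K} (hJ : J ≠ 0)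
    {P : Ideal R} (hP : P.IsMaximal) :
    ((J * P : FractionalIdeal R⁰ K) : Submodule R K).toAddSubgroup.relIndex
      (J : Submodule R K).toAddSubgroup = Nat.card (R ⧸ P) := by
  have hP1 : (P : FractionalIdeal R⁰ K) < 1 := by
    refine lt_of_le_of_ne FractionalIdeal.coeIdeal_le_one ?_
    rw [← FractionalIdeal.coeIdeal_top, Ne, FractionalIdeal.coeIdeal_inj]
    exact hP.ne_top
  have hlt : J * P < J := by
    refine lt_of_le_of_ne ?_ ?_
    · calc J * P ≤ J * 1 := mul_le_mul_right hP1.le J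
        _ = J := mul_one J
    · intro h
      exact hP1.ne (mul_left_cancel₀ hJ (h.trans (mul_one J).symm))
  obtain ⟨a, haJ, haP⟩ := SetLike.exists_of_lt hlt
  let f : R →ₗ[R] K := LinearMap.toSpanSingleton R K a
  have hcomap : (Submodule.comap f ((J * P : FractionalIdeal R⁰ K) : Submodule R K)) = P := by
    refine (hP.eq_of_le ?_ ?_).symm
    · intro h
      apply haP
      have : (1 : R) ∈ Submodule.comap f ((J * P : FractionalIdeal R⁰ K) : Submodule R K) := by
        rw [h]; trivial
      rw [Submodule.mem_comap] at this
      have h2 : (1 : R) • a ∈ J * P := this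
      rwa [one_smul] at h2
    · intro x hx
      rw [Submodule.mem_comap]
      show x • a ∈ J * P
      rw [Algebra.smul_def, mul_comm (algebraMap R K x)]
      exact FractionalIdeal.mul_mem_mul haJ (FractionalIdeal.mem_coeIdeal_of_mem _ hx)
  have hsup : FractionalIdeal.spanSingleton R⁰ a + J * P = J := by
    have h1 : FractionalIdeal.spanSingleton R⁰ a + J * P ≤ J := by
      rw [← FractionalIdeal.sup_eq_add]
      exact sup_le (FractionalIdeal.spanSingleton_le_iff_mem.2 haJ) hlt.le
    have h2 : J⁻¹ * (FractionalIdeal.spanSingleton R⁰ a + J * P) ≤ 1 := by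
      calc _ ≤ J⁻¹ * J := mul_le_mul_right h1 _
        _ = 1 := inv_mul_cancel₀ hJ
    obtain ⟨I, hI⟩ := FractionalIdeal.le_one_iff_exists_coeIdeal.1 h2
    have h3 : FractionalIdeal.spanSingleton R⁰ a + J * P = J * I := by
      rw [hI, mul_inv_cancel_left₀ hJ]
    have h4 : P ≤ I := by
      rw [← FractionalIdeal.coeIdeal_le_coeIdeal K, hI, mul_add, inv_mul_cancel_left₀ hJ,
        ← FractionalIdeal.sup_eq_add]
      exact le_sup_right
    have h5 : P ≠ I := by
      rintro rfl
      apply haP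
      rw [← h3, ← FractionalIdeal.sup_eq_add]
      exact (le_sup_left : FractionalIdeal.spanSingleton R⁰ a ≤ _)
        (FractionalIdeal.mem_spanSingleton_self _ _)
    have h6 : I = ⊤ := by
      by_contra h
      exact h5 (hP.eq_of_le h h4)
    rw [h3, h6, FractionalIdeal.coeIdeal_top, mul_one]
  have h7 : (J : Submodule R K).toAddSubgroup =
      (AddSubgroup.map f.toAddMonoidHom ⊤) ⊔
        ((J * P : FractionalIdeal R⁰ K) : Submodule R K).toAddSubgroup := by
    have e : AddSubgroup.map f.toAddMonoidHom ⊤ =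
        ((FractionalIdeal.spanSingleton R⁰ a : FractionalIdeal R⁰ K) :
          Submodule R K).toAddSubgroup := by
      ext x
      rw [FractionalIdeal.coe_spanSingleton]
      simp [f, Submodule.mem_span_singleton]
    rw [e, ← Submodule.sup_toAddSubgroup, ← FractionalIdeal.coe_sup, FractionalIdeal.sup_eq_add,
      hsup]
  rw [h7, AddSubgroup.relIndex_sup_right, ← AddSubgroup.relIndex_comap,
    AddSubgroup.relIndex_top_right]
  have h8 : AddSubgroup.comap f.toAddMonoidHom
      ((J * P : FractionalIdeal R⁰ K) : Submodule R K).toAddSubgroup = P.toAddSubgroup := by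
    conv_rhs => rw [← hcomap]
    rfl
  rw [h8]
  rfl

end FractionalIdealIndex

section IndexInf

variable {G : Type*} [AddCommGroup G] {U V : AddSubgroup G} (B : AddSubgroup G)

theorem AddSubgroup.card_inf_le_relIndex_mul (hUV : U ≤ V) (h0 : U.relIndex V ≠ 0) :
    Nat.card (V ⊓ B : AddSubgroup G) ≤ U.relIndex V * Nat.card (U ⊓ B : AddSubgroup G) := by
  rw [← AddSubgroup.relIndex_bot_left, ← AddSubgroup.relIndex_bot_left,
    ← AddSubgroup.relIndex_mul_relIndex _ _ _ bot_le (inf_le_inf_right B hUV), mul_comm]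
  refine Nat.mul_le_mul_right _ ?_
  have : (U ⊓ B).relIndex (V ⊓ B) = U.relIndex (V ⊓ B) := by
    rw [← AddSubgroup.inf_relIndex_right U (V ⊓ B), ← inf_assoc, inf_eq_left.2 hUV]
  rw [this]
  exact AddSubgroup.relIndex_le_of_le_right inf_le_left h0

theorem AddSubgroup.card_inf_eq_relIndex_mul (hUV : U ≤ V) (h : U ⊔ B = ⊤) :
    Nat.card (V ⊓ B : AddSubgroup G) = U.relIndex V * Nat.card (U ⊓ B : AddSubgroup G) := by
  rw [← AddSubgroup.relIndex_bot_left, ← AddSubgroup.relIndex_bot_left,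
    ← AddSubgroup.relIndex_mul_relIndex _ _ _ bot_le (inf_le_inf_right B hUV), mul_comm]
  congr 1
  have : (U ⊓ B).relIndex (V ⊓ B) = U.relIndex (V ⊓ B) := by
    rw [← AddSubgroup.inf_relIndex_right U (V ⊓ B), ← inf_assoc, inf_eq_left.2 hUV]
  have h2 : (V ⊓ B) ⊔ U = V := by
    rw [sup_comm, inf_comm, ← sup_inf_assoc_of_le B hUV, h, top_inf_eq]
  rw [this, ← AddSubgroup.relIndex_sup_right, h2]

end IndexInf

section FractionalSpace

variable {k L : Type*} [Field k] [Field L] [Algebra (RatFunc k) L] [Algebra k[X] L]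
  [IsScalarTower k[X] (RatFunc k) L] [Algebra k L] [IsScalarTower k (RatFunc k) L]

/-- A fractional ideal of the ring of integral elements, as a vector space over the constants. -/
noncomputable def fractionalSpace (J : FractionalIdeal (integralClosure k[X] L)⁰ L) :
    Submodule k L :=
  (J : Submodule (integralClosure k[X] L) L).restrictScalars k

theorem mem_fractionalSpace {J : FractionalIdeal (integralClosure k[X] L)⁰ L} {x : L} :
    x ∈ fractionalSpace J ↔ x ∈ J := Iff.rfl

theorem fractionalSpace_one :
    fractionalSpace (1 : FractionalIdeal (integralClosure k[X] L)⁰ L) = integralSpace k L := by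
  ext x
  rw [mem_fractionalSpace, FractionalIdeal.mem_one_iff, mem_integralSpace]
  constructor
  · rintro ⟨y, rfl⟩
    exact y.2
  · intro h
    exact ⟨⟨x, h⟩, rfl⟩

theorem fractionalSpace_mono {J J' : FractionalIdeal (integralClosure k[X] L)⁰ L} (h : J ≤ J') :
    fractionalSpace J ≤ fractionalSpace J' := h

variable [FiniteDimensional (RatFunc k) L] [Algebra.IsSeparable (RatFunc k) L]

instance finite_fractionalSpace_inf (J : FractionalIdeal (integralClosure k[X] L)⁰ L) (m : ℤ) :
    Module.Finite k (fractionalSpace J ⊓ poleSpace k L m : Submodule k L) := by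
  obtain ⟨c, hc0, hc⟩ := J.isFractional
  obtain ⟨n, hn⟩ := exists_mem_poleSpace (k := k) (algebraMap (integralClosure k[X] L) L c)
  have _ := finite_integralSpace_inf (k := k) (L := L) (n + m)
  let g : L →ₗ[k] L := LinearMap.mulLeft k (algebraMap (integralClosure k[X] L) L c)
  have hg : ∀ x ∈ fractionalSpace J ⊓ poleSpace k L m,
      g x ∈ (integralSpace k L ⊓ poleSpace k L (n + m) : Submodule k L) := by
    rintro x ⟨hx, hx'⟩
    refine ⟨?_, mul_mem_poleSpace hn hx'⟩
    obtain ⟨y, hy⟩ := hc x hx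
    show algebraMap (integralClosure k[X] L) L c * x ∈ _
    rw [← Algebra.smul_def, ← hy]
    exact y.2
  refine Module.Finite.of_injective (g.restrict hg) ?_
  intro x y hxy
  have h1 := congrArg Subtype.val hxy
  refine Subtype.ext (mul_left_cancel₀ ?_ h1)
  rw [Ne, FaithfulSMul.algebraMap_eq_zero_iff]
  exact nonZeroDivisors.ne_zero hc0

theorem relIndex_fractionalSpace [Finite k] {I : Ideal (integralClosure k[X] L)} (hI : I ≠ ⊥)
    {J : FractionalIdeal (integralClosure k[X] L)⁰ L} (hJ : J ≠ 0) :
    (fractionalSpace (J * (I : FractionalIdeal (integralClosure k[X] L)⁰ L))).toAddSubgroup.relIndex (fractionalSpace J).toAddSubgroup =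
      Nat.card k ^ (normPoly I).natDegree := by
  revert hI J
  induction I using UniqueFactorizationMonoid.induction_on_prime with
  | h₁ => exact fun h => absurd rfl h
  | h₂ I hu =>
    intro h J hJ
    have : I = 1 := by simpa using hu
    rw [this, normPoly_one]
    simp
  | h₃ I P hI hP ih =>
    intro h J hJ
    have hP0 : P ≠ ⊥ := hP.ne_zero
    have hPp : P.IsPrime := Ideal.isPrime_of_prime hP
    have hPm : P.IsMaximal := hPp.isMaximal hP0
    have _ : NeZero P := ⟨hP0⟩
    have hP' : (P : FractionalIdeal (integralClosure k[X] L)⁰ L) ≠ 0 :=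
      FractionalIdeal.coeIdeal_ne_zero.2 hP0
    have h1 := ih (J := J * P) hI (mul_ne_zero hJ hP')
    have h2 := FractionalIdeal.relIndex_mul_coeIdeal_of_isMaximal hJ hPm
    rw [Module.natCard_eq_pow_finrank (K := k), ← (normPoly_prime P hP0).1] at h2
    rw [normPoly_mul hP0 hI, Polynomial.natDegree_mul (monic_normPoly hP0).ne_zero
      (monic_normPoly hI).ne_zero, FractionalIdeal.coeIdeal_mul, ← mul_assoc, add_comm, pow_add,
      ← h1, ← h2]
    refine (AddSubgroup.relIndex_mul_relIndex _ _ _ ?_ ?_).symm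
    · exact fractionalSpace_mono
        ((mul_le_mul_right FractionalIdeal.coeIdeal_le_one _).trans (mul_one _).le)
    · exact fractionalSpace_mono
        ((mul_le_mul_right FractionalIdeal.coeIdeal_le_one _).trans (mul_one _).le)

end FractionalSpace

section SubmoduleIndex

variable {k V : Type*} [Ring k] [AddCommGroup V] [Module k V] {W W' : Submodule k V}
  (B : Submodule k V)

theorem Submodule.card_inf_le_relIndex_mul (h : W ≤ W')
    (h0 : W.toAddSubgroup.relIndex W'.toAddSubgroup ≠ 0) :
    Nat.card (W' ⊓ B : Submodule k V) ≤ W.toAddSubgroup.relIndex W'.toAddSubgroup *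
      Nat.card (W ⊓ B : Submodule k V) :=
  AddSubgroup.card_inf_le_relIndex_mul B.toAddSubgroup (toAddSubgroup_mono h) h0

theorem Submodule.card_inf_eq_relIndex_mul (h : W ≤ W') (ht : W ⊔ B = ⊤) :
    Nat.card (W' ⊓ B : Submodule k V) = W.toAddSubgroup.relIndex W'.toAddSubgroup *
      Nat.card (W ⊓ B : Submodule k V) := by
  refine AddSubgroup.card_inf_eq_relIndex_mul B.toAddSubgroup (toAddSubgroup_mono h) ?_
  rw [← Submodule.sup_toAddSubgroup, ht]; rfl

end SubmoduleIndex

section RiemannRochCount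

variable {k L : Type*} [Field k] [Field L] [Algebra (RatFunc k) L] [Algebra k[X] L]
  [IsScalarTower k[X] (RatFunc k) L] [Algebra k L] [IsScalarTower k (RatFunc k) L]
  [FiniteDimensional (RatFunc k) L] [Algebra.IsSeparable (RatFunc k) L]

theorem card_fractionalSpace_inf_add_le [Finite k] (J : FractionalIdeal (integralClosure k[X] L)⁰ L)
    (m : ℤ) (j : ℕ) :
    Nat.card (fractionalSpace J ⊓ poleSpace k L (m + j) : Submodule k L) ≤
      Nat.card (fractionalSpace J ⊓ poleSpace k L m : Submodule k L) *
        Nat.card k ^ (Module.finrank (RatFunc k) L * j) := by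
  rw [Module.natCard_eq_pow_finrank (K := k)
    (V := (fractionalSpace J ⊓ poleSpace k L (m + j) : Submodule k L)),
    Module.natCard_eq_pow_finrank (K := k)
    (V := (fractionalSpace J ⊓ poleSpace k L m : Submodule k L)), ← pow_add]
  exact Nat.pow_le_pow_right Nat.card_pos (finrank_inf_poleSpace_add_le (fractionalSpace J) m j).2

theorem card_fractionalSpace_inf_add [Finite k] (J : FractionalIdeal (integralClosure k[X] L)⁰ L)
    (m : ℤ) (j : ℕ) (h : fractionalSpace J ⊔ poleSpace k L m = ⊤) :
    Nat.card (fractionalSpace J ⊓ poleSpace k L (m + j) : Submodule k L) =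
      Nat.card (fractionalSpace J ⊓ poleSpace k L m : Submodule k L) *
        Nat.card k ^ (Module.finrank (RatFunc k) L * j) := by
  rw [Module.natCard_eq_pow_finrank (K := k)
    (V := (fractionalSpace J ⊓ poleSpace k L (m + j) : Submodule k L)),
    Module.natCard_eq_pow_finrank (K := k)
    (V := (fractionalSpace J ⊓ poleSpace k L m : Submodule k L)), ← pow_add,
    finrank_inf_poleSpace_add (fractionalSpace J) m j h]

theorem fractionalSpace_sup_poleSpace_eq_top [Finite k] {c : ℕ}
    (hc : integralSpace k L ⊔ poleSpace k L c = ⊤)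
    (J : FractionalIdeal (integralClosure k[X] L)⁰ L)
    (hJ : Nat.card k ^ (Module.finrank (RatFunc k) L * (2 * c + 2)) <
      Nat.card (fractionalSpace J ⊓ poleSpace k L c : Submodule k L)) :
    fractionalSpace J ⊔ poleSpace k L (-2) = ⊤ := by
  have h1 := card_fractionalSpace_inf_add_le (k := k) J (-c - 2) (2 * c + 2)
  have e : (-c - 2 : ℤ) + (2 * c + 2 : ℕ) = c := by push_cast; ring
  rw [e] at h1
  have h2 : 1 < Nat.card (fractionalSpace J ⊓ poleSpace k L (-c - 2) : Submodule k L) := by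
    by_contra! h
    have := Nat.mul_le_mul_right (Nat.card k ^ (Module.finrank (RatFunc k) L * (2 * c + 2))) h
    omega
  have _ : Finite (fractionalSpace J ⊓ poleSpace k L (-c - 2) : Submodule k L) :=
    Nat.finite_of_card_ne_zero (by omega)
  have _ := Finite.one_lt_card_iff_nontrivial.1 h2
  obtain ⟨f, hf0⟩ := exists_ne (0 : (fractionalSpace J ⊓ poleSpace k L (-c - 2) : Submodule k L))
  have hf0' : (f : L) ≠ 0 := fun h => hf0 (Subtype.ext h)
  rw [eq_top_iff]
  intro y _
  have h3 : y / f ∈ integralSpace k L ⊔ poleSpace k L c := by rw [hc]; trivial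
  obtain ⟨a, ha, b, hb, hab⟩ := Submodule.mem_sup.1 h3
  refine Submodule.mem_sup.2 ⟨a * f, ?_, b * f, ?_, ?_⟩
  · have := (J : Submodule (integralClosure k[X] L) L).smul_mem ⟨a, ha⟩ f.2.1
    exact this
  · have := mul_mem_poleSpace hb f.2.2
    have e2 : (c : ℤ) + (-c - 2) = -2 := by ring
    rwa [e2] at this
  · rw [← add_mul, hab, div_mul_cancel₀ _ hf0']

theorem card_fractionalSpace_inf_of_mul_eq [Finite k] {J J' : FractionalIdeal (integralClosure k[X] L)⁰ L}
    {I : Ideal (integralClosure k[X] L)} (hI : I ≠ ⊥) (hJ : J ≠ 0) (h : J * I = J') (m : ℤ) :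
    Nat.card (fractionalSpace J ⊓ poleSpace k L m : Submodule k L) ≤
      Nat.card k ^ (normPoly I).natDegree *
        Nat.card (fractionalSpace J' ⊓ poleSpace k L m : Submodule k L) ∧
    (fractionalSpace J' ⊔ poleSpace k L m = ⊤ →
      Nat.card (fractionalSpace J ⊓ poleSpace k L m : Submodule k L) =
      Nat.card k ^ (normPoly I).natDegree *
        Nat.card (fractionalSpace J' ⊓ poleSpace k L m : Submodule k L)) := by
  subst h
  have h1 := relIndex_fractionalSpace (k := k) hI hJ
  have hle : fractionalSpace (J * (I : FractionalIdeal (integralClosure k[X] L)⁰ L)) ≤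
      fractionalSpace J := fractionalSpace_mono
        ((mul_le_mul_right FractionalIdeal.coeIdeal_le_one _).trans (mul_one _).le)
  have h0 : Nat.card k ^ (normPoly I).natDegree ≠ 0 := pow_ne_zero _ Nat.card_pos.ne'
  rw [← h1] at h0 ⊢
  exact ⟨Submodule.card_inf_le_relIndex_mul _ hle h0, Submodule.card_inf_eq_relIndex_mul _ hle⟩

theorem card_coset_fractionalSpace [Finite k] {c : ℕ}
    (hc : integralSpace k L ⊔ poleSpace k L c = ⊤) {I P₁ P₂ : Ideal (integralClosure k[X] L)}
    (hI : I ≠ ⊥) (hP₁ : P₁ ≠ ⊥) (hP₂ : P₂ ≠ ⊥) (hd₁ : (normPoly P₁).natDegree = 1)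
    (hd₂ : (normPoly P₂).natDegree = 1)
    (hN : Module.finrank (RatFunc k) L * (2 * c + 2) < (normPoly I).natDegree) :
    Nat.card {f : L // f ∈ (I : FractionalIdeal (integralClosure k[X] L)⁰ L)⁻¹ *
      (P₁ : FractionalIdeal (integralClosure k[X] L)⁰ L)⁻¹ * P₂ ∧ f - 1 ∈ poleSpace k L (-2)} *
      Nat.card k ^ (Module.finrank (RatFunc k) L * (c + 2)) =
    Nat.card k ^ (normPoly I).natDegree *
      Nat.card (integralSpace k L ⊓ poleSpace k L c : Submodule k L) := by
  have hI' : (I : FractionalIdeal (integralClosure k[X] L)⁰ L) ≠ 0 :=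
    FractionalIdeal.coeIdeal_ne_zero.2 hI
  have hP₁' : (P₁ : FractionalIdeal (integralClosure k[X] L)⁰ L) ≠ 0 :=
    FractionalIdeal.coeIdeal_ne_zero.2 hP₁
  have hP₂' : (P₂ : FractionalIdeal (integralClosure k[X] L)⁰ L) ≠ 0 :=
    FractionalIdeal.coeIdeal_ne_zero.2 hP₂
  let J := (I : FractionalIdeal (integralClosure k[X] L)⁰ L)⁻¹ *
      (P₁ : FractionalIdeal (integralClosure k[X] L)⁰ L)⁻¹ * P₂
  let J₂ := (I : FractionalIdeal (integralClosure k[X] L)⁰ L)⁻¹ * P₂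
  have hJ : J * P₁ = J₂ := by
    simp only [J, J₂]
    rw [mul_right_comm, inv_mul_cancel_right₀ hP₁']
  have hJ0 : J ≠ 0 := mul_ne_zero (mul_ne_zero (inv_ne_zero hI') (inv_ne_zero hP₁')) hP₂'
  have hq : 1 < Nat.card k := Finite.one_lt_card
  have h1 := fun m => card_fractionalSpace_inf_of_mul_eq (k := k) hI (inv_ne_zero hI')
    (inv_mul_cancel₀ hI') m
  have h2 := fun m => card_fractionalSpace_inf_of_mul_eq (k := k) hP₂ (inv_ne_zero hI')
    (rfl : _ = J₂) m
  have h3 := fun m => card_fractionalSpace_inf_of_mul_eq (k := k) hP₁ hJ0 hJ m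
  rw [hd₂] at h2
  rw [hd₁] at h3
  rw [fractionalSpace_one] at h1
  have hone : Nat.card k ≤ Nat.card (integralSpace k L ⊓ poleSpace k L c : Submodule k L) := by
    have _ := finite_integralSpace_inf (k := k) (L := L) c
    have h0 : (1 : L) ∈ (integralSpace k L ⊓ poleSpace k L c : Submodule k L) :=
      ⟨isIntegral_one, poleSpace_mono (by positivity) one_mem_poleSpace⟩
    rw [Module.natCard_eq_pow_finrank (K := k)
      (V := (integralSpace k L ⊓ poleSpace k L c : Submodule k L))]
    refine Nat.le_self_pow ?_ _
    have _ : Nontrivial (integralSpace k L ⊓ poleSpace k L c : Submodule k L) :=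
      ⟨⟨1, h0⟩, 0, fun h => one_ne_zero (congrArg Subtype.val h)⟩
    exact Module.finrank_pos.ne'
  have hJ₂top : fractionalSpace J₂ ⊔ poleSpace k L (-2) = ⊤ := by
    refine fractionalSpace_sup_poleSpace_eq_top hc J₂ ?_
    have ha := (h1 c).2 hc
    have hb := (h2 c).1
    rw [ha, pow_one, mul_comm] at hb
    have hd : Nat.card k ^ (normPoly I).natDegree ≤
        Nat.card (fractionalSpace J₂ ⊓ poleSpace k L c : Submodule k L) := by
      refine Nat.le_of_mul_le_mul_left (le_trans ?_ hb) Nat.card_pos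
      exact Nat.mul_le_mul_right _ hone
    exact lt_of_lt_of_le (Nat.pow_lt_pow_right hq hN) hd
  have hle : ∀ {J' I' : FractionalIdeal (integralClosure k[X] L)⁰ L}, I' ≤ 1 → J' * I' ≤ J' :=
    fun h => (mul_le_mul_right h _).trans (mul_one _).le
  have hJtop : fractionalSpace J ⊔ poleSpace k L (-2) = ⊤ := by
    rw [eq_top_iff, ← hJ₂top, ← hJ]
    exact sup_le_sup_right (fractionalSpace_mono (hle FractionalIdeal.coeIdeal_le_one)) _
  have hItop : fractionalSpace (I : FractionalIdeal (integralClosure k[X] L)⁰ L)⁻¹ ⊔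
      poleSpace k L (-2) = ⊤ := by
    rw [eq_top_iff, ← hJ₂top]
    exact sup_le_sup_right (fractionalSpace_mono (hle FractionalIdeal.coeIdeal_le_one)) _
  have h4 : Nat.card (fractionalSpace J ⊓ poleSpace k L (-2) : Submodule k L) =
      Nat.card (fractionalSpace (I : FractionalIdeal (integralClosure k[X] L)⁰ L)⁻¹ ⊓
        poleSpace k L (-2) : Submodule k L) :=
    ((h3 _).2 hJ₂top).trans ((h2 _).2 hJ₂top).symm
  have h5 := card_fractionalSpace_inf_add (k := k) _ (-2) (c + 2) hItop
  have e : (-2 : ℤ) + (c + 2 : ℕ) = c := by push_cast; ring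
  rw [e, ← h4, (h1 c).2 hc] at h5
  rw [h5]
  congr 1
  have h6 : (1 : L) ∈ fractionalSpace J ⊔ poleSpace k L (-2) := by rw [hJtop]; trivial
  obtain ⟨a, ha, b, hb, hab⟩ := Submodule.mem_sup.1 h6
  have hb' : 1 - a ∈ poleSpace k L (-2) := by rwa [← hab, add_sub_cancel_left]
  refine Nat.card_congr
    { toFun := fun f => ⟨f.1 - a, (fractionalSpace J).sub_mem f.2.1 ha, ?_⟩
      invFun := fun f => ⟨f.1 + a, (fractionalSpace J).add_mem f.2.1 ha, ?_⟩
      left_inv := fun f => by simp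
      right_inv := fun f => by simp }
  · have := add_mem f.2.2 hb'
    rwa [sub_add_sub_cancel] at this
  · have := sub_mem f.2.2 hb'
    have e3 : f.1 + a - 1 = f.1 - (1 - a) := by ring
    rwa [e3]

end RiemannRochCount

section IdealSums

variable {k L : Type*} [Field k] [Field L] [Algebra (RatFunc k) L] [Algebra k[X] L]
  [IsScalarTower k[X] (RatFunc k) L]
  [FiniteDimensional (RatFunc k) L] [Algebra.IsSeparable (RatFunc k) L]

theorem finite_setOf_natDegree_normPoly [Finite k] (N : ℕ) :
    {I : Ideal (integralClosure k[X] L) | I ≠ ⊥ ∧ (normPoly I).natDegree = N}.Finite := by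
  have h1 : {g : k[X] | g.natDegree ≤ N}.Finite := by
    have e : {g : k[X] | g.natDegree ≤ N} = (Polynomial.degreeLE k N : Set k[X]) := by
      ext g
      rw [SetLike.mem_coe, Polynomial.mem_degreeLE, Set.mem_ofPred_eq,
        Polynomial.natDegree_le_iff_degree_le]
    rw [e]
    have : Module.Finite k (Polynomial.degreeLT k (N + 1)) :=
      Module.Finite.equiv (Polynomial.degreeLTEquiv k (N + 1)).symm
    have h2 : Finite (Polynomial.degreeLT k (N + 1)) := Module.finite_of_finite k
    refine (Set.toFinite (Polynomial.degreeLT k (N + 1) : Set k[X])).subset ?_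
    intro g hg
    rw [SetLike.mem_coe, Polynomial.mem_degreeLE] at hg
    rw [SetLike.mem_coe, Polynomial.mem_degreeLT]
    exact lt_of_le_of_lt hg (by exact_mod_cast Nat.lt_succ_self N)
  refine ((h1.subset (fun g (hg : g ∈ {g : k[X] | g.natDegree ≤ N ∧ g ≠ 0}) => hg.1)).biUnion
    (t := fun g => {I : Ideal (integralClosure k[X] L) |
      I ∣ Ideal.span {algebraMap k[X] (integralClosure k[X] L) g}}) ?_).subset ?_
  · intro g hg
    have hne : Ideal.span {algebraMap k[X] (integralClosure k[X] L) g} ≠ 0 := by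
      rw [Ne, Ideal.zero_eq_bot, Ideal.span_singleton_eq_bot,
        FaithfulSMul.algebraMap_eq_zero_iff]
      exact hg.2
    have : Finite {I // I ∣ Ideal.span {algebraMap k[X] (integralClosure k[X] L) g}} :=
      @Finite.of_fintype _ (UniqueFactorizationMonoid.fintypeSubtypeDvd _ hne)
    exact Set.finite_coe_iff.1 this
  · rintro I ⟨hI, hN⟩
    refine Set.mem_biUnion (x := normPoly I) ⟨hN.le, (monic_normPoly hI).ne_zero⟩ ?_
    rw [Set.mem_ofPred_eq, Ideal.dvd_span_singleton]
    exact normPoly_mem I hI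

variable (k L) in
/-- The nonzero ideals of degree `N`. -/
noncomputable def idealsOfDegree [Finite k] (N : ℕ) : Finset (Ideal (integralClosure k[X] L)) :=
  (finite_setOf_natDegree_normPoly N).toFinset

theorem mem_idealsOfDegree [Finite k] {N : ℕ} {I : Ideal (integralClosure k[X] L)} :
    I ∈ idealsOfDegree k L N ↔ I ≠ ⊥ ∧ (normPoly I).natDegree = N := by
  rw [idealsOfDegree, Set.Finite.mem_toFinset]; rfl

/-- The character on ideals given by an additive character evaluated at the sum of the
first coordinates of the zeros of an ideal. -/
noncomputable def idealChar (ψ : AddChar k ℂ) (I : Ideal (integralClosure k[X] L)) : ℂ :=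
  ψ (-(normPoly I).nextCoeff)

theorem idealChar_mul (ψ : AddChar k ℂ) {I J : Ideal (integralClosure k[X] L)} (hI : I ≠ ⊥)
    (hJ : J ≠ ⊥) : idealChar ψ (I * J) = idealChar ψ I * idealChar ψ J := by
  rw [idealChar, normPoly_mul hI hJ, (monic_normPoly hI).nextCoeff_mul (monic_normPoly hJ), neg_add,
    AddChar.map_add_eq_mul]; rfl

theorem idealChar_one (ψ : AddChar k ℂ) :
    idealChar ψ (1 : Ideal (integralClosure k[X] L)) = 1 := by
  rw [idealChar, normPoly_one, ← Polynomial.C_1, Polynomial.nextCoeff_C_eq_zero,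
    neg_zero, AddChar.map_zero_eq_one]

/-- The coefficients of the `L`-function of an additive character. -/
noncomputable def charSum [Finite k] (L : Type*) [Field L] [Algebra (RatFunc k) L] [Algebra k[X] L]
    [IsScalarTower k[X] (RatFunc k) L]
    [FiniteDimensional (RatFunc k) L] [Algebra.IsSeparable (RatFunc k) L]
    (ψ : AddChar k ℂ) (N : ℕ) : ℂ := ∑ I ∈ idealsOfDegree k L N, idealChar ψ I

variable [Algebra k L] [IsScalarTower k (RatFunc k) L]

/-- The elements near `1` at infinity that multiply `I * P₁` into `I' * P₂`. -/
def idealQuotients (P₁ P₂ I I' : Ideal (integralClosure k[X] L)) : Set L :=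
  {f | f - 1 ∈ poleSpace k L (-2) ∧ ((I' * P₂ : Ideal (integralClosure k[X] L)) :
    FractionalIdeal (integralClosure k[X] L)⁰ L) =
    FractionalIdeal.spanSingleton (integralClosure k[X] L)⁰ f *
      ((I * P₁ : Ideal (integralClosure k[X] L)) : FractionalIdeal (integralClosure k[X] L)⁰ L)}

theorem ncard_idealQuotients_comm (P₁ P₂ I I' : Ideal (integralClosure k[X] L)) :
    (idealQuotients P₁ P₂ I I').ncard = (idealQuotients P₂ P₁ I' I).ncard := by
  have key : ∀ P₁ P₂ I I' : Ideal (integralClosure k[X] L), ∀ f ∈ idealQuotients P₁ P₂ I I',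
      f⁻¹ ∈ idealQuotients P₂ P₁ I' I := by
    rintro P₁ P₂ I I' f ⟨hf, h⟩
    obtain ⟨h0, hf'⟩ := inv_sub_one_mem_poleSpace two_ne_zero hf
    refine ⟨hf', ?_⟩
    rw [h, ← mul_assoc, FractionalIdeal.spanSingleton_mul_spanSingleton, inv_mul_cancel₀ h0,
      FractionalIdeal.spanSingleton_one, one_mul]
  refine Set.ncard_congr (fun f _ => f⁻¹) (key _ _ _ _) (fun a b _ _ h => inv_injective h)
    (fun b hb => ⟨b⁻¹, key _ _ _ _ _ hb, inv_inv b⟩)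

theorem eq_of_mem_idealQuotients {P₁ P₂ I I' : Ideal (integralClosure k[X] L)} (hI : I ≠ ⊥)
    (hI' : I' ≠ ⊥) (hP₁ : P₁ ≠ ⊥) (hP₂ : P₂ ≠ ⊥) {f : L} (hf : f ∈ idealQuotients P₁ P₂ I I') :
    (normPoly I').natDegree + (normPoly P₂).natDegree =
      (normPoly I).natDegree + (normPoly P₁).natDegree ∧
    ∀ ψ : AddChar k ℂ, idealChar ψ I' * idealChar ψ P₂ = idealChar ψ I * idealChar ψ P₁ := by
  obtain ⟨h1, h2⟩ := normPoly_invariant (mul_ne_zero hI hP₁) (mul_ne_zero hI' hP₂) hf.1 hf.2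
  constructor
  · rwa [normPoly_mul hI' hP₂, normPoly_mul hI hP₁,
      (monic_normPoly hI').natDegree_mul (monic_normPoly hP₂),
      (monic_normPoly hI).natDegree_mul (monic_normPoly hP₁)] at h1
  · intro ψ
    rw [← idealChar_mul ψ hI' hP₂, ← idealChar_mul ψ hI hP₁, idealChar, idealChar, h2]

theorem sum_ncard_idealQuotients [Finite k] {c : ℕ}
    (hc : integralSpace k L ⊔ poleSpace k L c = ⊤) {I P₁ P₂ : Ideal (integralClosure k[X] L)}
    (hI : I ≠ ⊥) (hP₁ : P₁ ≠ ⊥) (hP₂ : P₂ ≠ ⊥) (hd₁ : (normPoly P₁).natDegree = 1)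
    (hd₂ : (normPoly P₂).natDegree = 1)
    (hN : Module.finrank (RatFunc k) L * (2 * c + 2) < (normPoly I).natDegree) :
    (∑ I' ∈ idealsOfDegree k L (normPoly I).natDegree, (idealQuotients P₁ P₂ I I').ncard) *
      Nat.card k ^ (Module.finrank (RatFunc k) L * (c + 2)) =
    Nat.card k ^ (normPoly I).natDegree *
      Nat.card (integralSpace k L ⊓ poleSpace k L c : Submodule k L) := by
  have hI' : (I : FractionalIdeal (integralClosure k[X] L)⁰ L) ≠ 0 :=
    FractionalIdeal.coeIdeal_ne_zero.2 hI
  have hP₁' : (P₁ : FractionalIdeal (integralClosure k[X] L)⁰ L) ≠ 0 :=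
    FractionalIdeal.coeIdeal_ne_zero.2 hP₁
  have hP₂' : (P₂ : FractionalIdeal (integralClosure k[X] L)⁰ L) ≠ 0 :=
    FractionalIdeal.coeIdeal_ne_zero.2 hP₂
  have h1 := card_coset_fractionalSpace hc hI hP₁ hP₂ hd₁ hd₂ hN
  rw [← h1]
  congr 1
  let S : Set L := {f | f ∈ (I : FractionalIdeal (integralClosure k[X] L)⁰ L)⁻¹ *
      (P₁ : FractionalIdeal (integralClosure k[X] L)⁰ L)⁻¹ * P₂ ∧ f - 1 ∈ poleSpace k L (-2)}
  have hfin : S.Finite := by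
    refine Set.finite_coe_iff.1 (Nat.finite_of_card_ne_zero (left_ne_zero_of_mul (h1.trans_ne ?_)))
    have _ := finite_integralSpace_inf (k := k) (L := L) c
    have _ : Finite (integralSpace k L ⊓ poleSpace k L c : Submodule k L) :=
      Module.finite_of_finite k
    exact mul_ne_zero (pow_ne_zero _ Nat.card_pos.ne') Nat.card_pos.ne'
  have hsub : ∀ I', idealQuotients P₁ P₂ I I' ⊆ S := by
    rintro I' f ⟨hf, h⟩
    refine ⟨?_, hf⟩
    rw [← FractionalIdeal.spanSingleton_le_iff_mem]
    have : FractionalIdeal.spanSingleton (integralClosure k[X] L)⁰ f =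
        (I : FractionalIdeal (integralClosure k[X] L)⁰ L)⁻¹ *
          (P₁ : FractionalIdeal (integralClosure k[X] L)⁰ L)⁻¹ * P₂ * I' := by
      rw [FractionalIdeal.coeIdeal_mul, FractionalIdeal.coeIdeal_mul] at h
      rw [mul_assoc, mul_comm (P₂ : FractionalIdeal (integralClosure k[X] L)⁰ L), h]
      field_simp
    rw [this]
    exact (mul_le_mul_right FractionalIdeal.coeIdeal_le_one _).trans (mul_one _).le
  have hex : ∀ f ∈ S, ∃ I' ∈ idealsOfDegree k L (normPoly I).natDegree,
      f ∈ idealQuotients P₁ P₂ I I' := by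
    rintro f ⟨hf, hf1⟩
    have h0 := (inv_sub_one_mem_poleSpace (n := 2) two_ne_zero hf1).1
    have h2 : FractionalIdeal.spanSingleton (integralClosure k[X] L)⁰ f * I * P₁ *
        (P₂ : FractionalIdeal (integralClosure k[X] L)⁰ L)⁻¹ ≤ 1 := by
      have h3 := FractionalIdeal.spanSingleton_le_iff_mem.2 hf
      calc _ = (I * P₁ * (P₂ : FractionalIdeal (integralClosure k[X] L)⁰ L)⁻¹) *
            FractionalIdeal.spanSingleton (integralClosure k[X] L)⁰ f := by ring
        _ ≤ (I * P₁ * (P₂ : FractionalIdeal (integralClosure k[X] L)⁰ L)⁻¹) * _ :=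
            mul_le_mul_right h3 _
        _ = 1 := by field_simp
    obtain ⟨I', hI''⟩ := FractionalIdeal.le_one_iff_exists_coeIdeal.1 h2
    have hI'0 : I' ≠ ⊥ := by
      rw [← FractionalIdeal.coeIdeal_ne_zero (K := L), hI'']
      refine mul_ne_zero (mul_ne_zero (mul_ne_zero ?_ hI') hP₁') (inv_ne_zero hP₂')
      exact FractionalIdeal.spanSingleton_ne_zero_iff.2 h0
    have hq : f ∈ idealQuotients P₁ P₂ I I' := by
      refine ⟨hf1, ?_⟩
      rw [FractionalIdeal.coeIdeal_mul, FractionalIdeal.coeIdeal_mul, hI'',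
        inv_mul_cancel_right₀ hP₂', mul_assoc]
    refine ⟨I', mem_idealsOfDegree.2 ⟨hI'0, ?_⟩, hq⟩
    have := (eq_of_mem_idealQuotients hI hI'0 hP₁ hP₂ hq).1
    omega
  have huniq : ∀ f ∈ S, ∀ I' I'', f ∈ idealQuotients P₁ P₂ I I' → f ∈ idealQuotients P₁ P₂ I I'' →
      I' = I'' := by
    rintro f hf I' I'' ⟨_, h2⟩ ⟨_, h3⟩
    have := FractionalIdeal.coeIdeal_injective (h2.trans h3.symm)
    exact mul_right_cancel₀ hP₂ this
  have hS : S = ⋃ I' ∈ idealsOfDegree k L (normPoly I).natDegree, idealQuotients P₁ P₂ I I' := by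
    ext f
    simp only [Set.mem_iUnion, exists_prop]
    exact ⟨hex f, fun ⟨I', _, h⟩ => hsub I' h⟩
  have h2 := (idealsOfDegree k L (normPoly I).natDegree).finite_toSet.ncard_biUnion
    (s := idealQuotients P₁ P₂ I) (fun I' _ => hfin.subset (hsub I'))
    (fun I' _ I'' _ hne => Set.disjoint_left.2 fun f hf hf' =>
      hne (huniq f (hsub _ hf) _ _ hf hf'))
  simp only [SetLike.mem_coe] at h2
  rw [← hS, finsum_mem_finset_eq_sum] at h2
  exact h2.symm

theorem idealChar_mul_charSum [Finite k] {c : ℕ}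
    (hc : integralSpace k L ⊔ poleSpace k L c = ⊤) {P₁ P₂ : Ideal (integralClosure k[X] L)}
    (hP₁ : P₁ ≠ ⊥) (hP₂ : P₂ ≠ ⊥) (hd₁ : (normPoly P₁).natDegree = 1)
    (hd₂ : (normPoly P₂).natDegree = 1) {N : ℕ}
    (hN : Module.finrank (RatFunc k) L * (2 * c + 2) < N) (ψ : AddChar k ℂ) :
    idealChar ψ P₁ * charSum L ψ N = idealChar ψ P₂ * charSum L ψ N := by
  let Q := Nat.card k ^ (Module.finrank (RatFunc k) L * (c + 2))
  let R := Nat.card k ^ N * Nat.card (integralSpace k L ⊓ poleSpace k L c : Submodule k L)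
  have hR : (R : ℂ) ≠ 0 := by
    have _ := finite_integralSpace_inf (k := k) (L := L) c
    have _ : Finite (integralSpace k L ⊓ poleSpace k L c : Submodule k L) :=
      Module.finite_of_finite k
    exact Nat.cast_ne_zero.2 (mul_ne_zero (pow_ne_zero _ Nat.card_pos.ne') Nat.card_pos.ne')
  have key : ∀ {P₁ P₂ : Ideal (integralClosure k[X] L)}, P₁ ≠ ⊥ → P₂ ≠ ⊥ →
      (normPoly P₁).natDegree = 1 → (normPoly P₂).natDegree = 1 →
      (R : ℂ) * (idealChar ψ P₁ * charSum L ψ N) =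
        ∑ I ∈ idealsOfDegree k L N, ∑ I' ∈ idealsOfDegree k L N,
          ((idealQuotients P₁ P₂ I I').ncard : ℂ) * Q * (idealChar ψ I * idealChar ψ P₁) := by
    intro P₁ P₂ h₁ h₂ hd₁ hd₂
    rw [charSum, Finset.mul_sum, Finset.mul_sum]
    refine Finset.sum_congr rfl fun I hI => ?_
    obtain ⟨hI0, hIN⟩ := mem_idealsOfDegree.1 hI
    have := sum_ncard_idealQuotients hc hI0 h₁ h₂ hd₁ hd₂ (hIN ▸ hN)
    rw [hIN] at this
    rw [← Finset.sum_mul, ← Finset.sum_mul, mul_comm (idealChar ψ P₁)]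
    congr 1
    exact_mod_cast this.symm
  refine mul_left_cancel₀ hR ?_
  rw [key hP₁ hP₂ hd₁ hd₂, key hP₂ hP₁ hd₂ hd₁, Finset.sum_comm]
  refine Finset.sum_congr rfl fun I' hI' => Finset.sum_congr rfl fun I hI => ?_
  rw [ncard_idealQuotients_comm P₂ P₁]
  rcases (idealQuotients P₁ P₂ I I').eq_empty_or_nonempty with h | ⟨f, hf⟩
  · simp [h]
  · rw [(eq_of_mem_idealQuotients (mem_idealsOfDegree.1 hI).1 (mem_idealsOfDegree.1 hI').1
      hP₁ hP₂ hf).2 ψ]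

end IdealSums

section NewtonRecurrence

open UniqueFactorizationMonoid

variable {α : Type*} [CommMonoidWithZero α] [UniqueFactorizationMonoid α]
  [NormalizationMonoid α] [Subsingleton αˣ]

open Classical in
theorem UniqueFactorizationMonoid.sum_multiset_normalizedFactors_eq (deg : α → ℕ) (h1 : deg 1 = 0)
    (hmul : ∀ a b, a ≠ 0 → b ≠ 0 → deg (a * b) = deg a + deg b) {a : α} (ha : a ≠ 0) :
    deg a = ((normalizedFactors a).map deg).sum := by
  revert ha
  induction a using UniqueFactorizationMonoid.induction_on_prime with
  | h₁ => exact fun h => absurd rfl h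
  | h₂ a hu =>
    intro _
    have : a = 1 := by simpa using hu
    rw [this, normalizedFactors_one, h1]; simp
  | h₃ a P ha hP ih =>
    intro _
    rw [normalizedFactors_mul hP.ne_zero ha, normalizedFactors_irreducible hP.irreducible,
      hmul _ _ hP.ne_zero ha, ih ha,
      associated_iff_eq.1 (normalize_associated P)]
    simp

variable [Nontrivial α]

open Classical in
/-- The power sums attached to the Euler factors of a Dirichlet-type series. -/
noncomputable def primePowerSum (D : ℕ → Finset α) (χ : α → ℂ) (m : ℕ) : ℂ :=
  ∑ x ∈ m.divisorsAntidiagonal, ∑ P ∈ (D x.1).filter Prime, (x.1 : ℂ) * χ P ^ x.2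

open Classical in
theorem mul_sum_eq_sum_primePowerSum_mul (deg : α → ℕ) (h1 : deg 1 = 0)
    (hmul : ∀ a b, a ≠ 0 → b ≠ 0 → deg (a * b) = deg a + deg b)
    (hpos : ∀ P, Prime P → 0 < deg P) (D : ℕ → Finset α)
    (hD : ∀ N a, a ∈ D N ↔ a ≠ 0 ∧ deg a = N) (χ : α → ℂ) (hχ1 : χ 1 = 1)
    (hχ : ∀ a b, a ≠ 0 → b ≠ 0 → χ (a * b) = χ a * χ b) (N : ℕ) :
    (N : ℂ) * ∑ a ∈ D N, χ a =
      ∑ m ∈ Finset.Icc 1 N, primePowerSum D χ m * ∑ a ∈ D (N - m), χ a := by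
  have hpow : ∀ P : α, P ≠ 0 → ∀ j, P ^ j ≠ 0 ∧ deg (P ^ j) = j * deg P ∧ χ (P ^ j) = χ P ^ j := by
    intro P hP j
    induction j with
    | zero => simp [h1, hχ1]
    | succ j ih =>
      refine ⟨pow_ne_zero _ hP, ?_, ?_⟩
      · rw [pow_succ, hmul _ _ ih.1 hP, ih.2.1]; ring
      · rw [pow_succ, hχ _ _ ih.1 hP, ih.2.2, pow_succ]
  -- the degree as a sum over prime powers
  have hdeg : ∀ a ∈ D N, (N : ℂ) = ∑ d ∈ Finset.Icc 1 N, ∑ P ∈ (D d).filter Prime,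
      ∑ j ∈ Finset.Icc 1 N, if P ^ j ∣ a then (d : ℂ) else 0 := by
    intro a ha
    obtain ⟨ha0, haN⟩ := (hD _ _).1 ha
    have e1 := sum_multiset_normalizedFactors_eq deg h1 hmul ha0
    rw [Finset.sum_multiset_map_count, haN] at e1
    have hle : ∀ P : α, Prime P → ∀ j, P ^ j ∣ a → j ≤ N ∧ (1 ≤ j → deg P ≤ N) := by
      rintro P hP j ⟨b, rfl⟩
      have hb : b ≠ 0 := right_ne_zero_of_mul ha0
      rw [hmul _ _ (hpow P hP.ne_zero j).1 hb, (hpow P hP.ne_zero j).2.1] at haN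
      have := hpos P hP
      exact ⟨by nlinarith, fun hj => by nlinarith⟩
    have hcnt : ∀ P : α, Prime P → (∑ j ∈ Finset.Icc 1 N, if P ^ j ∣ a then (deg P : ℂ) else 0) =
        (Multiset.count P (normalizedFactors a) : ℂ) * deg P := by
      intro P hP
      have e2 : (Finset.Icc 1 N).filter (fun j => P ^ j ∣ a) =
          Finset.Icc 1 (Multiset.count P (normalizedFactors a)) := by
        ext j
        have e3 : P ^ j ∣ a ↔ j ≤ Multiset.count P (normalizedFactors a) := by
          rw [pow_dvd_iff_le_emultiplicity,
            emultiplicity_eq_count_normalizedFactors hP.irreducible ha0,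
            associated_iff_eq.1 (normalize_associated P)]
          exact Nat.cast_le
        rw [Finset.mem_filter, Finset.mem_Icc, Finset.mem_Icc, e3]
        constructor
        · rintro ⟨⟨h, _⟩, h'⟩; exact ⟨h, h'⟩
        · rintro ⟨h, h'⟩; exact ⟨⟨h, (hle P hP j (e3.2 h')).1⟩, h'⟩
      rw [← Finset.sum_filter, e2, Finset.sum_const, Nat.card_Icc, nsmul_eq_mul]
      simp
    have e4 : ∀ d ∈ Finset.Icc 1 N, ∑ P ∈ (D d).filter Prime,
      ∑ j ∈ Finset.Icc 1 N, (if P ^ j ∣ a then (d : ℂ) else 0) =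
        ∑ P ∈ (normalizedFactors a).toFinset with deg P = d,
          (Multiset.count P (normalizedFactors a) : ℂ) * deg P := by
      intro d _
      have e5 : ∀ P ∈ (D d).filter Prime, ∑ j ∈ Finset.Icc 1 N,
          (if P ^ j ∣ a then (d : ℂ) else 0) =
          (Multiset.count P (normalizedFactors a) : ℂ) * deg P := by
        intro P hP
        rw [Finset.mem_filter, hD] at hP
        rw [← hcnt P hP.2, hP.1.2]
      rw [Finset.sum_congr rfl e5]
      symm
      refine Finset.sum_subset ?_ ?_
      · intro P hP
        rw [Finset.mem_filter, Multiset.mem_toFinset, mem_normalizedFactors_iff ha0] at hP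
        rw [Finset.mem_filter, hD]
        exact ⟨⟨hP.1.1.ne_zero, hP.2⟩, hP.1.1⟩
      · intro P hP hP'
        rw [Finset.mem_filter, hD] at hP
        rw [Finset.mem_filter, Multiset.mem_toFinset] at hP'
        have : P ∉ normalizedFactors a := fun h => hP' ⟨h, hP.1.2⟩
        rw [Multiset.count_eq_zero.2 this]; simp
    rw [Finset.sum_congr rfl e4, Finset.sum_fiberwise_of_maps_to]
    · rw [e1]; push_cast
      exact Finset.sum_congr rfl fun P _ => by simp
    · intro P hP
      rw [Multiset.mem_toFinset, mem_normalizedFactors_iff ha0] at hP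
      rw [Finset.mem_Icc]
      exact ⟨hpos P hP.1, (hle P hP.1 1 (by simpa using hP.2)).2 le_rfl⟩
  have hinner : ∀ d ∈ Finset.Icc 1 N, ∀ P ∈ (D d).filter Prime, ∀ j ∈ Finset.Icc 1 N,
      ∑ a ∈ D N, χ a * (if P ^ j ∣ a then (d : ℂ) else 0) =
        if j * d ≤ N then (d : ℂ) * χ P ^ j * ∑ a ∈ D (N - j * d), χ a else 0 := by
    intro d _ P hP j _
    rw [Finset.mem_filter, hD] at hP
    obtain ⟨p1, p2, p3⟩ := hpow P hP.1.1 j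
    rw [hP.1.2] at p2
    have e : ∀ a, χ a * (if P ^ j ∣ a then (d : ℂ) else 0) = if P ^ j ∣ a then χ a * d else 0 := by
      intro a; split_ifs <;> simp
    simp_rw [e]
    rw [← Finset.sum_filter]
    split_ifs with hj
    · rw [Finset.mul_sum]
      symm
      refine Finset.sum_bij (fun a _ => P ^ j * a) ?_ ?_ ?_ ?_
      · intro a ha
        rw [hD] at ha
        rw [Finset.mem_filter, hD]
        refine ⟨⟨mul_ne_zero p1 ha.1, ?_⟩, dvd_mul_right _ _⟩
        rw [hmul _ _ p1 ha.1, ha.2, p2]; omega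
      · intro a _ b _ hab
        exact mul_left_cancel₀ p1 hab
      · intro b hb
        rw [Finset.mem_filter, hD] at hb
        obtain ⟨⟨hb0, hbN⟩, a, rfl⟩ := hb
        have ha0 := right_ne_zero_of_mul hb0
        refine ⟨a, (hD _ _).2 ⟨ha0, ?_⟩, rfl⟩
        rw [hmul _ _ p1 ha0, p2] at hbN; omega
      · intro a ha
        rw [hD] at ha
        rw [hχ _ _ p1 ha.1, p3]; ring
    · rw [Finset.filter_false_of_mem, Finset.sum_empty]
      rintro b hb ⟨a, rfl⟩
      obtain ⟨hb0, hbN⟩ := (hD _ _).1 hb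
      have ha0 := right_ne_zero_of_mul hb0
      rw [hmul _ _ p1 ha0, p2] at hbN; omega
  have s1 : (N : ℂ) * ∑ a ∈ D N, χ a = ∑ d ∈ Finset.Icc 1 N, ∑ P ∈ (D d).filter Prime,
      ∑ j ∈ Finset.Icc 1 N,
        if j * d ≤ N then (d : ℂ) * χ P ^ j * ∑ a ∈ D (N - j * d), χ a else 0 := by
    rw [mul_comm, Finset.sum_mul]
    calc _ = ∑ a ∈ D N, ∑ d ∈ Finset.Icc 1 N, ∑ P ∈ (D d).filter Prime,
      ∑ j ∈ Finset.Icc 1 N, χ a * (if P ^ j ∣ a then (d : ℂ) else 0) := by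
          refine Finset.sum_congr rfl fun a ha => ?_
          conv_lhs => rw [hdeg a ha]
          simp_rw [Finset.mul_sum]
      _ = _ := by
          rw [Finset.sum_comm]
          refine Finset.sum_congr rfl fun d hd => ?_
          rw [Finset.sum_comm]
          refine Finset.sum_congr rfl fun P hP => ?_
          rw [Finset.sum_comm]
          exact Finset.sum_congr rfl fun j hj => hinner d hd P hP j hj
  let F : ℕ × ℕ → ℂ := fun x => ∑ P ∈ (D x.1).filter Prime,
    (x.1 : ℂ) * χ P ^ x.2 * ∑ a ∈ D (N - x.2 * x.1), χ a
  have s2 : (N : ℂ) * ∑ a ∈ D N, χ a =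
      ∑ x ∈ (Finset.Icc 1 N ×ˢ Finset.Icc 1 N) with x.2 * x.1 ≤ N, F x := by
    rw [s1, Finset.sum_filter, Finset.sum_product]
    refine Finset.sum_congr rfl fun d _ => ?_
    rw [Finset.sum_comm]
    refine Finset.sum_congr rfl fun j _ => ?_
    simp only [F]
    split_ifs
    · rfl
    · simp
  rw [s2, ← Finset.sum_fiberwise_of_maps_to (g := fun x : ℕ × ℕ => x.2 * x.1)
    (t := Finset.Icc 1 N)]
  · refine Finset.sum_congr rfl fun m hm => ?_
    rw [primePowerSum, Finset.sum_mul]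
    rw [Finset.mem_Icc] at hm
    refine Finset.sum_congr ?_ ?_
    · ext ⟨d, j⟩
      simp only [Finset.mem_filter, Finset.mem_product, Finset.mem_Icc,
        Nat.mem_divisorsAntidiagonal]
      constructor
      · rintro ⟨_, h⟩
        exact ⟨by rw [← h, mul_comm], by omega⟩
      · rintro ⟨h, _⟩
        have hd : 0 < d := Nat.pos_of_ne_zero (by rintro rfl; omega)
        have hj : 0 < j := Nat.pos_of_ne_zero (by rintro rfl; omega)
        refine ⟨⟨⟨⟨hd, ?_⟩, hj, ?_⟩, ?_⟩, ?_⟩ <;> nlinarith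
    · rintro ⟨d, j⟩ hx
      rw [Nat.mem_divisorsAntidiagonal] at hx
      simp only [F]
      rw [Finset.sum_mul, mul_comm j d, hx.1]
  · rintro ⟨d, j⟩ hx
    simp only [Finset.mem_filter, Finset.mem_product, Finset.mem_Icc] at hx ⊢
    exact ⟨Nat.mul_pos (by omega) (by omega), hx.2⟩

end NewtonRecurrence

section ResidueHoms

variable {p : ℕ} [Fact p.Prime] {Ω : Type*} [Field Ω] [CharP Ω p] [Algebra (ZMod p) Ω]

omit [CharP Ω p] in
theorem AlgHom.forall_pow_eq_iff_finrank_dvd {κ : Type*} [Field κ] [Algebra (ZMod p) κ]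
    [Module.Finite (ZMod p) κ] (g : κ →ₐ[ZMod p] Ω) (m : ℕ) :
    (∀ a, g a ^ p ^ m = g a) ↔ Module.finrank (ZMod p) κ ∣ m := by
  have _ : _root_.Finite κ := Module.finite_of_finite (ZMod p)
  rw [← FiniteField.orderOf_frobeniusAlgHom (ZMod p) κ, orderOf_dvd_iff_pow_eq_one, AlgHom.ext_iff]
  refine forall_congr' fun a => ?_
  have hi : g (a ^ p ^ m) = g a ↔ a ^ p ^ m = a := g.injective.eq_iff
  rw [← map_pow, hi, AlgHom.coe_pow, FiniteField.coe_frobeniusAlgHom, pow_iterate, ZMod.card]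
  rfl

theorem AlgHom.psiTr_eq_pow {κ : Type*} [Field κ] [Algebra (ZMod p) κ]
    [Module.Finite (ZMod p) κ] (g : κ →ₐ[ZMod p] Ω) (ψ : AddChar (ZMod p) ℂ) (j : ℕ) (x : κ) :
    psiTr ψ (Module.finrank (ZMod p) κ * j) (g x) = ψ (Algebra.trace (ZMod p) κ x) ^ j := by
  have _ : _root_.Finite κ := Module.finite_of_finite (ZMod p)
  rw [← AddChar.map_nsmul_eq_pow]
  refine psiTr_eq ψ ?_
  have h0 : ∀ c : ZMod p, ZMod.castHom (dvd_refl p) Ω c = algebraMap (ZMod p) Ω c := fun c =>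
    congrFun (congrArg DFunLike.coe (Subsingleton.elim (ZMod.castHom (dvd_refl p) Ω) (algebraMap (ZMod p) Ω))) c
  have h1 := congrArg g (FiniteField.algebraMap_trace_eq_sum_pow (ZMod p) κ x)
  rw [g.commutes, map_sum] at h1
  have h2 := (AlgHom.forall_pow_eq_iff_finrank_dvd g (Module.finrank (ZMod p) κ)).2 dvd_rfl
  set d := Module.finrank (ZMod p) κ
  rw [h0, map_nsmul, h1]
  induction j with
  | zero => simp
  | succ j ih =>
    rw [mul_add, mul_one, Finset.sum_range_add, ← ih, succ_nsmul]
    congr 1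
    refine Finset.sum_congr rfl fun i _ => ?_
    rw [pow_add, pow_mul]
    have : g x ^ p ^ (d * j) = g x :=
      (AlgHom.forall_pow_eq_iff_finrank_dvd g (d * j)).2 (dvd_mul_right _ _) x
    rw [this, map_pow, Nat.card_zmod]

variable [IsAlgClosed Ω]

theorem exists_finset_ker_eq {A : Type*} [CommRing A] [Algebra (ZMod p) A] (P : Ideal A)
    [P.IsMaximal] [Module.Finite (ZMod p) (A ⧸ P)] :
    ∃ K : Finset (A →ₐ[ZMod p] Ω), (∀ h, h ∈ K ↔ RingHom.ker h = P) ∧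
      K.card = Module.finrank (ZMod p) (A ⧸ P) ∧
      ∀ h ∈ K, (∀ m, (∀ a, h a ^ p ^ m = h a) ↔ Module.finrank (ZMod p) (A ⧸ P) ∣ m) ∧
        ∀ (ψ : AddChar (ZMod p) ℂ) (j : ℕ) (x : A),
          psiTr ψ (Module.finrank (ZMod p) (A ⧸ P) * j) (h x) =
            ψ (Algebra.trace (ZMod p) (A ⧸ P) (Ideal.Quotient.mk P x)) ^ j := by
  classical
  let _ : Field (A ⧸ P) := Ideal.Quotient.field P
  have hinj : Function.Injective fun g : (A ⧸ P) →ₐ[ZMod p] Ω =>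
      g.comp (Ideal.Quotient.mkₐ (ZMod p) P) := fun g g' h =>
    (AlgHom.cancel_right (Ideal.Quotient.mkₐ_surjective _ _)).1 h
  refine ⟨Finset.univ.map ⟨_, hinj⟩, ?_, ?_, ?_⟩
  · intro h
    simp only [Finset.mem_map, Finset.mem_univ, true_and, Function.Embedding.coeFn_mk]
    constructor
    · rintro ⟨g, rfl⟩
      ext a
      rw [RingHom.mem_ker]
      change g (Ideal.Quotient.mk P a) = 0 ↔ _
      rw [map_eq_zero_iff g g.injective, Ideal.Quotient.eq_zero_iff_mem]
    · intro hk
      refine ⟨Ideal.Quotient.liftₐ P h fun a ha => ?_, ?_⟩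
      · rw [← hk] at ha; exact ha
      · ext a; rfl
  · rw [Finset.card_map, Finset.card_univ]
    exact AlgHom.card (ZMod p) (A ⧸ P) Ω
  · intro h hh
    obtain ⟨g, -, rfl⟩ := Finset.mem_map.1 hh
    refine ⟨fun m => ?_, fun ψ j x => AlgHom.psiTr_eq_pow g ψ j _⟩
    rw [← AlgHom.forall_pow_eq_iff_finrank_dvd g m]
    exact ⟨fun H b => by obtain ⟨a, rfl⟩ := Ideal.Quotient.mk_surjective b; exact H a,
      fun H a => H _⟩

end ResidueHoms

section FixedHoms

variable {p : ℕ} [Fact p.Prime] {L : Type*} [Field L] [Algebra (RatFunc (ZMod p)) L]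
  [Algebra (ZMod p)[X] L] [IsScalarTower (ZMod p)[X] (RatFunc (ZMod p)) L]
  [FiniteDimensional (RatFunc (ZMod p)) L] [Algebra.IsSeparable (RatFunc (ZMod p)) L]
  [Algebra (ZMod p) L] [IsScalarTower (ZMod p) (RatFunc (ZMod p)) L]
  {Ω : Type*} [Field Ω] [CharP Ω p] [Algebra (ZMod p) Ω] [IsAlgClosed Ω]

omit [CharP Ω p] [IsAlgClosed Ω] [IsScalarTower (ZMod p) (RatFunc (ZMod p)) L] in
theorem ker_ne_bot_of_pow_eq {m : ℕ} (hm : 0 < m)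
    (h : integralClosure (ZMod p)[X] L →ₐ[ZMod p] Ω) (hh : ∀ a, h a ^ p ^ m = h a) :
    RingHom.ker h ≠ ⊥ := by
  intro hk
  have h1 : algebraMap (ZMod p)[X] (integralClosure (ZMod p)[X] L)
      (Polynomial.X ^ p ^ m - Polynomial.X) ∈ RingHom.ker h := by
    rw [RingHom.mem_ker, map_sub, map_pow, map_sub, map_pow, hh, sub_self]
  rw [hk, Ideal.mem_bot, map_eq_zero_iff _ (FaithfulSMul.algebraMap_injective _ _)] at h1
  exact FiniteField.X_pow_card_sub_X_ne_zero (ZMod p)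
    (Nat.one_lt_pow hm.ne' (Fact.out : p.Prime).one_lt) h1

set_option maxHeartbeats 1000000 in
set_option synthInstance.maxHeartbeats 100000 in
theorem exists_finset_primePowerSum_eq (ψ : AddChar (ZMod p) ℂ) {m : ℕ} (hm : 0 < m) :
    ∃ H : Finset (integralClosure (ZMod p)[X] L →ₐ[ZMod p] Ω),
      (∀ h, h ∈ H ↔ ∀ a, h a ^ p ^ m = h a) ∧
      primePowerSum (idealsOfDegree (ZMod p) L) (idealChar ψ) m =
        ∑ h ∈ H, psiTr ψ m (h (algebraMap (ZMod p)[X] _ Polynomial.X)) := by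
  classical
  have key : ∀ P : Ideal (integralClosure (ZMod p)[X] L), ∃ K : Finset
      (integralClosure (ZMod p)[X] L →ₐ[ZMod p] Ω), Prime P → (∀ h, h ∈ K ↔ RingHom.ker h = P) ∧
      K.card = (normPoly P).natDegree ∧
      ∀ h ∈ K, (∀ m, (∀ a, h a ^ p ^ m = h a) ↔ (normPoly P).natDegree ∣ m) ∧
        ∀ (j : ℕ), psiTr ψ ((normPoly P).natDegree * j)
          (h (algebraMap (ZMod p)[X] _ Polynomial.X)) = idealChar ψ P ^ j := by
    intro P
    by_cases hP : Prime P
    · have hP0 : P ≠ ⊥ := hP.ne_zero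
      have _ : P.IsPrime := (Ideal.prime_iff_isPrime hP0).1 hP
      have _ : P.IsMaximal := Ring.DimensionLEOne.maximalOfPrime hP0 inferInstance
      have _ : NeZero P := ⟨hP0⟩
      obtain ⟨h1, h2⟩ := normPoly_prime P hP0
      obtain ⟨K, hK1, hK2, hK3⟩ := exists_finset_ker_eq (Ω := Ω) P
      refine ⟨K, fun _ => ⟨hK1, by rw [hK2, h1], fun h hh => ⟨?_, fun j => ?_⟩⟩⟩
      · rw [h1]; exact (hK3 h hh).1
      · rw [h1, (hK3 h hh).2, idealChar, h2, neg_neg]; rfl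
    · exact ⟨∅, fun h => absurd h hP⟩
  choose K hK using key
  refine ⟨m.divisorsAntidiagonal.biUnion fun x =>
    ((idealsOfDegree (ZMod p) L x.1).filter Prime).biUnion K, ?_, ?_⟩
  · intro h
    simp only [Finset.mem_biUnion, Finset.mem_filter, mem_idealsOfDegree]
    constructor
    · rintro ⟨⟨d, j⟩, hx, P, ⟨⟨hP0, hd⟩, hP⟩, hh⟩
      rw [Nat.mem_divisorsAntidiagonal] at hx
      rw [((hK P hP).2.2 h hh).1, hd, ← hx.1]
      exact dvd_mul_right _ _
    · intro hh
      have hP0 := ker_ne_bot_of_pow_eq hm h hh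
      have hP : Prime (RingHom.ker h) := (Ideal.prime_iff_isPrime hP0).2 (RingHom.ker_isPrime _)
      have hmem := ((hK _ hP).1 h).2 rfl
      obtain ⟨j, hj⟩ := (((hK _ hP).2.2 h hmem).1 m).1 hh
      exact ⟨(_, j), Nat.mem_divisorsAntidiagonal.2 ⟨hj.symm, hm.ne'⟩, RingHom.ker h,
        ⟨⟨hP0, rfl⟩, hP⟩, hmem⟩
  · have hdisj : ∀ P P' : Ideal (integralClosure (ZMod p)[X] L), Prime P → Prime P' → P ≠ P' →
        Disjoint (K P) (K P') := by
      intro P P' hP hP' hne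
      rw [Finset.disjoint_left]
      intro h h1 h2
      exact hne ((((hK P hP).1 h).1 h1).symm.trans (((hK P' hP').1 h).1 h2))
    rw [primePowerSum, Finset.sum_biUnion]
    · refine Finset.sum_congr rfl ?_
      rintro ⟨d, j⟩ hx
      rw [Nat.mem_divisorsAntidiagonal] at hx
      rw [Finset.sum_biUnion]
      · refine Finset.sum_congr rfl fun P hP => ?_
        rw [Finset.mem_filter, mem_idealsOfDegree] at hP
        obtain ⟨⟨hP0, hd⟩, hP⟩ := hP
        simp only at hd hx
        have h1 : ∀ h ∈ K P, psiTr ψ m (h (algebraMap (ZMod p)[X] _ Polynomial.X)) =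
            idealChar ψ P ^ j := by
          intro h hh
          rw [← ((hK P hP).2.2 h hh).2 j, hd, hx.1]
        rw [Finset.sum_congr rfl h1, Finset.sum_const, (hK P hP).2.1, hd, nsmul_eq_mul]
      · intro P hP P' hP' hne
        exact hdisj P P' (Finset.mem_filter.1 hP).2 (Finset.mem_filter.1 hP').2 hne
    · rintro ⟨d, j⟩ hx ⟨d', j'⟩ hx' hne
      simp only [Function.onFun, Finset.disjoint_biUnion_left, Finset.disjoint_biUnion_right,
        Finset.mem_filter, mem_idealsOfDegree]
      rintro P ⟨⟨_, hd⟩, hP⟩ P' ⟨⟨_, hd'⟩, hP'⟩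
      refine (hdisj P P' hP hP' ?_).symm
      rintro rfl
      rw [Finset.mem_coe, Nat.mem_divisorsAntidiagonal] at hx hx'
      apply hne
      simp only at hd hd' hx hx'
      have hdd : d = d' := hd'.symm.trans hd
      subst hdd
      have h0 : d ≠ 0 := by rintro rfl; omega
      rw [Prod.mk.injEq]
      exact ⟨rfl, Nat.eq_of_mul_eq_mul_left (Nat.pos_of_ne_zero h0) (hx.1.trans hx'.1.symm)⟩

end FixedHoms

section PowerSums

open Filter Topology

theorem PowerSeries.X_mul_derivative_prod (s : Multiset ℂ) :
    PowerSeries.X * PowerSeries.derivative ℂ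
        ((s.map fun w => 1 - PowerSeries.C w * PowerSeries.X).prod) =
      PowerSeries.mk (fun m => if m = 0 then 0 else -(s.map (· ^ m)).sum) *
        (s.map fun w => 1 - PowerSeries.C w * PowerSeries.X).prod := by
  induction s using Multiset.induction_on with
  | empty =>
    have : (PowerSeries.mk fun m => if m = 0 then (0 : ℂ) else
        -((0 : Multiset ℂ).map (· ^ m)).sum) = 0 := by
      ext m; simp
    rw [this]; simp
  | cons w s ih =>
    rw [Multiset.map_cons, Multiset.prod_cons]
    generalize (s.map fun w => 1 - PowerSeries.C w * PowerSeries.X).prod = B at ih ⊢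
    have h1 : (PowerSeries.mk fun m => if m = 0 then (0 : ℂ) else -((w ::ₘ s).map (· ^ m)).sum) =
        PowerSeries.mk (fun m => if m = 0 then 0 else -w ^ m) +
          PowerSeries.mk fun m => if m = 0 then 0 else -(s.map (· ^ m)).sum := by
      ext m
      rw [map_add, PowerSeries.coeff_mk, PowerSeries.coeff_mk, PowerSeries.coeff_mk]
      split_ifs
      · simp
      · rw [Multiset.map_cons, Multiset.sum_cons]; ring
    have h2 : PowerSeries.mk (fun m => if m = 0 then (0 : ℂ) else -w ^ m) *
        (1 - PowerSeries.C w * PowerSeries.X) = - (PowerSeries.C w * PowerSeries.X) := by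
      ext m
      rw [mul_sub, mul_one, ← mul_assoc, mul_comm _ (PowerSeries.C w), mul_assoc, map_sub,
        PowerSeries.coeff_C_mul, map_neg, PowerSeries.coeff_C_mul]
      cases m with
      | zero => simp
      | succ m =>
        rw [PowerSeries.coeff_succ_mul_X, PowerSeries.coeff_mk, PowerSeries.coeff_mk,
          PowerSeries.coeff_X]
        by_cases hm : m = 0
        · simp [hm]
        · simp [hm, pow_succ']
    have h3 : PowerSeries.derivative ℂ (1 - PowerSeries.C w * PowerSeries.X) = - PowerSeries.C w := by
      rw [map_sub, PowerSeries.derivative_one, Derivation.leibniz, PowerSeries.derivative_C,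
        PowerSeries.derivative_X]
      simp
    rw [Derivation.leibniz, h3, h1, smul_eq_mul, smul_eq_mul]
    linear_combination (1 - PowerSeries.C w * PowerSeries.X) * ih - B * h2

theorem eq_neg_sum_pow_of_recurrence (s : Multiset ℂ) (b S : ℕ → ℂ)
    (hb : PowerSeries.mk b = (s.map fun w => 1 - PowerSeries.C w * PowerSeries.X).prod)
    (hrec : ∀ N : ℕ, (N : ℂ) * b N = ∑ m ∈ Finset.Icc 1 N, S m * b (N - m)) {m : ℕ} (hm : 0 < m) :
    S m = -(s.map (· ^ m)).sum := by
  have h1 := PowerSeries.X_mul_derivative_prod s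
  rw [← hb] at h1
  have h2 : PowerSeries.X * PowerSeries.derivative ℂ (PowerSeries.mk b) =
      PowerSeries.mk (fun m => if m = 0 then 0 else S m) * PowerSeries.mk b := by
    ext N
    have e1 : PowerSeries.coeff N (PowerSeries.X * PowerSeries.derivative ℂ (PowerSeries.mk b)) =
        (N : ℂ) * b N := by
      cases N with
      | zero => simp
      | succ N =>
        rw [PowerSeries.coeff_succ_X_mul, PowerSeries.coeff_derivative, PowerSeries.coeff_mk]
        push_cast; ring
    rw [e1, hrec, PowerSeries.coeff_mul, Finset.Nat.sum_antidiagonal_eq_sum_range_succ_mk, Finset.sum_range_eq_add_Ico _ (Nat.succ_pos N)]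
    simp only [PowerSeries.coeff_mk, if_true, zero_mul, zero_add]
    refine Finset.sum_congr ?_ fun i hi => ?_
    · ext i; simp only [Finset.mem_Icc, Finset.mem_Ico]; omega
    · rw [Finset.mem_Ico] at hi
      rw [if_neg (by omega)]
  have h0 : PowerSeries.mk b ≠ 0 := by
    rw [hb]
    intro h
    have := congrArg PowerSeries.constantCoeff h
    rw [map_multiset_prod, Multiset.map_map] at this
    simp at this
  have h3 := congrArg (PowerSeries.coeff m) (mul_right_cancel₀ h0 (h2.symm.trans h1))
  rw [PowerSeries.coeff_mk, PowerSeries.coeff_mk, if_neg hm.ne', if_neg hm.ne'] at h3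
  exact h3

theorem Polynomial.exists_eq_prod_one_sub (B : Polynomial ℂ) (h0 : B.coeff 0 = 1) :
    ∃ s : Multiset ℂ, Multiset.card s ≤ B.natDegree ∧
      B = (s.map fun w => 1 - Polynomial.C w * Polynomial.X).prod := by
  have hB : B ≠ 0 := by rintro rfl; simp at h0
  refine ⟨B.roots.map (·⁻¹), by rw [Multiset.card_map]; exact Polynomial.card_roots' B, ?_⟩
  have h1 := (IsAlgClosed.splits B).eq_prod_roots
  have h2 : (B.roots.map fun x => Polynomial.X - Polynomial.C x) =
      B.roots.map fun x => Polynomial.C (-x) * (1 - Polynomial.C x⁻¹ * Polynomial.X) := by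
    refine Multiset.map_congr rfl fun x hx => ?_
    have hx0 : x ≠ 0 := by
      rintro rfl
      rw [Polynomial.mem_roots hB, Polynomial.IsRoot, ← Polynomial.coeff_zero_eq_eval_zero, h0] at hx
      exact one_ne_zero hx
    have h3 : (Polynomial.C x : Polynomial ℂ) * Polynomial.C x⁻¹ = 1 := by
      rw [← Polynomial.C_mul, mul_inv_cancel₀ hx0, Polynomial.C_1]
    rw [Polynomial.C_neg]
    linear_combination (-Polynomial.X : Polynomial ℂ) * h3
  rw [h2, Multiset.prod_map_mul] at h1
  have h4 : (B.roots.map fun x => (Polynomial.C (-x) : Polynomial ℂ)).prod =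
      Polynomial.C (B.roots.map fun x => -x).prod := by
    rw [map_multiset_prod, Multiset.map_map]; rfl
  rw [h4, ← mul_assoc, ← Polynomial.C_mul] at h1
  have h5 := congrArg (Polynomial.eval 0) h1
  rw [← Polynomial.coeff_zero_eq_eval_zero, h0, Polynomial.eval_mul, Polynomial.eval_C,
    Polynomial.eval_multiset_prod, Multiset.map_map] at h5
  have h6 : (B.roots.map (Polynomial.eval 0 ∘ fun x => 1 - Polynomial.C x⁻¹ * Polynomial.X)).prod = 1 :=
    Multiset.prod_eq_one fun y hy => by
      obtain ⟨x, -, rfl⟩ := Multiset.mem_map.1 hy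
      simp
  rw [h6, mul_one] at h5
  rw [Multiset.map_map]
  conv_lhs => rw [h1, ← h5]
  rw [Polynomial.C_1, one_mul]
  rfl

/-- If the power sums of finitely many complex numbers are `O(q^i)`, all of them have absolute
value at most `q`. -/
theorem norm_le_of_norm_sum_pow_le {ι : Type*} [Fintype ι] (α : ι → ℂ) {q C : ℝ} (hq : 0 < q)
    (h : ∀ᶠ i : ℕ in atTop, ‖∑ x, α x ^ i‖ ≤ C * q ^ i) (x : ι) : ‖α x‖ ≤ q := by
  classical
  have _ : Nonempty ι := ⟨x⟩
  obtain ⟨x₀, hx₀⟩ := Finite.exists_max fun x => ‖α x‖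
  refine (hx₀ x).trans ?_
  by_contra! hR
  set R := ‖α x₀‖
  have hR0 : 0 < R := hq.trans hR
  let T : Finset ι := Finset.univ.filter fun x => ‖α x‖ = R
  have hT : ∀ y : T, ‖α y.1 / R‖ = 1 := by
    intro y
    have := (Finset.mem_filter.1 y.2).2
    rw [norm_div, this, Complex.norm_real, Real.norm_of_nonneg hR0.le, div_self hR0.ne']
  let z : T → Circle := fun y => ⟨α y.1 / R, mem_sphere_zero_iff_norm.2 (hT y)⟩
  have hz := mapClusterPt_one_atTop_pow z
  have hF : Tendsto (fun w : T → Circle => ∑ y, (w y : ℂ)) (𝓝 1) (𝓝 (∑ y : T, ((1 : T → Circle) y : ℂ))) :=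
    Continuous.tendsto (by fun_prop) 1
  have hz2 := hz.tendsto_comp hF
  have hlim : Tendsto (fun i : ℕ => ∑ y : T, ((z ^ i) y : ℂ)) atTop (𝓝 0) := by
    have e1 : ∀ i : ℕ, ∑ y : T, ((z ^ i) y : ℂ) =
        (∑ y, α y ^ i) / R ^ i - ∑ y ∈ Tᶜ, (α y / R) ^ i := by
      intro i
      have e2 : ∑ y : T, ((z ^ i) y : ℂ) = ∑ y ∈ T, (α y / R) ^ i := by
        rw [← Finset.sum_coe_sort T]
        refine Finset.sum_congr rfl fun y _ => ?_
        rw [Pi.pow_apply, Circle.coe_pow]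
      rw [e2, eq_sub_iff_add_eq, Finset.sum_add_sum_compl, Finset.sum_div]
      exact Finset.sum_congr rfl fun y _ => div_pow _ _ _
    simp_rw [e1]
    have l1 : Tendsto (fun i : ℕ => (∑ y, α y ^ i) / (R : ℂ) ^ i) atTop (𝓝 0) := by
      have l2 : Tendsto (fun i : ℕ => C * (q / R) ^ i) atTop (𝓝 (C * 0)) :=
        (tendsto_pow_atTop_nhds_zero_of_lt_one (by positivity) ((div_lt_one hR0).2 hR)).const_mul C
      rw [mul_zero] at l2
      refine squeeze_zero_norm' ?_ l2
      filter_upwards [h] with i hi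
      rw [norm_div, norm_pow, Complex.norm_real, Real.norm_of_nonneg hR0.le, div_pow, ← mul_div_assoc]
      gcongr
    have l3 : Tendsto (fun i : ℕ => ∑ y ∈ Tᶜ, (α y / R) ^ i) atTop (𝓝 (∑ y ∈ Tᶜ, 0)) := by
      refine tendsto_finsetSum _ fun y hy => ?_
      refine tendsto_pow_atTop_nhds_zero_of_norm_lt_one ?_
      rw [norm_div, Complex.norm_real, Real.norm_of_nonneg hR0.le, div_lt_one hR0]
      refine lt_of_le_of_ne (hx₀ y) fun h => ?_
      rw [Finset.mem_compl, Finset.mem_filter] at hy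
      exact hy ⟨Finset.mem_univ _, h⟩
    simpa using l1.sub l3
  have h5 : (∑ y : T, ((1 : T → Circle) y : ℂ)) = 0 := by
    have hne := hz2.neBot
    exact tendsto_nhds_unique_of_frequently_eq tendsto_const_nhds tendsto_const_nhds
      (Eventually.frequently (f := atTop) (α := ℕ) (by
        filter_upwards with _
        by_contra hne'
        obtain ⟨U, V, hU, hV, h1, h2, h3⟩ := t2_separation hne'
        obtain ⟨i, hi1, hi2⟩ := ((hz2.frequently (hU.mem_nhds h1)).and_eventually
          (hlim (hV.mem_nhds h2))).exists
        exact Set.disjoint_left.1 h3 hi1 hi2))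
  have h6 : (∑ y : T, ((1 : T → Circle) y : ℂ)) = T.card := by simp
  rw [h6, Nat.cast_eq_zero, Finset.card_eq_zero] at h5
  have : x₀ ∈ T := Finset.mem_filter.2 ⟨Finset.mem_univ _, rfl⟩
  rw [h5] at this
  simp at this

/-- Square-root bound for the first power sum, from bounds for a subsequence of power sums. -/
theorem norm_le_mul_sqrt_of_recurrence (b S : ℕ → ℂ) {M p : ℕ} (hp : 1 < p) (hb0 : b 0 = 1)
    (hbM : ∀ N, M < N → b N = 0)
    (hrec : ∀ N : ℕ, (N : ℂ) * b N = ∑ m ∈ Finset.Icc 1 N, S m * b (N - m))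
    {C : ℝ} {Q t : ℕ} (ht : 0 < t)
    (hS : ∀ j, 0 < j → t ∣ j → Q ≤ p ^ j → ‖S (2 * j)‖ ≤ C * p ^ j) :
    ‖S 1‖ ≤ M * Real.sqrt p := by
  classical
  let B : Polynomial ℂ := ∑ i ∈ Finset.range (M + 1), Polynomial.monomial i (b i)
  have hB : ∀ N, B.coeff N = b N := by
    intro N
    simp only [B, Polynomial.finsetSum_coeff, Polynomial.coeff_monomial, Finset.sum_ite_eq', Finset.mem_range]
    split_ifs with h
    · rfl
    · rw [hbM N (by omega)]
  obtain ⟨s, hs1, hs2⟩ := Polynomial.exists_eq_prod_one_sub B (by rw [hB, hb0])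
  have hM : Multiset.card s ≤ M := by
    refine hs1.trans (Polynomial.natDegree_le_iff_coeff_eq_zero.2 fun N hN => ?_)
    rw [hB, hbM N hN]
  have hmk : PowerSeries.mk b = (s.map fun w => 1 - PowerSeries.C w * PowerSeries.X).prod := by
    have h1 : PowerSeries.mk b = (B : PowerSeries ℂ) := by
      ext N; rw [PowerSeries.coeff_mk, Polynomial.coeff_coe, hB]
    rw [h1]
    conv_lhs => rw [hs2]
    rw [← Polynomial.coeToPowerSeries.ringHom_apply, map_multiset_prod, Multiset.map_map]
    congr 1
    refine Multiset.map_congr rfl fun w _ => ?_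
    simp
  have key := fun {m : ℕ} (hm : 0 < m) => eq_neg_sum_pow_of_recurrence s b S hmk hrec hm
  have hp0 : (0 : ℝ) < p := by exact_mod_cast (by omega : 0 < p)
  have hw : ∀ w : s, ‖(w.1 : ℂ)‖ ≤ Real.sqrt p := by
    intro w
    have h1 : ‖(w.1 : ℂ) ^ (2 * t)‖ ≤ (p : ℝ) ^ t := by
      refine norm_le_of_norm_sum_pow_le (fun w : s => (w.1 : ℂ) ^ (2 * t)) (C := C) (by positivity) ?_ w
      filter_upwards [eventually_ge_atTop (Q + 1)] with i hi
      have hti : t * i ≥ i := Nat.le_mul_of_pos_left i ht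
      have h2 := hS (t * i) (by omega) (dvd_mul_right _ _) (by
        have := (t * i).lt_pow_self hp; omega)
      rw [key (by omega), norm_neg, ← Multiset.map_univ] at h2
      rw [← pow_mul]
      refine le_trans (le_of_eq ?_) h2
      congr 1
      change _ = ∑ x : s, _
      exact Finset.sum_congr rfl fun x _ => by rw [← pow_mul, mul_assoc]
    rw [norm_pow, pow_mul] at h1
    have h2 := le_of_pow_le_pow_left₀ ht.ne' hp0.le h1
    exact Real.le_sqrt_of_sq_le h2
  rw [key one_pos, norm_neg, ← Multiset.map_univ]
  change ‖∑ x : s, (x.1 : ℂ) ^ 1‖ ≤ _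
  refine (norm_sum_le _ _).trans ?_
  refine (Finset.sum_le_sum fun x _ => (by rw [pow_one]; exact hw x : ‖(x.1 : ℂ) ^ 1‖ ≤ Real.sqrt p)).trans ?_
  rw [Finset.sum_const, nsmul_eq_mul, Finset.card_univ, Multiset.card_coe]
  gcongr

end PowerSums

/-- The leading segments of a polynomial relation satisfied by `y` are integral. -/
theorem isIntegral_leading_segment {R L : Type*} [CommRing R] [Field L] [Algebra R L] (a : ℕ → R)
    (y : L) {e : ℕ} (he : 0 < e) (h : ∑ j ∈ Finset.range (e + 1), a j • y ^ j = 0) {i : ℕ}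
    (hi : i ≤ e) : IsIntegral R (∑ j ∈ Finset.range (i + 1), a (e - i + j) • y ^ j) := by
  let N : Submodule R L := Submodule.span R ((fun j => y ^ j) '' (Finset.range e : Set ℕ))
  have hN : ∀ j, j < e → y ^ j ∈ N := fun j hj =>
    Submodule.subset_span ⟨j, Finset.mem_coe.2 (Finset.mem_range.2 hj), rfl⟩
  refine isIntegral_of_smul_mem_submodule N ?_ ?_ _ ?_
  · intro h0
    have := hN 0 he
    rw [h0, Submodule.mem_bot, pow_zero] at this
    exact one_ne_zero this
  · exact Submodule.fg_span ((Finset.finite_toSet _).image _)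
  · intro n hn
    induction hn using Submodule.span_induction with
    | zero => rw [smul_zero]; exact zero_mem _
    | add x x' _ _ hx hx' => rw [smul_add]; exact add_mem hx hx'
    | smul r x _ hx => rw [smul_comm]; exact N.smul_mem r hx
    | mem x hx =>
      obtain ⟨l, hl, rfl⟩ := hx
      rw [Finset.mem_coe, Finset.mem_range] at hl
      simp only [smul_eq_mul]
      by_cases hil : i + l < e
      · rw [Finset.sum_mul]
        refine sum_mem fun j hj => ?_
        rw [Finset.mem_range] at hj
        rw [smul_mul_assoc, ← pow_add]
        exact N.smul_mem _ (hN _ (by omega))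
      · obtain ⟨l', rfl⟩ : ∃ l', l = e - i + l' := ⟨l - (e - i), by omega⟩
        have h1 : (∑ j ∈ Finset.range (i + 1), a (e - i + j) • y ^ j) * y ^ (e - i) =
            -∑ j ∈ Finset.range (e - i), a j • y ^ j := by
          rw [show e + 1 = (e - i) + (i + 1) by omega, Finset.sum_range_add] at h
          rw [eq_neg_iff_add_eq_zero, add_comm, ← h, Finset.sum_mul]
          congr 1
          exact Finset.sum_congr rfl fun j _ => by rw [smul_mul_assoc, ← pow_add, add_comm j]
        rw [pow_add, ← mul_assoc, h1, neg_mul, Finset.sum_mul]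
        refine neg_mem (sum_mem fun j hj => ?_)
        rw [Finset.mem_range] at hj
        rw [smul_mul_assoc, ← pow_add]
        exact N.smul_mem _ (hN _ (by omega))

section PlaneModel

variable {k L : Type*} [Field k] [Field L] [Algebra (RatFunc k) L] [Algebra k[X] L]
  [IsScalarTower k[X] (RatFunc k) L] [Algebra k L] [IsScalarTower k (RatFunc k) L]

theorem algebraMap_polynomial_mem_poleSpace {a : k[X]} {D : ℕ} (ha : a.natDegree ≤ D) :
    algebraMap k[X] L a ∈ poleSpace k L D := by
  rw [IsScalarTower.algebraMap_apply k[X] (RatFunc k) L]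
  exact algebraMap_mem_poleSpace (by rw [RatFunc.intDegree_polynomial]; exact_mod_cast ha)

theorem leading_segment_mem_poleSpace (a : ℕ → k[X]) {D : ℕ} (hD : ∀ j, (a j).natDegree ≤ D)
    (y : L) {e : ℕ} (he : 0 < e) (h : ∑ j ∈ Finset.range (e + 1), a j • y ^ j = 0) {i : ℕ}
    (hi : i ≤ e) :
    ∑ j ∈ Finset.range (i + 1), a (e - i + j) • y ^ j ∈ poleSpace k L D := by
  have hm : ∀ j, RatFunc.X ^ (-(D : ℤ)) * algebraMap k[X] (RatFunc k) (a j) ∈ inftyRing k := by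
    intro j
    refine X_zpow_mul_mem_inftyRing ?_
    rw [RatFunc.intDegree_polynomial, neg_neg]
    exact_mod_cast hD j
  let b : ℕ → inftyRing k := fun j => ⟨_, hm j⟩
  have hb : ∀ j (x : L), b j • x = algebraMap (RatFunc k) L (RatFunc.X ^ (-(D : ℤ))) * (a j • x) := by
    intro j x
    rw [Algebra.smul_def, Algebra.smul_def, ← mul_assoc, IsScalarTower.algebraMap_apply k[X] (RatFunc k) L,
      ← map_mul]
    rfl
  rw [mem_poleSpace, Finset.mul_sum]
  have := isIntegral_leading_segment b y he (by
    simp_rw [hb]; rw [← Finset.mul_sum, h, mul_zero]) hi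
  simp_rw [hb] at this
  exact this

variable {f : Polynomial k[X]} {y : L} {D : ℕ}

omit [Algebra (RatFunc k) L] [IsScalarTower k[X] (RatFunc k) L] [Algebra k L]
  [IsScalarTower k (RatFunc k) L] in
theorem sum_coeff_smul_eq_zero (hy : Polynomial.aeval y f = 0) :
    ∑ j ∈ Finset.range (f.natDegree + 1), f.coeff j • y ^ j = 0 := by
  rw [← hy, Polynomial.aeval_eq_sum_range]

theorem integralSpace_sup_poleSpace_eq_top_of_aeval_eq_zero (hy : Polynomial.aeval y f = 0)
    (he : 0 < f.natDegree) (hD : ∀ j, (f.coeff j).natDegree ≤ D)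
    (hspan : Submodule.span (RatFunc k) (Set.range fun i : Fin f.natDegree => y ^ (i : ℕ)) = ⊤) :
    integralSpace k L ⊔ poleSpace k L D = ⊤ := by
  have h0 := sum_coeff_smul_eq_zero hy
  let w : Fin f.natDegree → L := fun i =>
    ∑ j ∈ Finset.range (i + 1), f.coeff (f.natDegree - i + j) • y ^ j
  have hw : Submodule.span (RatFunc k) (Set.range w) = ⊤ := by
    rw [eq_top_iff, ← hspan, Submodule.span_le]
    rintro _ ⟨⟨i, hi⟩, rfl⟩
    simp only [SetLike.mem_coe]
    induction i using Nat.strong_induction_on with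
    | _ i ih =>
      have hlc : (algebraMap k[X] (RatFunc k)) f.leadingCoeff ≠ 0 := by
        rw [Ne, map_eq_zero_iff _ (IsFractionRing.injective _ _), Polynomial.leadingCoeff_eq_zero]
        rintro rfl
        simp at he
      have h1 : algebraMap k[X] (RatFunc k) f.leadingCoeff • y ^ i =
          w ⟨i, hi⟩ - ∑ j ∈ Finset.range i, algebraMap k[X] (RatFunc k) (f.coeff (f.natDegree - i + j)) • y ^ j := by
        simp only [w]
        rw [Finset.sum_range_succ, show f.natDegree - i + i = f.natDegree by omega]
        simp only [algebraMap_smul]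
        rw [add_sub_cancel_left]; rfl
      rw [← Submodule.smul_mem_iff _ hlc, h1]
      refine sub_mem (Submodule.subset_span ⟨_, rfl⟩) (sum_mem fun j hj => Submodule.smul_mem _ _ ?_)
      rw [Finset.mem_range] at hj
      exact ih j hj (by omega)
  have h2 := integralSpace_sup_poleSpace_eq_top (k := k) w (c := D) hw fun i =>
    ⟨isIntegral_leading_segment _ y he h0 i.2.le,
      leading_segment_mem_poleSpace _ hD y he h0 i.2.le⟩
  exact top_le_iff.1 (h2 ▸ sup_le_sup_left (poleSpace_mono (by omega)) _)

theorem leadingCoeff_mul_mem (hy : Polynomial.aeval y f = 0)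
    (he : 0 < f.natDegree) (hD : ∀ j, (f.coeff j).natDegree ≤ D) :
    IsIntegral k[X] (algebraMap k[X] L f.leadingCoeff * y) ∧
      algebraMap k[X] L f.leadingCoeff * y ∈ poleSpace k L D := by
  have h0 := sum_coeff_smul_eq_zero hy
  have h1 := isIntegral_leading_segment _ y he h0 (i := 1) he
  have h2 := leading_segment_mem_poleSpace _ hD y he h0 (i := 1) he
  have h3 : ∑ j ∈ Finset.range (1 + 1), f.coeff (f.natDegree - 1 + j) • y ^ j =
      algebraMap k[X] L (f.coeff (f.natDegree - 1)) + algebraMap k[X] L f.leadingCoeff * y := by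
    rw [Finset.sum_range_succ, Finset.sum_range_one, show f.natDegree - 1 + 1 = f.natDegree by omega,
      Algebra.smul_def, Algebra.smul_def, pow_zero, mul_one, pow_one]
    rfl
  rw [h3] at h1 h2
  refine ⟨?_, ?_⟩
  · have := h1.sub (isIntegral_algebraMap (R := k[X]) (x := f.coeff (f.natDegree - 1)))
    rwa [add_sub_cancel_left] at this
  · have := sub_mem h2 (algebraMap_polynomial_mem_poleSpace (L := L) (hD (f.natDegree - 1)))
    rwa [add_sub_cancel_left] at this

variable [FiniteDimensional (RatFunc k) L] [Algebra.IsSeparable (RatFunc k) L]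

theorem minpoly_eq_integralNormalization (hy : Polynomial.aeval y f = 0)
    (he : 0 < f.natDegree)
    (hspan : Submodule.span (RatFunc k) (Set.range fun i : Fin f.natDegree => y ^ (i : ℕ)) = ⊤)
    (hn : Module.finrank (RatFunc k) L = f.natDegree)
    (z : integralClosure k[X] L) (hz : (z : L) = algebraMap k[X] L f.leadingCoeff * y) :
    Algebra.adjoin (RatFunc k) {(z : L)} = ⊤ ∧ minpoly k[X] z = f.integralNormalization := by
  have hf : f ≠ 0 := by rintro rfl; simp at he
  have hinj : Function.Injective (algebraMap k[X] L) := FaithfulSMul.algebraMap_injective _ _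
  have hlc : (algebraMap k[X] (RatFunc k)) f.leadingCoeff ≠ 0 := by
    rw [Ne, map_eq_zero_iff _ (IsFractionRing.injective _ _), Polynomial.leadingCoeff_eq_zero]
    exact hf
  have htop : Algebra.adjoin (RatFunc k) {(z : L)} = ⊤ := by
    have h1 : y ∈ Algebra.adjoin (RatFunc k) {(z : L)} := by
      have h2 : y = (algebraMap k[X] (RatFunc k) f.leadingCoeff)⁻¹ • (z : L) := by
        rw [eq_inv_smul_iff₀ hlc, hz, algebraMap_smul, Algebra.smul_def]
      rw [h2]
      exact Subalgebra.smul_mem _ (Algebra.self_mem_adjoin_singleton _ _) _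
    rw [← Algebra.toSubmodule_eq_top, eq_top_iff, ← hspan, Submodule.span_le]
    rintro _ ⟨i, rfl⟩
    exact Subalgebra.pow_mem _ h1 _
  refine ⟨htop, ?_⟩
  have hint : IsIntegral k[X] z := Algebra.IsIntegral.isIntegral z
  have hintL : IsIntegral k[X] (z : L) := z.2
  have hg : Polynomial.aeval z f.integralNormalization = 0 := by
    apply Subtype.val_injective
    have := Polynomial.integralNormalization_aeval_eq_zero hy fun x hx => (map_eq_zero_iff _ hinj).1 hx
    rw [← hz] at this
    exact (Polynomial.aeval_algebraMap_apply L z _).symm.trans this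
  have hdeg : (minpoly k[X] z).natDegree = f.natDegree := by
    have h1 : minpoly k[X] z = minpoly k[X] (z : L) :=
      (minpoly.algebraMap_eq (B := integralClosure k[X] L) (B' := L) Subtype.val_injective z).symm
    have h2 := minpoly.isIntegrallyClosed_eq_field_fractions' (RatFunc k) hintL
    have h3 := congrArg Polynomial.natDegree h2
    rw [Polynomial.natDegree_map_eq_of_injective (IsFractionRing.injective _ _), ← h1] at h3
    rw [← h3, ← hn]
    have h4 : IsIntegral (RatFunc k) (z : L) := Algebra.IsIntegral.isIntegral _
    rw [(PowerBasis.ofAdjoinEqTop h4 htop).finrank, PowerBasis.ofAdjoinEqTop_dim]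
  refine Polynomial.eq_of_monic_of_dvd_of_natDegree_le (minpoly.monic hint)
    (Polynomial.monic_integralNormalization hf) (minpoly.isIntegrallyClosed_dvd hint hg) ?_ |>.symm
  rw [hdeg, Polynomial.natDegree_integralNormalization]

end PlaneModel

section PlanePoints

variable {k O Ω : Type*} [Field k] [CommRing O] [IsDomain O] [Algebra k O] [Algebra k[X] O]
  [IsScalarTower k k[X] O] [Module.IsTorsionFree k[X] O] [Field Ω] [Algebra k Ω]

omit [IsDomain O] [Module.IsTorsionFree k[X] O] in
theorem AlgHom.algebraMap_polynomial (h : O →ₐ[k] Ω) (B : k[X]) :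
    h (algebraMap k[X] O B) = Polynomial.aeval (h (algebraMap k[X] O Polynomial.X)) B := by
  have : h.comp (IsScalarTower.toAlgHom k k[X] O) =
      Polynomial.aeval (h (algebraMap k[X] O Polynomial.X)) := by
    ext; simp
  exact congrArg (fun φ => φ B) this

omit [IsDomain O] [Module.IsTorsionFree k[X] O] in
theorem AlgHom.aeval_polynomial (h : O →ₐ[k] Ω) (z : O) (g : Polynomial k[X]) :
    h (Polynomial.aeval z g) = Polynomial.eval₂ (Polynomial.eval₂RingHom (algebraMap k Ω)
      (h (algebraMap k[X] O Polynomial.X))) (h z) g := by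
  rw [Polynomial.aeval_def]
  refine (Polynomial.hom_eval₂ _ _ (h : O →+* Ω) _).trans ?_
  congr 1
  exact RingHom.ext fun B => h.algebraMap_polynomial B

theorem exists_algHom_of_eval_minpoly_eq_zero [IsAlgClosed Ω] [Algebra.IsIntegral k[X] O] (z : O)
    {x w : Ω} (hw : Polynomial.eval₂ (Polynomial.eval₂RingHom (algebraMap k Ω) x) w
      (minpoly k[X] z) = 0) :
    ∃ h : O →ₐ[k] Ω, h (algebraMap k[X] O Polynomial.X) = x ∧ h z = w := by
  have hz : IsIntegral k[X] z := Algebra.IsIntegral.isIntegral z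
  let u : Algebra.adjoin k[X] {z} →+* Ω := (AdjoinRoot.lift _ w hw).comp
    ((minpoly.equivAdjoin hz).symm : Algebra.adjoin k[X] {z} ≃+* AdjoinRoot (minpoly k[X] z)).toRingHom
  have hu1 : ∀ B, u (algebraMap k[X] _ B) = Polynomial.eval₂ (algebraMap k Ω) x B := by
    intro B
    have : (minpoly.equivAdjoin hz).symm (algebraMap k[X] _ B) = AdjoinRoot.of _ B :=
      (minpoly.equivAdjoin hz).symm.commutes B
    change AdjoinRoot.lift _ w hw ((minpoly.equivAdjoin hz).symm (algebraMap k[X] _ B)) = _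
    rw [this, AdjoinRoot.lift_of]
    rfl
  have hu2 : u ⟨z, Algebra.self_mem_adjoin_singleton _ _⟩ = w := by
    have h1 : minpoly.equivAdjoin hz (AdjoinRoot.root _) = ⟨z, Algebra.self_mem_adjoin_singleton _ _⟩ := by
      rw [minpoly.coe_equivAdjoin]
      exact Subtype.ext (by simp [AdjoinRoot.Minpoly.toAdjoin])
    change AdjoinRoot.lift _ w hw ((minpoly.equivAdjoin hz).symm _) = _
    rw [← h1, AlgEquiv.symm_apply_apply, AdjoinRoot.lift_root]
  let _ : Algebra (Algebra.adjoin k[X] {z}) Ω := u.toAlgebra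
  have _ : Algebra.IsIntegral (Algebra.adjoin k[X] {z}) O := Algebra.IsIntegral.tower_top (R := k[X])
  obtain ⟨h⟩ := nonempty_algHom_of_isIntegral (R := Algebra.adjoin k[X] {z}) (A := O) (Ω := Ω)
  have hR : ∀ B, h (algebraMap k[X] O B) = Polynomial.eval₂ (algebraMap k Ω) x B := fun B => by
    rw [← hu1]
    exact h.commutes (algebraMap k[X] _ B)
  refine ⟨{ h.toRingHom with commutes' := fun c => ?_ }, ?_, ?_⟩
  · have := hR (algebraMap k k[X] c)
    rw [← IsScalarTower.algebraMap_apply] at this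
    refine this.trans ?_
    simp
  · refine (hR _).trans ?_
    simp
  · exact (h.commutes (⟨z, Algebra.self_mem_adjoin_singleton _ _⟩ : Algebra.adjoin k[X] {z})).trans hu2

omit [IsDomain O] [Module.IsTorsionFree k[X] O] in
theorem AlgHom.eq_of_adjoin {z δ : O} (hδ : ∀ a, δ * a ∈ Algebra.adjoin k[X] {z}) {h h' : O →ₐ[k] Ω}
    (hx : h (algebraMap k[X] O Polynomial.X) = h' (algebraMap k[X] O Polynomial.X))
    (hz : h z = h' z) (h0 : h δ ≠ 0) : h = h' := by
  have key : ∀ a ∈ Algebra.adjoin k[X] {z}, h a = h' a := by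
    intro a ha
    induction ha using Algebra.adjoin_induction with
    | mem x hx' => rw [Set.mem_singleton_iff] at hx'; rw [hx', hz]
    | algebraMap r => rw [h.algebraMap_polynomial, h'.algebraMap_polynomial, hx]
    | add x y _ _ hx hy => rw [map_add, map_add, hx, hy]
    | mul x y _ _ hx hy => rw [map_mul, map_mul, hx, hy]
  ext a
  have h1 := key _ (hδ a)
  have h2 := key _ (hδ 1)
  rw [mul_one] at h2
  rw [map_mul, map_mul, ← h2] at h1
  exact mul_left_cancel₀ h0 h1

end PlanePoints

section Delta

variable {k L : Type*} [Field k] [Field L] [Algebra (RatFunc k) L] [Algebra k[X] L]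
  [IsScalarTower k[X] (RatFunc k) L] [FiniteDimensional (RatFunc k) L]
  [Algebra.IsSeparable (RatFunc k) L]

theorem aeval_derivative_mul_mem_adjoin (z : integralClosure k[X] L)
    (htop : Algebra.adjoin (RatFunc k) {(z : L)} = ⊤) (a : integralClosure k[X] L) :
    Polynomial.aeval z (Polynomial.derivative (minpoly k[X] z)) * a ∈ Algebra.adjoin k[X] {z} := by
  refine mem_conductor_iff.1 (?_ : _ ∈ conductor k[X] z) a
  have := conductor_mul_differentIdeal k[X] (RatFunc k) L z htop
  exact Ideal.mul_le_left (this ▸ Ideal.mem_span_singleton_self _)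

omit [FiniteDimensional (RatFunc k) L] in
theorem aeval_derivative_minpoly_ne_zero (z : integralClosure k[X] L) :
    Polynomial.aeval z (Polynomial.derivative (minpoly k[X] z)) ≠ 0 := by
  have h1 : minpoly k[X] z = minpoly k[X] (z : L) :=
    (minpoly.algebraMap_eq (B := integralClosure k[X] L) (B' := L) Subtype.val_injective z).symm
  have h2 := minpoly.isIntegrallyClosed_eq_field_fractions' (RatFunc k) z.2
  have h3 := (Algebra.IsSeparable.isSeparable (RatFunc k) (z : L)).aeval_derivative_ne_zero
    (minpoly.aeval (RatFunc k) (z : L))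
  intro h
  apply h3
  rw [h2, Polynomial.derivative_map, Polynomial.aeval_map_algebraMap, ← h1]
  rw [show (z : L) = algebraMap (integralClosure k[X] L) L z from rfl,
    Polynomial.aeval_algebraMap_apply, h, map_zero]

variable [Algebra k L] [IsScalarTower k (RatFunc k) L]

omit [FiniteDimensional (RatFunc k) L] [Algebra.IsSeparable (RatFunc k) L] in
theorem aeval_derivative_mem_poleSpace {f : Polynomial k[X]} {D : ℕ} (he : 0 < f.natDegree)
    (hD : ∀ j, (f.coeff j).natDegree ≤ D) {z : L} (hz : z ∈ poleSpace k L D) :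
    Polynomial.aeval z (Polynomial.derivative f.integralNormalization) ∈
      poleSpace k L (D * (f.natDegree - 1 : ℕ)) := by
  have hf : f ≠ 0 := by rintro rfl; simp at he
  rw [Polynomial.derivative_apply, Polynomial.sum_def, map_sum]
  refine sum_mem fun i hi => ?_
  have hie : i ≤ f.natDegree := by
    have := Polynomial.le_natDegree_of_mem_supp _ hi
    rwa [Polynomial.natDegree_integralNormalization] at this
  rcases Nat.eq_zero_or_pos i with rfl | hi0
  · simp
  have hc : (f.integralNormalization.coeff i * (i : k[X])).natDegree ≤ D * (f.natDegree - i) := by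
    refine (Polynomial.natDegree_mul_le).trans ?_
    rw [Polynomial.natDegree_natCast, add_zero]
    rcases hie.eq_or_lt with rfl | hlt
    · rw [Polynomial.integralNormalization_coeff_natDegree hf]; simp
    · rw [Polynomial.integralNormalization_coeff_ne_natDegree hlt.ne]
      refine (Polynomial.natDegree_mul_le).trans ?_
      have h1 := (Polynomial.natDegree_pow_le (p := f.leadingCoeff) (n := f.natDegree - 1 - i))
      have h2 := hD f.natDegree
      have h3 := hD i
      obtain ⟨r, hr⟩ : ∃ r, f.natDegree = i + 1 + r := ⟨f.natDegree - (i + 1), by omega⟩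
      rw [show f.natDegree - 1 - i = r by omega] at h1 ⊢
      rw [show f.natDegree - i = r + 1 by omega]
      have h4 : r * f.leadingCoeff.natDegree ≤ r * D := Nat.mul_le_mul_left _ h2
      nlinarith
  rw [Polynomial.aeval_mul, Polynomial.aeval_C, map_pow, Polynomial.aeval_X]
  have := mul_mem_poleSpace (algebraMap_polynomial_mem_poleSpace (L := L) hc)
    (pow_mem_poleSpace hz (i - 1))
  refine poleSpace_mono ?_ this
  norm_cast
  obtain ⟨r, hr⟩ : ∃ r, f.natDegree = i + r := ⟨f.natDegree - i, by omega⟩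
  obtain ⟨j, rfl⟩ : ∃ j, i = j + 1 := ⟨i - 1, by omega⟩
  rw [hr]
  simp only [Nat.add_sub_cancel, Nat.add_sub_cancel_left]
  rw [show j + 1 + r - 1 = j + r by omega]
  nlinarith

end Delta

theorem norm_sum_sub_sum_le {α β : Type*} (S : Finset α) (T : Finset β) (a : α → ℂ) (b : β → ℂ)
    (ha : ∀ s ∈ S, ‖a s‖ ≤ 1) (hb : ∀ t ∈ T, ‖b t‖ ≤ 1) (P : α → Prop) (Q : β → Prop)
    [DecidablePred P] [DecidablePred Q] (i : α → β) (hi : ∀ s ∈ S, P s → i s ∈ T ∧ Q (i s))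
    (hinj : ∀ s ∈ S, ∀ s' ∈ S, P s → P s' → i s = i s' → s = s')
    (hsurj : ∀ t ∈ T, Q t → ∃ s ∈ S, P s ∧ i s = t) (hab : ∀ s ∈ S, P s → a s = b (i s)) :
    ‖∑ s ∈ S, a s - ∑ t ∈ T, b t‖ ≤
      (S.filter fun s => ¬ P s).card + (T.filter fun t => ¬ Q t).card := by
  have h : ∑ s ∈ S.filter P, a s = ∑ t ∈ T.filter Q, b t := by
    refine Finset.sum_bij (fun s _ => i s) ?_ ?_ ?_ ?_
    · intro s hs
      rw [Finset.mem_filter] at hs ⊢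
      exact hi s hs.1 hs.2
    · intro s hs s' hs' h
      rw [Finset.mem_filter] at hs hs'
      exact hinj s hs.1 s' hs'.1 hs.2 hs'.2 h
    · intro t ht
      rw [Finset.mem_filter] at ht
      obtain ⟨s, hs, hP, rfl⟩ := hsurj t ht.1 ht.2
      exact ⟨s, Finset.mem_filter.2 ⟨hs, hP⟩, rfl⟩
    · intro s hs
      rw [Finset.mem_filter] at hs
      exact hab s hs.1 hs.2
  rw [← Finset.sum_filter_add_sum_filter_not S P, ← Finset.sum_filter_add_sum_filter_not T Q, h,
    add_sub_add_left_eq_sub]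
  refine (norm_sub_le _ _).trans (add_le_add ?_ ?_)
  · refine (norm_sum_le_of_le _ (f := a) fun s hs => ha s (Finset.mem_filter.1 hs).1).trans ?_
    simp
  · refine (norm_sum_le_of_le _ (f := b) fun s hs => hb s (Finset.mem_filter.1 hs).1).trans ?_
    simp

section Compare

variable {p : ℕ} [Fact p.Prime] {L : Type*} [Field L] [Algebra (RatFunc (ZMod p)) L]
  [Algebra (ZMod p)[X] L] [IsScalarTower (ZMod p)[X] (RatFunc (ZMod p)) L]
  [FiniteDimensional (RatFunc (ZMod p)) L] [Algebra.IsSeparable (RatFunc (ZMod p)) L]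
  [Algebra (ZMod p) L] [IsScalarTower (ZMod p) (RatFunc (ZMod p)) L]
  {Ω : Type*} [Field Ω] [CharP Ω p] [Algebra (ZMod p) Ω] [IsAlgClosed Ω]

omit [CharP Ω p] [IsAlgClosed Ω] in
theorem card_algHom_apply_eq_zero_le {D : ℕ} (δ : integralClosure (ZMod p)[X] L) (h0 : δ ≠ 0)
    (hδ : (δ : L) ∈ poleSpace (ZMod p) L D)
    (s : Finset (integralClosure (ZMod p)[X] L →ₐ[ZMod p] Ω)) (hs : ∀ h ∈ s, h δ = 0) :
    s.card ≤ Module.finrank (RatFunc (ZMod p)) L * D := by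
  have hI : Ideal.span {δ} ≠ ⊥ := by rwa [Ne, Ideal.span_singleton_eq_bot]
  have _ := finite_quotient_integralClosure (k := ZMod p) (Ideal.span {δ}) hI
  refine (Finset.card_algHom_le_finrank_quotient (Ideal.span {δ}) s ?_).trans
    (finrank_quotient_span_le δ h0 hδ)
  intro h hh a ha
  obtain ⟨b, rfl⟩ := Ideal.mem_span_singleton.1 ha
  rw [map_mul, hs h hh, zero_mul]

theorem norm_sum_psiTr_sub_pointSum_le {f : Polynomial (ZMod p)[X]} {y : L} {D : ℕ}
    (hy : Polynomial.aeval y f = 0) (he : 0 < f.natDegree) (hD : ∀ j, (f.coeff j).natDegree ≤ D)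
    (hspan : Submodule.span (RatFunc (ZMod p)) (Set.range fun i : Fin f.natDegree => y ^ (i : ℕ)) = ⊤)
    (hn : Module.finrank (RatFunc (ZMod p)) L = f.natDegree) (ψ : AddChar (ZMod p) ℂ) {m : ℕ}
    (hm : 0 < m) (H : Finset (integralClosure (ZMod p)[X] L →ₐ[ZMod p] Ω))
    (hH : ∀ h, h ∈ H ↔ ∀ a, h a ^ p ^ m = h a) :
    ‖∑ h ∈ H, psiTr ψ m (h (algebraMap (ZMod p)[X] _ Polynomial.X)) - pointSum Ω ψ f m‖ ≤
      (2 * f.natDegree ^ 2 * D + f.natDegree * D : ℕ) := by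
  classical
  have hf : f ≠ 0 := by rintro rfl; simp at he
  obtain ⟨hint, hpole⟩ := leadingCoeff_mul_mem hy he hD
  obtain ⟨z, hz⟩ : ∃ z : integralClosure (ZMod p)[X] L, (z : L) = algebraMap _ L f.leadingCoeff * y :=
    ⟨⟨_, hint⟩, rfl⟩
  obtain ⟨htop, hmin⟩ := minpoly_eq_integralNormalization hy he hspan hn z hz
  let ε : Ω → (ZMod p)[X] →+* Ω := fun x => Polynomial.eval₂RingHom (algebraMap (ZMod p) Ω) x
  let δ : integralClosure (ZMod p)[X] L := algebraMap _ _ f.leadingCoeff *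
    Polynomial.aeval z (Polynomial.derivative (minpoly (ZMod p)[X] z))
  have hlc : f.leadingCoeff ≠ 0 := Polynomial.leadingCoeff_ne_zero.2 hf
  have hδ0 : δ ≠ 0 := mul_ne_zero
    ((map_ne_zero_iff _ (FaithfulSMul.algebraMap_injective _ _)).2 hlc)
    (aeval_derivative_minpoly_ne_zero z)
  have hδa : ∀ a, δ * a ∈ Algebra.adjoin (ZMod p)[X] {z} := fun a => by
    rw [mul_assoc, ← Algebra.smul_def]
    exact Subalgebra.smul_mem _ (aeval_derivative_mul_mem_adjoin z htop a) _
  have hδp : (δ : L) ∈ poleSpace (ZMod p) L (D * f.natDegree : ℕ) := by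
    have h1 := aeval_derivative_mem_poleSpace he hD (hz ▸ hpole)
    have h2 := mul_mem_poleSpace
      (algebraMap_polynomial_mem_poleSpace (k := ZMod p) (L := L) (hD f.natDegree)) h1
    have h3 : (δ : L) = algebraMap _ L f.leadingCoeff *
        Polynomial.aeval (z : L) (Polynomial.derivative f.integralNormalization) := by
      rw [← hmin]
      exact congrArg (algebraMap _ L f.leadingCoeff * ·) (Polynomial.aeval_algebraMap_apply L z _).symm
    rw [h3]
    refine poleSpace_mono ?_ h2
    norm_cast
    obtain ⟨r, hr⟩ : ∃ r, f.natDegree = r + 1 := ⟨f.natDegree - 1, by omega⟩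
    rw [hr, Nat.add_sub_cancel]
    exact le_of_eq (by ring)
  have hcard := card_algHom_apply_eq_zero_le (Ω := Ω) δ hδ0 hδp
  have hhδ : ∀ h : integralClosure (ZMod p)[X] L →ₐ[ZMod p] Ω,
      h δ = ε (h (algebraMap (ZMod p)[X] _ Polynomial.X)) f.leadingCoeff *
        Polynomial.eval₂ (ε (h (algebraMap (ZMod p)[X] _ Polynomial.X))) (h z)
          (Polynomial.derivative (minpoly (ZMod p)[X] z)) := fun h => by
    rw [map_mul, h.aeval_polynomial, h.algebraMap_polynomial]
    rfl
  have hg : ∀ x w, Polynomial.eval₂ (ε x) (ε x f.leadingCoeff * w) (minpoly (ZMod p)[X] z) =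
      ε x f.leadingCoeff ^ (f.natDegree - 1) * Polynomial.eval₂ (ε x) w f := fun x w => by
    rw [hmin]
    exact Polynomial.integralNormalization_eval₂_leadingCoeff_mul he _ _
  let t : Ω → Finset Ω := fun x => (f.map (ε x)).roots.toFinset.filter fun y => y ^ p ^ m = y
  have hroot : ∀ x w, ε x f.leadingCoeff ≠ 0 →
      (w ∈ t x ↔ Polynomial.eval₂ (ε x) w f = 0 ∧ w ^ p ^ m = w) := fun x w hc => by
    have : f.map (ε x) ≠ 0 := fun h0 => hc (by
      have := congrArg (fun g => g.coeff f.natDegree) h0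
      simpa using this)
    simp only [t]
    rw [Finset.mem_filter, Multiset.mem_toFinset, Polynomial.mem_roots this, Polynomial.IsRoot.def,
      Polynomial.eval_map]
  have hp1 : 1 < p ^ m := Nat.one_lt_pow hm.ne' (Fact.out : p.Prime).one_lt
  have hsum : pointSum Ω ψ f m =
      ∑ v ∈ (powFixed Ω (p ^ m)).sigma t, psiTr ψ m v.1 := by
    rw [Finset.sum_sigma, pointSum]
    refine Finset.sum_congr rfl fun x _ => ?_
    dsimp only
    rw [Finset.sum_const, nsmul_eq_mul, mul_comm]
  let Q : (Σ _ : Ω, Ω) → Prop := fun v => ε v.1 f.leadingCoeff ≠ 0 ∧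
    Polynomial.eval₂ (ε v.1) (ε v.1 f.leadingCoeff * v.2)
      (Polynomial.derivative (minpoly (ZMod p)[X] z)) ≠ 0
  have hex : ∀ v ∈ (powFixed Ω (p ^ m)).sigma t, ε v.1 f.leadingCoeff ≠ 0 →
      ∃ h : integralClosure (ZMod p)[X] L →ₐ[ZMod p] Ω, h (algebraMap (ZMod p)[X] _ Polynomial.X) = v.1 ∧
        h z = ε v.1 f.leadingCoeff * v.2 := fun v hv hc => by
    refine exists_algHom_of_eval_minpoly_eq_zero z ?_
    rw [hg, ((hroot _ _ hc).1 (Finset.mem_sigma.1 hv).2).1, mul_zero]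
  have hεpow : ∀ x B, x ^ p ^ m = x → ε x B ^ p ^ m = ε x B := fun x B hx => by
    have h1 : ((iterateFrobenius Ω p m).comp (ε x)) = ε x := by
      refine Polynomial.ringHom_ext (fun c => ?_) ?_
      · simp only [ε, RingHom.comp_apply, Polynomial.coe_eval₂RingHom, Polynomial.eval₂_C]
        exact congrFun (congrArg DFunLike.coe (Subsingleton.elim
          ((iterateFrobenius Ω p m).comp (algebraMap (ZMod p) Ω)) (algebraMap (ZMod p) Ω))) c
      · simp [ε, iterateFrobenius_def, hx]
    exact congrArg (fun φ => φ B) h1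
  rw [hsum]
  let i : (integralClosure (ZMod p)[X] L →ₐ[ZMod p] Ω) → Σ _ : Ω, Ω := fun h =>
    ⟨h (algebraMap (ZMod p)[X] _ Polynomial.X),
      (ε (h (algebraMap (ZMod p)[X] _ Polynomial.X)) f.leadingCoeff)⁻¹ * h z⟩
  refine (norm_sum_sub_sum_le H _ _ _ (fun h _ => norm_psiTr_le _ _ _) (fun v _ => norm_psiTr_le _ _ _)
    (fun h => h δ ≠ 0) Q i ?_ ?_ ?_ ?_).trans ?_
  · intro h hh hδ
    rw [hhδ] at hδ
    have hc := left_ne_zero_of_mul hδ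
    have hX := (hH h).1 hh (algebraMap (ZMod p)[X] _ Polynomial.X)
    refine ⟨Finset.mem_sigma.2 ⟨(mem_powFixed hp1).2 hX, (hroot _ _ hc).2 ⟨?_, ?_⟩⟩, hc, ?_⟩
    · have h1 := hg (h (algebraMap (ZMod p)[X] _ Polynomial.X))
        ((ε (h (algebraMap (ZMod p)[X] _ Polynomial.X)) f.leadingCoeff)⁻¹ * h z)
      rw [mul_inv_cancel_left₀ hc] at h1
      have h2 := h.aeval_polynomial z (minpoly _ z)
      rw [minpoly.aeval, map_zero] at h2
      rw [← h2, eq_comm, mul_eq_zero] at h1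
      exact h1.resolve_left (pow_ne_zero _ hc)
    · rw [mul_pow, inv_pow, hεpow _ _ hX, (hH h).1 hh z]
    · simp only [i]
      rw [mul_inv_cancel_left₀ hc]
      exact right_ne_zero_of_mul hδ
  · intro h hh h' hh' hδ _ heq
    have h1 : h (algebraMap (ZMod p)[X] _ Polynomial.X) = h' (algebraMap (ZMod p)[X] _ Polynomial.X) :=
      congrArg Sigma.fst heq
    have h2 := congrArg (fun v : Σ _ : Ω, Ω => v.2) heq
    simp only [i, ← h1] at h2
    have hc := left_ne_zero_of_mul ((hhδ h) ▸ hδ)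
    exact AlgHom.eq_of_adjoin hδa h1 (mul_left_cancel₀ (inv_ne_zero hc) h2) hδ
  · intro v hv hQ
    obtain ⟨h, h1, h2⟩ := hex v hv hQ.1
    have hδ : h δ ≠ 0 := by
      rw [hhδ, h1, h2]
      exact mul_ne_zero hQ.1 hQ.2
    obtain ⟨hv1, hv2⟩ := Finset.mem_sigma.1 hv
    rw [mem_powFixed hp1] at hv1
    have hv3 := ((hroot _ _ hQ.1).1 hv2).2
    refine ⟨h, (hH h).2 fun a => ?_, hδ, ?_⟩
    · let F : integralClosure (ZMod p)[X] L →ₐ[ZMod p] Ω :=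
        { (iterateFrobenius Ω p m).comp (h : integralClosure (ZMod p)[X] L →+* Ω) with
          commutes' := fun c => congrFun (congrArg DFunLike.coe (Subsingleton.elim
            (((iterateFrobenius Ω p m).comp (h : integralClosure (ZMod p)[X] L →+* Ω)).comp
              (algebraMap (ZMod p) (integralClosure (ZMod p)[X] L)))
              (algebraMap (ZMod p) Ω))) c }
      have hF : ∀ a, F a = h a ^ p ^ m := fun a => rfl
      have : h = F := AlgHom.eq_of_adjoin hδa (by rw [hF, h1, hv1])
        (by rw [hF, h2, mul_pow, hεpow _ _ hv1, hv3]) hδ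
      rw [← hF, ← this]
    · simp only [i]
      rw [h1, h2, inv_mul_cancel_left₀ hQ.1]
  · intro h _ _
    rfl
  · norm_cast
    have hb1 := hcard (H.filter fun h => ¬ h δ ≠ 0) fun h hh => by
      simpa using (Finset.mem_filter.1 hh).2
    have hb2 : (((powFixed Ω (p ^ m)).sigma t).filter fun v => ¬ Q v).card ≤
        f.natDegree * D + f.natDegree * (D * f.natDegree) := by
      rw [← Finset.card_filter_add_card_filter_not (p := fun v : Σ _ : Ω, Ω => ε v.1 f.leadingCoeff = 0)]
      refine add_le_add ?_ ?_
      · have hsub : ((((powFixed Ω (p ^ m)).sigma t).filter fun v => ¬ Q v).filter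
            fun v => ε v.1 f.leadingCoeff = 0) ⊆
            ((f.leadingCoeff.map (algebraMap (ZMod p) Ω)).roots.toFinset).sigma t := by
          intro v hv
          simp only [Finset.mem_filter, Finset.mem_sigma] at hv
          refine Finset.mem_sigma.2 ⟨?_, hv.1.1.2⟩
          rw [Multiset.mem_toFinset, Polynomial.mem_roots (Polynomial.map_ne_zero hlc),
            Polynomial.IsRoot.def, Polynomial.eval_map]
          exact hv.2
        refine (Finset.card_le_card hsub).trans ?_
        rw [Finset.card_sigma]
        refine (Finset.sum_le_card_nsmul _ _ f.natDegree fun x _ => ?_).trans ?_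
        · refine (Finset.card_filter_le _ _).trans ((Multiset.toFinset_card_le _).trans
            ((Polynomial.card_roots' _).trans Polynomial.natDegree_map_le))
        · rw [smul_eq_mul, mul_comm]
          refine Nat.mul_le_mul_left _ ((Multiset.toFinset_card_le _).trans
            ((Polynomial.card_roots' _).trans (Polynomial.natDegree_map_le.trans (hD _))))
      · let B := ((((powFixed Ω (p ^ m)).sigma t).filter fun v => ¬ Q v).filter
            fun v => ¬ ε v.1 f.leadingCoeff = 0)
        have hB : ∀ v : B, v.1 ∈ (powFixed Ω (p ^ m)).sigma t ∧ ¬ Q v.1 ∧ ε v.1.1 f.leadingCoeff ≠ 0 :=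
          fun v => by
            have h1 := Finset.mem_filter.1 v.2
            have h2 := Finset.mem_filter.1 h1.1
            exact ⟨h2.1, h2.2, h1.2⟩
        choose u hu1 hu2 using fun v : B => hex v.1 (hB v).1 (hB v).2.2
        have huinj : Function.Injective u := by
          intro v v' hvv
          have h1 : v.1.1 = v'.1.1 := by rw [← hu1, ← hu1, hvv]
          have h2 : ε v.1.1 f.leadingCoeff * v.1.2 = ε v.1.1 f.leadingCoeff * v'.1.2 := by
            rw [← hu2, hvv, hu2, h1]
          have h3 := mul_left_cancel₀ (hB v).2.2 h2
          exact Subtype.ext (Sigma.ext h1 (heq_of_eq h3))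
        have := hcard (Finset.univ.map ⟨u, huinj⟩) fun h hh => by
          obtain ⟨v, -, rfl⟩ := Finset.mem_map.1 hh
          change u v δ = 0
          rw [hhδ, hu1, hu2]
          by_contra h0
          exact (hB v).2.1 ⟨left_ne_zero_of_mul h0, right_ne_zero_of_mul h0⟩
        rw [Finset.card_map, Finset.card_univ, Fintype.card_coe, hn] at this
        exact this
    rw [hn] at hb1
    refine (add_le_add hb1 hb2).trans (le_of_eq ?_)
    ring

end Compare

section WeilBound

variable {p : ℕ} [Fact p.Prime] {L : Type*} [Field L] [Algebra (RatFunc (ZMod p)) L]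
  [Algebra (ZMod p)[X] L] [IsScalarTower (ZMod p)[X] (RatFunc (ZMod p)) L]
  [FiniteDimensional (RatFunc (ZMod p)) L] [Algebra.IsSeparable (RatFunc (ZMod p)) L]
  [Algebra (ZMod p) L] [IsScalarTower (ZMod p) (RatFunc (ZMod p)) L]

set_option maxHeartbeats 1000000 in
set_option synthInstance.maxHeartbeats 100000 in
theorem natDegree_normPoly_pos {P : Ideal (integralClosure (ZMod p)[X] L)} (hP : Prime P) :
    0 < (normPoly P).natDegree := by
  have hP0 : P ≠ ⊥ := hP.ne_zero
  have _ : P.IsPrime := (Ideal.prime_iff_isPrime hP0).1 hP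
  have _ : NeZero P := ⟨hP0⟩
  have _ : Nontrivial (integralClosure (ZMod p)[X] L ⧸ P) := Ideal.Quotient.nontrivial_iff.2
    (Ideal.IsPrime.ne_top inferInstance)
  rw [(normPoly_prime P hP0).1]
  exact Module.finrank_pos

theorem eq_top_of_natDegree_normPoly_eq_zero {I : Ideal (integralClosure (ZMod p)[X] L)}
    (hI : I ≠ ⊥) (h : (normPoly I).natDegree = 0) : I = ⊤ := by
  by_contra hne
  obtain ⟨M, hM, hle⟩ := Ideal.exists_le_maximal I hne
  obtain ⟨J, rfl⟩ := Ideal.dvd_iff_le.2 hle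
  have hM0 : M ≠ ⊥ := left_ne_zero_of_mul hI
  have hJ0 : J ≠ ⊥ := right_ne_zero_of_mul hI
  have := natDegree_normPoly_pos ((Ideal.prime_iff_isPrime hM0).2 hM.isPrime)
  rw [normPoly_mul hM0 hJ0, (monic_normPoly hM0).natDegree_mul (monic_normPoly hJ0)] at h
  omega

theorem charSum_zero (ψ : AddChar (ZMod p) ℂ) : charSum L ψ 0 = 1 := by
  have : idealsOfDegree (ZMod p) L 0 = {1} := by
    ext I
    rw [mem_idealsOfDegree, Finset.mem_singleton]
    constructor
    · rintro ⟨h0, h⟩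
      exact (eq_top_of_natDegree_normPoly_eq_zero h0 h).trans Ideal.one_eq_top.symm
    · rintro rfl
      refine ⟨one_ne_zero, ?_⟩
      rw [normPoly_one, Polynomial.natDegree_one]
  rw [charSum, this, Finset.sum_singleton, idealChar_one]

theorem mul_charSum_eq (ψ : AddChar (ZMod p) ℂ) (N : ℕ) :
    (N : ℂ) * charSum L ψ N = ∑ m ∈ Finset.Icc 1 N,
      primePowerSum (idealsOfDegree (ZMod p) L) (idealChar ψ) m * charSum L ψ (N - m) := by
  classical
  let _ : StrongNormalizationMonoid (Ideal (integralClosure (ZMod p)[X] L)) :=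
    UniqueFactorizationMonoid.strongNormalizationMonoid
  refine mul_sum_eq_sum_primePowerSum_mul (fun I => (normPoly I).natDegree) ?_ ?_
    (fun P hP => natDegree_normPoly_pos hP) (idealsOfDegree (ZMod p) L)
    (fun N a => mem_idealsOfDegree) (idealChar ψ) (idealChar_one ψ)
    (fun a b ha hb => idealChar_mul ψ ha hb) N
  · rw [normPoly_one, Polynomial.natDegree_one]
  · intro a b ha hb
    rw [normPoly_mul ha hb, (monic_normPoly ha).natDegree_mul (monic_normPoly hb)]

variable {Ω : Type*} [Field Ω] [CharP Ω p] [Algebra (ZMod p) Ω] [IsAlgClosed Ω]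

set_option maxHeartbeats 1000000 in
set_option synthInstance.maxHeartbeats 100000 in
theorem natDegree_normPoly_ker_eq_one (ψ : AddChar (ZMod p) ℂ)
    (h : integralClosure (ZMod p)[X] L →ₐ[ZMod p] Ω) (hh : ∀ a, h a ^ p = h a) :
    RingHom.ker h ≠ ⊥ ∧ (normPoly (RingHom.ker h)).natDegree = 1 ∧
      psiTr ψ 1 (h (algebraMap (ZMod p)[X] _ Polynomial.X)) = idealChar ψ (RingHom.ker h) := by
  have hP0 := ker_ne_bot_of_pow_eq one_pos h (by simpa using hh)
  have _ : (RingHom.ker h).IsPrime := RingHom.ker_isPrime _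
  have _ : (RingHom.ker h).IsMaximal := Ring.DimensionLEOne.maximalOfPrime hP0 inferInstance
  have _ : NeZero (RingHom.ker h) := ⟨hP0⟩
  obtain ⟨h1, h2⟩ := normPoly_prime (RingHom.ker h) hP0
  obtain ⟨K, hK1, hK2, hK3⟩ := exists_finset_ker_eq (Ω := Ω) (RingHom.ker h)
  obtain ⟨h3, h4⟩ := hK3 h ((hK1 h).2 rfl)
  have h5 := (h3 1).1 (by simpa using hh)
  rw [Nat.dvd_one] at h5
  refine ⟨hP0, h1.trans h5, ?_⟩
  have h6 := h4 ψ 1 (algebraMap (ZMod p)[X] _ Polynomial.X)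
  rw [h5, mul_one, pow_one] at h6
  rw [h6, idealChar, h2, neg_neg]
  rfl

theorem norm_primePowerSum_one_le {D : ℕ} (hD : integralSpace (ZMod p) L ⊔ poleSpace (ZMod p) L D = ⊤)
    (Ω : Type*) [Field Ω] [CharP Ω p] [Algebra (ZMod p) Ω] [IsAlgClosed Ω]
    {ψ : AddChar (ZMod p) ℂ} (hψ : ψ ≠ 1) {C : ℝ} {Q t : ℕ} (ht : 0 < t)
    (hS : ∀ j, 0 < j → t ∣ j → Q ≤ p ^ j →
      ‖primePowerSum (idealsOfDegree (ZMod p) L) (idealChar ψ) (2 * j)‖ ≤ C * p ^ j) :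
    ‖primePowerSum (idealsOfDegree (ZMod p) L) (idealChar ψ) 1‖ ≤
      (Module.finrank (RatFunc (ZMod p)) L * (2 * D + 2) : ℕ) * √p := by
  have hp1 : 1 < p := (Fact.out : p.Prime).one_lt
  by_cases hex : ∃ P₁ P₂ : Ideal (integralClosure (ZMod p)[X] L), P₁ ≠ ⊥ ∧ P₂ ≠ ⊥ ∧
      (normPoly P₁).natDegree = 1 ∧ (normPoly P₂).natDegree = 1 ∧ idealChar ψ P₁ ≠ idealChar ψ P₂
  · obtain ⟨P₁, P₂, h1, h2, hd1, hd2, hne⟩ := hex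
    refine norm_le_mul_sqrt_of_recurrence (charSum L ψ) _ hp1 (charSum_zero ψ) (fun N hN => ?_)
      (mul_charSum_eq ψ) ht hS
    by_contra h0
    exact hne (mul_right_cancel₀ h0 (idealChar_mul_charSum hD h1 h2 hd1 hd2 hN ψ))
  · push Not at hex
    obtain ⟨H, hH, hsum⟩ := exists_finset_primePowerSum_eq (L := L) (Ω := Ω) ψ one_pos
    simp only [pow_one] at hH
    have hcard : H.card ≤ Module.finrank (RatFunc (ZMod p)) L := by
      rcases H.eq_empty_or_nonempty with rfl | ⟨h0, hh0⟩
      · simp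
      have hc : ∀ h ∈ H, ∃ c : ZMod p, ZMod.castHom (dvd_refl p) Ω c =
          h (algebraMap (ZMod p)[X] _ Polynomial.X) ∧
          psiTr ψ 1 (h (algebraMap (ZMod p)[X] _ Polynomial.X)) = ψ c := fun h hh => by
        obtain ⟨c, hc⟩ := exists_cast_eq_of_pow_eq ((hH h).1 hh (algebraMap (ZMod p)[X] _ Polynomial.X))
        exact ⟨c, hc, psiTr_eq ψ (by simpa using hc)⟩
      obtain ⟨c0, hc0, hc0'⟩ := hc h0 hh0
      have hall : ∀ h ∈ H, h (algebraMap (ZMod p)[X] _ Polynomial.X) = algebraMap (ZMod p) Ω c0 := by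
        intro h hh
        obtain ⟨c, hc, hc'⟩ := hc h hh
        obtain ⟨k1, k2, k3⟩ := natDegree_normPoly_ker_eq_one ψ h ((hH h).1 hh)
        obtain ⟨l1, l2, l3⟩ := natDegree_normPoly_ker_eq_one ψ h0 ((hH h0).1 hh0)
        have e : ψ c = ψ c0 := by
          rw [← hc', ← hc0', k3, l3]
          exact hex _ _ k1 l1 k2 l2
        have e2 : c - c0 = 0 := AddChar.eq_zero_of_eq_one hψ (by
          rw [sub_eq_add_neg, AddChar.map_add_eq_mul, e, ← AddChar.map_add_eq_mul, add_neg_cancel,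
            AddChar.map_zero_eq_one])
        rw [← hc, sub_eq_zero.1 e2]
        exact congrFun (congrArg DFunLike.coe (Subsingleton.elim _ (algebraMap (ZMod p) Ω))) c0
      have := card_algHom_apply_eq_zero_le (L := L) (D := 1) (algebraMap (ZMod p)[X] _
        (Polynomial.X - Polynomial.C c0)) ?_ ?_ H ?_
      · rwa [mul_one] at this
      · exact (map_ne_zero_iff _ (FaithfulSMul.algebraMap_injective _ _)).2 (Polynomial.X_sub_C_ne_zero c0)
      · exact algebraMap_polynomial_mem_poleSpace (by simp)
      · intro h hh
        rw [h.algebraMap_polynomial, hall h hh]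
        simp
    rw [hsum]
    refine (norm_sum_le_of_le _ fun h _ => norm_psiTr_le ψ 1 _).trans ?_
    rw [Finset.sum_const, nsmul_eq_mul, mul_one]
    have h1 : (1 : ℝ) ≤ √p := by
      rw [Real.one_le_sqrt]; exact_mod_cast hp1.le
    have h2 : H.card ≤ Module.finrank (RatFunc (ZMod p)) L * (2 * D + 2) := by nlinarith
    have h3 : (H.card : ℝ) ≤ (Module.finrank (RatFunc (ZMod p)) L * (2 * D + 2) : ℕ) := by
      exact_mod_cast h2
    nlinarith [Nat.cast_nonneg (α := ℝ) (Module.finrank (RatFunc (ZMod p)) L * (2 * D + 2))]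

theorem norm_pointSum_one_le_of_aeval_eq_zero [Algebra.IsAlgebraic (ZMod p) Ω]
    {f : Polynomial (ZMod p)[X]} (hirr : Irreducible f) (hp : f.natDegree < p) {y : L} {D : ℕ}
    (hy : Polynomial.aeval y f = 0) (he : 0 < f.natDegree) (hD : ∀ j, (f.coeff j).natDegree ≤ D)
    (hspan : Submodule.span (RatFunc (ZMod p)) (Set.range fun i : Fin f.natDegree => y ^ (i : ℕ)) = ⊤)
    (hn : Module.finrank (RatFunc (ZMod p)) L = f.natDegree) {ψ : AddChar (ZMod p) ℂ}
    (hψ : ψ ≠ 1) :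
    ‖pointSum Ω ψ f 1‖ ≤ (f.natDegree * (2 * D + 2) : ℕ) * √p +
      (2 * f.natDegree ^ 2 * D + f.natDegree * D : ℕ) := by
  set E := 2 * f.natDegree ^ 2 * D + f.natDegree * D
  have hcmp : ∀ m, 0 < m → ‖primePowerSum (idealsOfDegree (ZMod p) L) (idealChar ψ) m -
      pointSum Ω ψ f m‖ ≤ E := fun m hm => by
    obtain ⟨H, hH, hsum⟩ := exists_finset_primePowerSum_eq (L := L) (Ω := Ω) ψ hm
    rw [hsum]
    exact norm_sum_psiTr_sub_pointSum_le hy he hD hspan hn ψ hm H hH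
  obtain ⟨C, Q, t, ht, hC⟩ := exists_norm_pointSum_le (Ω := Ω) hirr he hp ψ hψ
  have h1 := norm_primePowerSum_one_le (integralSpace_sup_poleSpace_eq_top_of_aeval_eq_zero hy he hD hspan)
    Ω hψ (C := C + E) (Q := Q) ht fun j hj htj hQ => by
      have h1 := hcmp (2 * j) (by omega)
      have h2 := hC j hj htj hQ
      have h3 := norm_add_le (primePowerSum (idealsOfDegree (ZMod p) L) (idealChar ψ) (2 * j) -
        pointSum Ω ψ f (2 * j)) (pointSum Ω ψ f (2 * j))
      rw [sub_add_cancel] at h3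
      have h4 : (1 : ℝ) ≤ (p : ℝ) ^ j := one_le_pow₀ (by exact_mod_cast (Fact.out : p.Prime).one_lt.le)
      nlinarith [Nat.cast_nonneg (α := ℝ) E]
  rw [hn] at h1
  have h2 := hcmp 1 one_pos
  have h3 := norm_sub_le (primePowerSum (idealsOfDegree (ZMod p) L) (idealChar ψ) 1)
    (primePowerSum (idealsOfDegree (ZMod p) L) (idealChar ψ) 1 - pointSum Ω ψ f 1)
  rw [sub_sub_cancel] at h3
  linarith

end WeilBound

/-- A Weil-type bound for additive character sums over the points of an irreducible plane curve. -/
theorem norm_pointSum_one_le {p : ℕ} [Fact p.Prime] {Ω : Type*} [Field Ω] [CharP Ω p]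
    [Algebra (ZMod p) Ω] [IsAlgClosed Ω] [Algebra.IsAlgebraic (ZMod p) Ω]
    {f : Polynomial (ZMod p)[X]} (hirr : Irreducible f) (he : 0 < f.natDegree) (hp : f.natDegree < p)
    {D : ℕ} (hD : ∀ j, (f.coeff j).natDegree ≤ D) {ψ : AddChar (ZMod p) ℂ} (hψ : ψ ≠ 1) :
    ‖pointSum Ω ψ f 1‖ ≤ (f.natDegree * (2 * D + 2) : ℕ) * √p +
      (2 * f.natDegree ^ 2 * D + f.natDegree * D : ℕ) := by
  have hprim : f.IsPrimitive := hirr.isPrimitive he.ne'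
  let F : Polynomial (RatFunc (ZMod p)) := f.map (algebraMap (ZMod p)[X] (RatFunc (ZMod p)))
  have hFirr : Irreducible F := (hprim.irreducible_iff_irreducible_map_fraction_map).1 hirr
  have hFdeg : F.natDegree = f.natDegree :=
    Polynomial.natDegree_map_eq_of_injective (IsFractionRing.injective _ _) _
  have _ : Fact (Irreducible F) := ⟨hFirr⟩
  let pb := AdjoinRoot.powerBasis hFirr.ne_zero
  have hdim : pb.dim = f.natDegree := hFdeg
  have _ : FiniteDimensional (RatFunc (ZMod p)) (AdjoinRoot F) := pb.finite
  have _ : Algebra.IsSeparable (RatFunc (ZMod p)) (AdjoinRoot F) := by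
    have hroot : IsSeparable (RatFunc (ZMod p)) (AdjoinRoot.root F) := by
      refine (separable_map_ratFunc_of_irreducible hirr he hp).of_dvd (minpoly.dvd _ _ ?_)
      rw [Polynomial.aeval_def, AdjoinRoot.algebraMap_eq, AdjoinRoot.eval₂_root]
    have h1 := (IntermediateField.isSeparable_adjoin_simple_iff_isSeparable _ _).2 hroot
    have h2 : IntermediateField.adjoin (RatFunc (ZMod p)) {AdjoinRoot.root F} = ⊤ := by
      rw [← IntermediateField.toSubalgebra_inj, IntermediateField.top_toSubalgebra, eq_top_iff,
        ← AdjoinRoot.adjoinRoot_eq_top]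
      exact IntermediateField.algebra_adjoin_le_adjoin _ _
    rw [h2] at h1
    exact AlgEquiv.Algebra.isSeparable IntermediateField.topEquiv
  have _ : IsScalarTower (ZMod p) (RatFunc (ZMod p)) (AdjoinRoot F) := inferInstance
  have _ : IsScalarTower (ZMod p)[X] (RatFunc (ZMod p)) (AdjoinRoot F) := inferInstance
  refine norm_pointSum_one_le_of_aeval_eq_zero (L := AdjoinRoot F) hirr hp (y := AdjoinRoot.root F) ?_ he hD ?_
    (pb.finrank.trans hdim) hψ
  · have h1 : Polynomial.aeval (AdjoinRoot.root F) F = 0 := by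
      rw [Polynomial.aeval_def, AdjoinRoot.algebraMap_eq, AdjoinRoot.eval₂_root]
    rwa [Polynomial.aeval_map_algebraMap] at h1
  · rw [← hFdeg, ← pb.basis.span_eq]
    congr 1
    refine congrArg Set.range (funext fun i => ?_)
    exact (pb.basis_eq_pow i).symm

section PlaneCurve

theorem map_evalRingHom_ne_zero {k : Type*} [Field k] {f : Polynomial k[X]} (hirr : Irreducible f)
    (he : 0 < f.natDegree) (x : k) : f.map (Polynomial.evalRingHom x) ≠ 0 := by
  intro h0
  have hdvd : Polynomial.C (Polynomial.X - Polynomial.C x) ∣ f := by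
    rw [Polynomial.C_dvd_iff_dvd_coeff]
    intro i
    rw [Polynomial.dvd_iff_isRoot, Polynomial.IsRoot, ← Polynomial.coe_evalRingHom,
      ← Polynomial.coeff_map, h0, Polynomial.coeff_zero]
  exact Polynomial.not_isUnit_X_sub_C x (hirr.isPrimitive he.ne' _ hdvd)

theorem evalEval_eq_eval_map {k : Type*} [CommRing k] (f : Polynomial k[X]) (x y : k) :
    Polynomial.evalEval x y f = (f.map (Polynomial.evalRingHom x)).eval y := by
  induction f using Polynomial.induction_on' with
  | add f g hf hg => rw [Polynomial.evalEval_add, hf, hg, Polynomial.map_add, Polynomial.eval_add]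
  | monomial n a => simp [Polynomial.evalEval, Polynomial.eval_monomial, Polynomial.map_monomial]

theorem card_evalEval_eq_zero_le {k : Type*} [Field k] [Fintype k] [DecidableEq k]
    {f : Polynomial k[X]} (hirr : Irreducible f)
    (he : 0 < f.natDegree) (x : k) :
    (Finset.univ.filter fun y : k => Polynomial.evalEval x y f = 0).card ≤ f.natDegree := by
  have h0 := map_evalRingHom_ne_zero hirr he x
  calc _ ≤ (f.map (Polynomial.evalRingHom x)).roots.toFinset.card := by
        refine Finset.card_le_card fun y hy => ?_
        rw [Finset.mem_filter, evalEval_eq_eval_map] at hy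
        rw [Multiset.mem_toFinset, Polynomial.mem_roots h0]
        exact hy.2
    _ ≤ (f.map (Polynomial.evalRingHom x)).roots.card := Multiset.toFinset_card_le _
    _ ≤ (f.map (Polynomial.evalRingHom x)).natDegree := Polynomial.card_roots' _
    _ ≤ _ := Polynomial.natDegree_map_le

variable {p : ℕ} [Fact p.Prime]

theorem pointSum_one_eq {Ω : Type*} [Field Ω] [CharP Ω p] [Algebra (ZMod p) Ω]
    {f : Polynomial (ZMod p)[X]} (hirr : Irreducible f) (he : 0 < f.natDegree)
    (ψ : AddChar (ZMod p) ℂ) :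
    pointSum Ω ψ f 1 = ∑ x : ZMod p,
      ψ x * (Finset.univ.filter fun y : ZMod p => Polynomial.evalEval x y f = 0).card := by
  classical
  have hp1 : 1 < p ^ 1 := by rw [pow_one]; exact (Fact.out : p.Prime).one_lt
  have hcast : ∀ c : ZMod p, ZMod.castHom (dvd_refl p) Ω c = algebraMap (ZMod p) Ω c := fun c => by
    congr 1; exact RingHom.ext_zmod _ _
  have hex : ∀ z : Ω, z ^ p ^ 1 = z → ∃ c : ZMod p, algebraMap (ZMod p) Ω c = z := fun z hz => by
    rw [pow_one] at hz
    obtain ⟨c, hc⟩ := exists_cast_eq_of_pow_eq hz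
    exact ⟨c, (hcast c).symm.trans hc⟩
  have hfix : ∀ c : ZMod p, (algebraMap (ZMod p) Ω c) ^ p ^ 1 = algebraMap (ZMod p) Ω c :=
    fun c => by rw [pow_one, ← map_pow, ZMod.pow_card]
  have hinj : Function.Injective (algebraMap (ZMod p) Ω) := (algebraMap (ZMod p) Ω).injective
  unfold pointSum
  symm
  refine Finset.sum_bij (fun c _ => algebraMap (ZMod p) Ω c) ?_ ?_ ?_ ?_
  · intro c _
    rw [mem_powFixed hp1]
    exact hfix c
  · intro a _ b _ h
    exact hinj h
  · intro z hz
    rw [mem_powFixed hp1] at hz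
    obtain ⟨c, hc⟩ := hex z hz
    exact ⟨c, Finset.mem_univ _, hc⟩
  · intro c _
    rw [psiTr_eq ψ (c := c) (by rw [hcast]; simp)]
    congr 2
    have hmap : f.map (Polynomial.eval₂RingHom (algebraMap (ZMod p) Ω) (algebraMap (ZMod p) Ω c)) =
        (f.map (Polynomial.evalRingHom c)).map (algebraMap (ZMod p) Ω) := by
      rw [Polynomial.map_map]
      congr 1
      refine Polynomial.ringHom_ext (fun a => by simp) (by simp)
    have h0 : (f.map (Polynomial.evalRingHom c)).map (algebraMap (ZMod p) Ω) ≠ 0 :=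
      (Polynomial.map_ne_zero_iff hinj).2 (map_evalRingHom_ne_zero hirr he c)
    rw [hmap, ← Finset.card_image_of_injective _ hinj]
    congr 1
    ext y
    rw [Finset.mem_image, Finset.mem_filter, Multiset.mem_toFinset, Polynomial.mem_roots h0]
    constructor
    · rintro ⟨c', hc', rfl⟩
      refine ⟨?_, hfix c'⟩
      rw [Finset.mem_filter, evalEval_eq_eval_map] at hc'
      rw [Polynomial.IsRoot, Polynomial.eval_map_algebraMap, Polynomial.aeval_algebraMap_apply, Polynomial.coe_aeval_eq_eval, hc'.2, map_zero]
    · rintro ⟨h1, h2⟩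
      obtain ⟨c', rfl⟩ := hex y h2
      refine ⟨c', ?_, rfl⟩
      rw [Finset.mem_filter, evalEval_eq_eval_map]
      refine ⟨Finset.mem_univ _, ?_⟩
      rw [Polynomial.IsRoot, Polynomial.eval_map_algebraMap, Polynomial.aeval_algebraMap_apply, Polynomial.coe_aeval_eq_eval] at h1
      exact (map_eq_zero_iff _ hinj).1 h1

theorem norm_sum_addChar_mul_card_le {f : Polynomial (ZMod p)[X]} (hirr : Irreducible f)
    (he : 0 < f.natDegree) {d : ℕ} (hfd : f.natDegree ≤ d)
    (hD : ∀ j, (f.coeff j).natDegree ≤ d) (hd : d ^ 2 ≤ p)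
    {ψ : AddChar (ZMod p) ℂ} (hψ : ψ ≠ 1) :
    ‖∑ x : ZMod p,
      ψ x * (Finset.univ.filter fun y : ZMod p => Polynomial.evalEval x y f = 0).card‖ ≤
      7 * (d : ℝ) ^ 2 * √p := by
  have hd0 : 1 ≤ d := he.trans_le hfd
  have hp2 := (Fact.out : p.Prime).two_le
  have hdp : f.natDegree < p := by
    refine hfd.trans_lt ?_
    by_contra! h
    nlinarith
  have _ : CharP (AlgebraicClosure (ZMod p)) p := charP_of_injective_algebraMap (algebraMap (ZMod p) _).injective p
  have h := norm_pointSum_one_le (Ω := AlgebraicClosure (ZMod p)) hirr he hdp hD hψ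
  rw [pointSum_one_eq hirr he] at h
  refine h.trans ?_
  have hsq : (d : ℝ) ≤ √p := Real.le_sqrt_of_sq_le (by exact_mod_cast hd)
  have h1 : ((f.natDegree * (2 * d + 2) : ℕ) : ℝ) ≤ 4 * (d : ℝ) ^ 2 := by
    have : f.natDegree * (2 * d + 2) ≤ 4 * d ^ 2 := by nlinarith [Nat.mul_le_mul hfd (le_refl (2*d+2))]
    exact_mod_cast this
  have h2 : ((2 * f.natDegree ^ 2 * d + f.natDegree * d : ℕ) : ℝ) ≤ 3 * (d : ℝ) ^ 2 * d := by
    have : 2 * f.natDegree ^ 2 * d + f.natDegree * d ≤ 3 * d ^ 2 * d := by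
      have h3 : f.natDegree ^ 2 * d ≤ d ^ 2 * d := Nat.mul_le_mul_right _ (Nat.pow_le_pow_left hfd 2)
      have h4 : f.natDegree * d ≤ d ^ 2 * d := by
        refine Nat.mul_le_mul_right _ (hfd.trans ?_)
        nlinarith
      nlinarith
    exact_mod_cast this
  calc _ ≤ 4 * (d : ℝ) ^ 2 * √p + 3 * (d : ℝ) ^ 2 * d := by gcongr
    _ ≤ 4 * (d : ℝ) ^ 2 * √p + 3 * (d : ℝ) ^ 2 * √p := by gcongr
    _ = _ := by ring

end PlaneCurve

section CommonZeros

theorem Matrix.natDegree_det_le_sum {R : Type*} [CommRing R] {n : Type*} [Fintype n] [DecidableEq n]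
    (M : Matrix n n R[X]) (c : n → ℕ) (h : ∀ i j, (M i j).natDegree ≤ c j) :
    M.det.natDegree ≤ ∑ j, c j := by
  rw [Matrix.det_apply]
  refine Polynomial.natDegree_sum_le_of_forall_le _ _ fun σ _ => ?_
  refine (Polynomial.natDegree_smul_le _ _).trans ?_
  exact (Polynomial.natDegree_prod_le _ _).trans (Finset.sum_le_sum fun i _ => h _ _)

theorem natDegree_resultant_le {R : Type*} [CommRing R] (f g : Polynomial R[X]) {m n a b : ℕ}
    (hf : ∀ j, (f.coeff j).natDegree ≤ a) (hg : ∀ j, (g.coeff j).natDegree ≤ b) :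
    (Polynomial.resultant f g m n).natDegree ≤ m * b + n * a := by
  unfold Polynomial.resultant
  refine (Matrix.natDegree_det_le_sum _ (fun j => j.addCases (fun _ => b) (fun _ => a)) ?_).trans ?_
  · intro i j
    unfold Polynomial.sylvester
    rw [Matrix.of_apply]
    induction j using Fin.addCases with
    | left j =>
      simp only [Fin.addCases_left]
      split_ifs
      · exact hg _
      · simp
    | right j =>
      simp only [Fin.addCases_right]
      split_ifs
      · exact hf _
      · simp
  · rw [Fin.sum_univ_add]
    simp

variable {k : Type*} [Field k]

theorem resultant_ne_zero_of_not_dvd {f g : Polynomial k[X]} (hirr : Irreducible f)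
    (he : 0 < f.natDegree) (hfg : ¬ f ∣ g) : Polynomial.resultant f g ≠ 0 := by
  have hprim : f.IsPrimitive := hirr.isPrimitive he.ne'
  let ε := algebraMap k[X] (RatFunc k)
  have hε : Function.Injective ε := IsFractionRing.injective _ _
  have hF : Irreducible (f.map ε) := (hprim.irreducible_iff_irreducible_map_fraction_map).1 hirr
  have hFG : ¬ f.map ε ∣ g.map ε := fun h =>
    hfg (hprim.dvd_of_fraction_map_dvd_fraction_map h)
  have h1 : Polynomial.resultant (f.map ε) (g.map ε) ≠ 0 := by
    rw [Ne, Polynomial.resultant_eq_zero_iff]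
    exact fun h => h.2 (hF.coprime_iff_not_dvd.2 hFG)
  rw [Polynomial.natDegree_map_eq_of_injective hε, Polynomial.natDegree_map_eq_of_injective hε,
    Polynomial.resultant_map_map] at h1
  exact fun h => h1 (by rw [h, map_zero])

theorem card_common_zeros_le [Fintype k] [DecidableEq k] {f g : Polynomial k[X]}
    (hirr : Irreducible f) (he : 0 < f.natDegree) (hfg : ¬ f ∣ g) {m n : ℕ}
    (hfm : f.natDegree ≤ m) (hfm' : ∀ j, (f.coeff j).natDegree ≤ m)
    (hgn : g.natDegree ≤ n) (hgn' : ∀ j, (g.coeff j).natDegree ≤ n) :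
    (Finset.univ.filter fun z : k × k => Polynomial.evalEval z.1 z.2 f = 0 ∧
      Polynomial.evalEval z.1 z.2 g = 0).card ≤ 2 * m * n * m := by
  have hr := resultant_ne_zero_of_not_dvd hirr he hfg
  obtain ⟨u, v, -, -, huv⟩ := Polynomial.exists_mul_add_mul_eq_C_resultant f g le_rfl le_rfl
    (Or.inl he.ne')
  have hdeg : (Polynomial.resultant f g).natDegree ≤ 2 * m * n := by
    refine (natDegree_resultant_le f g hfm' hgn').trans ?_
    nlinarith [Nat.mul_le_mul_right n hfm, Nat.mul_le_mul_right m hgn]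
  have hsub : (Finset.univ.filter fun z : k × k => Polynomial.evalEval z.1 z.2 f = 0 ∧
      Polynomial.evalEval z.1 z.2 g = 0) ⊆
      Finset.image (fun s : (_ : k) × k => (s.1, s.2))
        ((Polynomial.resultant f g).roots.toFinset.sigma
          (fun x => Finset.univ.filter fun y : k => Polynomial.evalEval x y f = 0)) := by
    intro z hz
    rw [Finset.mem_filter] at hz
    refine Finset.mem_image.2 ⟨⟨z.1, z.2⟩, ?_, rfl⟩
    rw [Finset.mem_sigma, Multiset.mem_toFinset, Polynomial.mem_roots hr, Finset.mem_filter]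
    refine ⟨?_, Finset.mem_univ _, hz.2.1⟩
    have h := congrArg (Polynomial.evalEval z.1 z.2) huv
    rw [Polynomial.evalEval_add, Polynomial.evalEval_mul, Polynomial.evalEval_mul, hz.2.1, hz.2.2,
      Polynomial.evalEval_C] at h
    simpa using h.symm
  refine (Finset.card_le_card hsub).trans (Finset.card_image_le.trans ?_)
  rw [Finset.card_sigma]
  refine (Finset.sum_le_card_nsmul _ _ m fun x _ => (card_evalEval_eq_zero_le hirr he x).trans hfm).trans ?_
  rw [smul_eq_mul]
  exact Nat.mul_le_mul_right _ ((Multiset.toFinset_card_le _).trans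
    ((Polynomial.card_roots' _).trans hdeg))

end CommonZeros

section Coordinates

variable {k : Type*} [Field k]

/-- The isomorphism `k[x₀, x₁] ≃ k[X][Y]` sending `a x₀ + b x₁` to `X`. -/
noncomputable def linearCoords (a b α β : k) (h : a * α + b * β = 1) :
    MvPolynomial (Fin 2) k ≃ₐ[k] Polynomial k[X] :=
  AlgEquiv.ofAlgHom
    (MvPolynomial.aeval ![Polynomial.C (Polynomial.C α * Polynomial.X) -
        Polynomial.C (Polynomial.C b) * Polynomial.X,
      Polynomial.C (Polynomial.C β * Polynomial.X) +
        Polynomial.C (Polynomial.C a) * Polynomial.X])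
    (Polynomial.aevalAeval (MvPolynomial.C a * MvPolynomial.X 0 + MvPolynomial.C b * MvPolynomial.X 1)
      (MvPolynomial.C α * MvPolynomial.X 1 - MvPolynomial.C β * MvPolynomial.X 0))
    (by
      refine Polynomial.algHom_ext' (Polynomial.algHom_ext ?_) ?_
      · have h1 := congrArg (fun c : k => (Polynomial.C (Polynomial.C c) : Polynomial k[X])) h
        simp only [map_add, map_mul, map_one] at h1
        simp
        linear_combination Polynomial.C Polynomial.X * h1
      · have h1 := congrArg (fun c : k => (Polynomial.C (Polynomial.C c) : Polynomial k[X])) h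
        simp only [map_add, map_mul, map_one] at h1
        simp
        linear_combination Polynomial.X * h1)
    (by
      have h1 := congrArg (fun c : k => (MvPolynomial.C c : MvPolynomial (Fin 2) k)) h
      simp only [map_add, map_mul, map_one] at h1
      refine MvPolynomial.algHom_ext fun i => ?_
      fin_cases i
      · simp [Polynomial.aevalAeval, MvPolynomial.algebraMap_eq]
        linear_combination MvPolynomial.X 0 * h1
      · simp [MvPolynomial.algebraMap_eq]
        linear_combination MvPolynomial.X 1 * h1)

variable {a b α β : k} (h : a * α + b * β = 1)

theorem evalEval_linearCoords (φ : MvPolynomial (Fin 2) k) (x y : k) :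
    Polynomial.evalEval x y (linearCoords a b α β h φ) =
      MvPolynomial.eval ![α * x - b * y, β * x + a * y] φ := by
  induction φ using MvPolynomial.induction_on with
  | C c =>
    have : linearCoords a b α β h (MvPolynomial.C c) = Polynomial.C (Polynomial.C c) :=
      (linearCoords a b α β h).commutes c
    rw [this]
    simp
  | add f g hf hg => rw [map_add, map_add, Polynomial.evalEval_add, hf, hg]
  | mul_X f i hf =>
    rw [map_mul, map_mul, Polynomial.evalEval_mul, hf]
    congr 1
    fin_cases i <;> simp [linearCoords, Polynomial.evalEval_C]

theorem degree_le_mul {R : Type*} [CommRing R] {f g : Polynomial R[X]} {m n : ℕ}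
    (hf : f.natDegree ≤ m ∧ ∀ j, (f.coeff j).natDegree ≤ m)
    (hg : g.natDegree ≤ n ∧ ∀ j, (g.coeff j).natDegree ≤ n) :
    (f * g).natDegree ≤ m + n ∧ ∀ j, ((f * g).coeff j).natDegree ≤ m + n := by
  refine ⟨Polynomial.natDegree_mul_le.trans (add_le_add hf.1 hg.1), fun j => ?_⟩
  rw [Polynomial.coeff_mul]
  exact Polynomial.natDegree_sum_le_of_forall_le _ _ fun i _ =>
    Polynomial.natDegree_mul_le.trans (add_le_add (hf.2 _) (hg.2 _))

theorem degree_le_pow {R : Type*} [CommRing R] {f : Polynomial R[X]}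
    (hf : f.natDegree ≤ 1 ∧ ∀ j, (f.coeff j).natDegree ≤ 1) (n : ℕ) :
    (f ^ n).natDegree ≤ n ∧ ∀ j, ((f ^ n).coeff j).natDegree ≤ n := by
  induction n with
  | zero =>
    rw [pow_zero]
    refine ⟨by simp, fun j => ?_⟩
    rw [Polynomial.coeff_one]
    split_ifs <;> simp
  | succ n ih => rw [pow_succ]; exact degree_le_mul ih hf

theorem degree_le_linear {R : Type*} [CommRing R] (u v : R) :
    (Polynomial.C (Polynomial.C u * Polynomial.X) +
      Polynomial.C (Polynomial.C v) * Polynomial.X : Polynomial R[X]).natDegree ≤ 1 ∧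
    ∀ j, ((Polynomial.C (Polynomial.C u * Polynomial.X) +
      Polynomial.C (Polynomial.C v) * Polynomial.X : Polynomial R[X]).coeff j).natDegree ≤ 1 := by
  constructor
  · compute_degree
  · intro j
    rw [Polynomial.coeff_add, Polynomial.coeff_C, Polynomial.coeff_C_mul, Polynomial.coeff_X]
    split_ifs <;> compute_degree!

theorem linearCoords_degree_le (φ : MvPolynomial (Fin 2) k) :
    (linearCoords a b α β h φ).natDegree ≤ φ.totalDegree ∧
      ∀ j, ((linearCoords a b α β h φ).coeff j).natDegree ≤ φ.totalDegree := by
  have h0 : (linearCoords a b α β h (MvPolynomial.X 0)).natDegree ≤ 1 ∧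
      ∀ j, ((linearCoords a b α β h (MvPolynomial.X 0)).coeff j).natDegree ≤ 1 := by
    have e : linearCoords a b α β h (MvPolynomial.X 0) = Polynomial.C (Polynomial.C α * Polynomial.X) +
        Polynomial.C (Polynomial.C (-b)) * Polynomial.X := by
      simp [linearCoords, sub_eq_add_neg]
      ring
    rw [e]
    exact degree_le_linear α (-b)
  have h1 : (linearCoords a b α β h (MvPolynomial.X 1)).natDegree ≤ 1 ∧
      ∀ j, ((linearCoords a b α β h (MvPolynomial.X 1)).coeff j).natDegree ≤ 1 := by
    have e : linearCoords a b α β h (MvPolynomial.X 1) = Polynomial.C (Polynomial.C β * Polynomial.X) +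
        Polynomial.C (Polynomial.C a) * Polynomial.X := by
      simp [linearCoords]
    rw [e]
    exact degree_le_linear β a
  have hC : ∀ c : k, linearCoords a b α β h (MvPolynomial.C c) = Polynomial.C (Polynomial.C c) :=
    fun c => (linearCoords a b α β h).commutes c
  have hmon : ∀ s ∈ φ.support, (linearCoords a b α β h (MvPolynomial.monomial s (φ.coeff s))).natDegree ≤
      φ.totalDegree ∧ ∀ j, ((linearCoords a b α β h
        (MvPolynomial.monomial s (φ.coeff s))).coeff j).natDegree ≤ φ.totalDegree := by
    intro s hs
    have hdeg : 0 + (s 0 + s 1) ≤ φ.totalDegree := by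
      have := MvPolynomial.le_totalDegree hs
      rw [Finsupp.sum_fintype _ _ (fun _ => rfl), Fin.sum_univ_two] at this
      rwa [zero_add]
    rw [MvPolynomial.monomial_eq, Finsupp.prod_fintype _ _ (fun _ => pow_zero _), Fin.prod_univ_two,
      map_mul, map_mul, map_pow, map_pow, hC]
    have hc : (Polynomial.C (Polynomial.C (φ.coeff s)) : Polynomial k[X]).natDegree ≤ 0 ∧
        ∀ j, ((Polynomial.C (Polynomial.C (φ.coeff s)) : Polynomial k[X]).coeff j).natDegree ≤ 0 := by
      refine ⟨by simp, fun j => ?_⟩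
      rw [Polynomial.coeff_C]
      split_ifs <;> simp
    have h2 := degree_le_mul hc (degree_le_mul (degree_le_pow h0 (s 0)) (degree_le_pow h1 (s 1)))
    exact ⟨h2.1.trans hdeg, fun j => (h2.2 j).trans hdeg⟩
  rw [φ.as_sum, map_sum, ← φ.as_sum]
  refine ⟨Polynomial.natDegree_sum_le_of_forall_le _ _ fun s hs => (hmon s hs).1, fun j => ?_⟩
  rw [Polynomial.finsetSum_coeff]
  exact Polynomial.natDegree_sum_le_of_forall_le _ _ fun s hs => (hmon s hs).2 j

theorem linearCoords_symm_C_X_sub_C (x : k) :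
    (linearCoords a b α β h).symm (Polynomial.C (Polynomial.X - Polynomial.C x)) =
      MvPolynomial.C a * MvPolynomial.X 0 + MvPolynomial.C b * MvPolynomial.X 1 +
        MvPolynomial.C (-x) := by
  simp [linearCoords, sub_eq_add_neg]

end Coordinates

section CharacterSum

variable {p : ℕ} [Fact p.Prime]

theorem norm_sum_addChar_le_card {G : Type*} [AddGroup G] [Finite G] {ι : Type*}
    (ψ : AddChar G ℂ) (s : Finset ι) (f : ι → G) : ‖∑ i ∈ s, ψ (f i)‖ ≤ s.card := by
  refine (norm_sum_le _ _).trans ?_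
  simp

variable {a b α β : ZMod p} (h : a * α + b * β = 1)

theorem evalEval_linearCoords_ne_zero {φ : MvPolynomial (Fin 2) (ZMod p)}
    (hlin : ∀ c, ¬ (MvPolynomial.C a * MvPolynomial.X 0 + MvPolynomial.C b * MvPolynomial.X 1 +
      MvPolynomial.C c : MvPolynomial (Fin 2) (ZMod p)) ∣ φ)
    (h0 : (linearCoords a b α β h φ).natDegree = 0) (x y : ZMod p) :
    Polynomial.evalEval x y (linearCoords a b α β h φ) ≠ 0 := by
  intro hxy
  obtain ⟨g, hg⟩ : ∃ g, linearCoords a b α β h φ = Polynomial.C g :=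
    ⟨_, Polynomial.eq_C_of_natDegree_eq_zero h0⟩
  rw [hg, Polynomial.evalEval_C] at hxy
  have h1 : Polynomial.C (Polynomial.X - Polynomial.C x) ∣ linearCoords a b α β h φ := by
    rw [hg]
    exact Polynomial.C.map_dvd (Polynomial.dvd_iff_isRoot.2 hxy)
  have h2 := map_dvd (linearCoords a b α β h).symm h1
  rw [linearCoords_symm_C_X_sub_C, AlgEquiv.symm_apply_apply] at h2
  exact hlin _ h2

theorem norm_sum_linearCoords_le_of_irreducible {ψ : AddChar (ZMod p) ℂ} (hψ : ψ ≠ 1)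
    {φ : MvPolynomial (Fin 2) (ZMod p)} (hirr : Irreducible φ)
    (hlin : ∀ c, ¬ (MvPolynomial.C a * MvPolynomial.X 0 + MvPolynomial.C b * MvPolynomial.X 1 +
      MvPolynomial.C c : MvPolynomial (Fin 2) (ZMod p)) ∣ φ)
    (hd : φ.totalDegree ^ 2 ≤ p) :
    ‖∑ z : ZMod p × ZMod p with Polynomial.evalEval z.1 z.2 (linearCoords a b α β h φ) = 0,
      ψ z.1‖ ≤ 7 * (φ.totalDegree : ℝ) ^ 2 * √p := by
  rcases Nat.eq_zero_or_pos (linearCoords a b α β h φ).natDegree with h0 | h0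
  · rw [Finset.filter_false_of_mem
      (fun z _ => evalEval_linearCoords_ne_zero h hlin h0 z.1 z.2)]
    rw [Finset.sum_empty, norm_zero]
    positivity
  · have hirr' : Irreducible (linearCoords a b α β h φ) :=
      (MulEquiv.irreducible_iff (linearCoords a b α β h)).2 hirr
    have hdeg := linearCoords_degree_le h φ
    have := norm_sum_addChar_mul_card_le hirr' h0 hdeg.1 hdeg.2 hd hψ
    convert this using 2
    rw [Finset.sum_filter, Fintype.sum_prod_type]
    refine Finset.sum_congr rfl fun x _ => ?_
    rw [← Finset.sum_filter]
    dsimp only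
    rw [Finset.sum_const, nsmul_eq_mul, mul_comm]

theorem norm_sum_linearCoords_le {ψ : AddChar (ZMod p) ℂ} (hψ : ψ ≠ 1)
    {φ : MvPolynomial (Fin 2) (ZMod p)} (h0 : φ ≠ 0)
    (hlin : ∀ c, ¬ (MvPolynomial.C a * MvPolynomial.X 0 + MvPolynomial.C b * MvPolynomial.X 1 +
      MvPolynomial.C c : MvPolynomial (Fin 2) (ZMod p)) ∣ φ)
    (hd : φ.totalDegree ^ 2 ≤ p) :
    ‖∑ z : ZMod p × ZMod p with Polynomial.evalEval z.1 z.2 (linearCoords a b α β h φ) = 0,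
      ψ z.1‖ ≤ 7 * (φ.totalDegree : ℝ) ^ 2 * √p := by
  induction φ using WfDvdMonoid.induction_on_irreducible with
  | zero => exact absurd rfl h0
  | unit u hu =>
    have hu' := hu.map (linearCoords a b α β h)
    rw [Finset.filter_false_of_mem fun z _ hz => (hu'.map (Polynomial.evalEvalRingHom z.1 z.2)).ne_zero hz]
    rw [Finset.sum_empty, norm_zero]
    positivity
  | mul g f hg0 hf ih =>
    have hf0 : f ≠ 0 := hf.ne_zero
    have hdeg : (f * g).totalDegree = f.totalDegree + g.totalDegree :=
      MvPolynomial.totalDegree_mul_of_isDomain hf0 hg0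
    have hlf : ∀ c, ¬ (MvPolynomial.C a * MvPolynomial.X 0 + MvPolynomial.C b * MvPolynomial.X 1 +
        MvPolynomial.C c : MvPolynomial (Fin 2) (ZMod p)) ∣ f :=
      fun c hc => hlin c (hc.mul_right g)
    have hlg : ∀ c, ¬ (MvPolynomial.C a * MvPolynomial.X 0 + MvPolynomial.C b * MvPolynomial.X 1 +
        MvPolynomial.C c : MvPolynomial (Fin 2) (ZMod p)) ∣ g :=
      fun c hc => hlin c (hc.mul_left f)
    have hdf : f.totalDegree ^ 2 ≤ p := (Nat.pow_le_pow_left (by omega) 2).trans hd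
    have hdg : g.totalDegree ^ 2 ≤ p := (Nat.pow_le_pow_left (by omega) 2).trans hd
    have ihf := norm_sum_linearCoords_le_of_irreducible h hψ hf hlf hdf
    have ihg := ih hg0 hlg hdg
    let V : MvPolynomial (Fin 2) (ZMod p) → Finset (ZMod p × ZMod p) := fun φ =>
      Finset.univ.filter fun z => Polynomial.evalEval z.1 z.2 (linearCoords a b α β h φ) = 0
    have hV : V (f * g) = V f ∪ V g := by
      ext z
      simp only [V, Finset.mem_union, Finset.mem_filter, Finset.mem_univ, true_and, map_mul,
        Polynomial.evalEval_mul, mul_eq_zero]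
    have hinter : f ∣ g ∨ ((V f ∩ V g).card : ℝ) ≤ 2 * f.totalDegree * g.totalDegree * √p := by
      by_cases hfg : f ∣ g
      · exact Or.inl hfg
      right
      rcases Nat.eq_zero_or_pos (linearCoords a b α β h f).natDegree with h1 | h1
      · have : V f = ∅ := Finset.filter_false_of_mem
          (fun z _ => evalEval_linearCoords_ne_zero h hlf h1 z.1 z.2)
        rw [this, Finset.empty_inter, Finset.card_empty, Nat.cast_zero]
        positivity
      · have hirr' : Irreducible (linearCoords a b α β h f) :=
          (MulEquiv.irreducible_iff (linearCoords a b α β h)).2 hf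
        have hnd : ¬ linearCoords a b α β h f ∣ linearCoords a b α β h g := fun hh =>
          hfg ((map_dvd_iff (linearCoords a b α β h)).1 hh)
        have h2 := card_common_zeros_le hirr' h1 hnd (linearCoords_degree_le h f).1
          (linearCoords_degree_le h f).2 (linearCoords_degree_le h g).1 (linearCoords_degree_le h g).2
        rw [← Finset.filter_and]
        calc _ ≤ ((2 * f.totalDegree * g.totalDegree * f.totalDegree : ℕ) : ℝ) := by exact_mod_cast h2
          _ = 2 * (f.totalDegree : ℝ) * g.totalDegree * f.totalDegree := by push_cast; ring
          _ ≤ _ := by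
            gcongr
            exact Real.le_sqrt_of_sq_le (by exact_mod_cast hdf)
    change ‖∑ z ∈ V (f * g), ψ z.1‖ ≤ _
    change ‖∑ z ∈ V f, ψ z.1‖ ≤ _ at ihf
    change ‖∑ z ∈ V g, ψ z.1‖ ≤ _ at ihg
    rw [hdeg]
    push_cast
    rcases hinter with hfg | hfg
    · have : V (f * g) = V g := by
        rw [hV, Finset.union_eq_right]
        intro z hz
        obtain ⟨w, rfl⟩ := hfg
        simp only [V, Finset.mem_filter, Finset.mem_univ, true_and, map_mul,
          Polynomial.evalEval_mul, mul_eq_zero] at hz ⊢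
        exact Or.inl hz
      rw [this]
      refine ihg.trans ?_
      gcongr
      simp
    · have hsum := Finset.sum_union_inter (s₁ := V f) (s₂ := V g) (f := fun z => ψ z.1)
      rw [← hV] at hsum
      rw [eq_sub_of_add_eq hsum]
      have h3 := norm_sum_addChar_le_card ψ (V f ∩ V g) Prod.fst
      refine (norm_sub_le _ _).trans ((add_le_add (norm_add_le _ _) h3).trans ?_)
      have h4 : 0 ≤ (f.totalDegree : ℝ) * g.totalDegree * √p := by positivity
      nlinarith

theorem norm_sum_addChar_linear_le {ψ : AddChar (ZMod p) ℂ} (hψ : ψ ≠ 1)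
    {φ : MvPolynomial (Fin 2) (ZMod p)} (h0 : φ ≠ 0)
    (hlin : ∀ b₁ b₂ c : ZMod p, (b₁, b₂) ≠ (0, 0) →
      ¬ (MvPolynomial.C b₁ * MvPolynomial.X 0 + MvPolynomial.C b₂ * MvPolynomial.X 1 +
        MvPolynomial.C c : MvPolynomial (Fin 2) (ZMod p)) ∣ φ)
    (hd : φ.totalDegree ^ 2 ≤ p) (a b : ZMod p) (hab : (a, b) ≠ (0, 0)) :
    ‖∑ z : ZMod p × ZMod p with MvPolynomial.eval ![z.1, z.2] φ = 0,
      ψ (a * z.1 + b * z.2)‖ ≤ 7 * (φ.totalDegree : ℝ) ^ 2 * √p := by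
  obtain ⟨α, β, h⟩ : ∃ α β : ZMod p, a * α + b * β = 1 := by
    by_cases ha : a = 0
    · have hb : b ≠ 0 := fun hb => hab (by rw [ha, hb])
      exact ⟨0, b⁻¹, by rw [mul_zero, zero_add, mul_inv_cancel₀ hb]⟩
    · exact ⟨a⁻¹, 0, by rw [mul_zero, add_zero, mul_inv_cancel₀ ha]⟩
  have := norm_sum_linearCoords_le h hψ h0 (fun c => hlin a b c hab) hd
  convert this using 2
  symm
  refine Finset.sum_bij (fun z _ => (α * z.1 - b * z.2, β * z.1 + a * z.2)) ?_ ?_ ?_ ?_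
  · intro z hz
    rw [Finset.mem_filter, evalEval_linearCoords] at hz
    rw [Finset.mem_filter]
    exact ⟨Finset.mem_univ _, hz.2⟩
  · rintro ⟨x, y⟩ _ ⟨x', y'⟩ _ hxy
    rw [Prod.mk.injEq] at hxy ⊢
    obtain ⟨e1, e2⟩ := hxy
    dsimp only at e1 e2
    constructor
    · linear_combination a * e1 + b * e2 + (x' - x) * h
    · linear_combination α * e2 - β * e1 + (y' - y) * h
  · rintro ⟨u, v⟩ hz
    rw [Finset.mem_filter] at hz
    have e1 : α * (a * u + b * v) - b * (α * v - β * u) = u := by linear_combination u * h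
    have e2 : β * (a * u + b * v) + a * (α * v - β * u) = v := by linear_combination v * h
    refine ⟨(a * u + b * v, α * v - β * u), ?_, by simp only [e1, e2]⟩
    rw [Finset.mem_filter, evalEval_linearCoords, e1, e2]
    exact ⟨Finset.mem_univ _, hz.2⟩
  · rintro ⟨x, y⟩ _
    congr 1
    dsimp only
    linear_combination -x * h

end CharacterSum

section CompletingSums

variable {p : ℕ} [Fact p.Prime]

theorem le_norm_stdAddChar_natCast_sub_one {j : ℕ} (h0 : 0 < j) (hj : j < p) :
    4 * min (j : ℝ) (p - j) / p ≤ ‖(ZMod.stdAddChar (j : ZMod p) : ℂ) - 1‖ := by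
  have hp : (0 : ℝ) < p := by exact_mod_cast (Fact.out : p.Prime).pos
  have hjp : (j : ℝ) < p := by exact_mod_cast hj
  have hj0 : (0 : ℝ) < j := by exact_mod_cast h0
  have h1 : (ZMod.stdAddChar (j : ZMod p) : ℂ) =
      Complex.exp (Complex.I * ((2 * Real.pi * j / p : ℝ) : ℂ)) := by
    have := ZMod.stdAddChar_coe (N := p) (j : ℤ)
    rw [Int.cast_natCast] at this
    rw [this]
    congr 1
    push_cast
    ring
  have hsin : ∀ t : ℝ, 0 ≤ t → t ≤ p / 2 → 2 * t / p ≤ Real.sin (Real.pi * t / p) := by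
    intro t ht0 ht
    have h2 := Real.mul_le_sin (x := Real.pi * t / p) (by positivity) (by
      rw [div_le_iff₀ hp]
      nlinarith [Real.pi_pos])
    convert h2 using 1
    field_simp
  rw [h1, Complex.norm_exp_I_mul_ofReal_sub_one, norm_mul, Real.norm_eq_abs, Real.norm_eq_abs,
    abs_two]
  have h3 : 2 * Real.pi * j / p / 2 = Real.pi * j / p := by ring
  rw [h3]
  have h4 : 2 * min (j : ℝ) (p - j) / p ≤ |Real.sin (Real.pi * j / p)| := by
    refine le_trans ?_ (le_abs_self _)
    rcases le_total (j : ℝ) (p / 2) with h | h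
    · rw [min_eq_left (by linarith)]
      exact hsin _ hj0.le h
    · rw [min_eq_right (by linarith)]
      have h5 := hsin (p - j) (by linarith) (by linarith)
      rwa [show Real.pi * (p - j) / p = Real.pi - Real.pi * j / p by field_simp, Real.sin_pi_sub] at h5
  calc _ = 2 * (2 * min (j : ℝ) (p - j) / p) := by ring
    _ ≤ _ := by gcongr

theorem norm_geom_sum_stdAddChar_le {j : ℕ} (h0 : 0 < j) (hj : j < p) (m : ℕ) :
    ‖∑ i ∈ Finset.range m, (ZMod.stdAddChar (j : ZMod p) : ℂ) ^ i‖ ≤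
      p / 2 * ((j : ℝ)⁻¹ + ((p - j : ℝ))⁻¹) := by
  have hp : (0 : ℝ) < p := by exact_mod_cast (Fact.out : p.Prime).pos
  have hj0 : (0 : ℝ) < j := by exact_mod_cast h0
  have hjp : (0 : ℝ) < p - j := sub_pos.2 (by exact_mod_cast hj)
  have hmin : 0 < min (j : ℝ) (p - j) := lt_min hj0 hjp
  have h1 := le_norm_stdAddChar_natCast_sub_one h0 hj
  have h2 : (0 : ℝ) < 4 * min (j : ℝ) (p - j) / p := by positivity
  have hne : (ZMod.stdAddChar (j : ZMod p) : ℂ) ≠ 1 := fun h => by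
    rw [h, sub_self, norm_zero] at h1
    linarith
  rw [geom_sum_eq hne, norm_div]
  have h3 : ‖(ZMod.stdAddChar (j : ZMod p) : ℂ) ^ m - 1‖ ≤ 2 := by
    refine (norm_sub_le _ _).trans ?_
    rw [norm_pow, AddChar.norm_apply, norm_one, one_pow]
    norm_num
  calc _ ≤ 2 / (4 * min (j : ℝ) (p - j) / p) := div_le_div₀ zero_le_two h3 h2 h1
    _ = p / 2 * (min (j : ℝ) (p - j))⁻¹ := by field_simp; norm_num
    _ ≤ _ := by
      gcongr
      rcases min_choice (j : ℝ) (p - j) with h | h <;> rw [h]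
      · exact le_add_of_nonneg_right (inv_nonneg.2 hjp.le)
      · exact le_add_of_nonneg_left (inv_nonneg.2 hj0.le)

theorem sum_zmod_eq_sum_range {M : Type*} [AddCommMonoid M] (f : ZMod p → M) :
    ∑ a, f a = ∑ j ∈ Finset.range p, f j := by
  symm
  refine Finset.sum_bij (fun j _ => (j : ZMod p)) (fun _ _ => Finset.mem_univ _) ?_ ?_ (fun _ _ => rfl)
  · intro i hi j hj h
    rw [Finset.mem_range] at hi hj
    rw [ZMod.natCast_eq_natCast_iff'] at h
    rwa [Nat.mod_eq_of_lt hi, Nat.mod_eq_of_lt hj] at h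
  · intro a _
    exact ⟨a.val, Finset.mem_range.2 (ZMod.val_lt a), ZMod.natCast_zmod_val a⟩

theorem one_half_le_log_prime : 1 / 2 ≤ Real.log p := by
  have h1 : Real.log 2 ≤ Real.log p :=
    Real.log_le_log two_pos (by exact_mod_cast (Fact.out : p.Prime).two_le)
  have := Real.log_two_gt_d9
  linarith

theorem sum_norm_geom_sum_stdAddChar_le {m : ℕ} (hm : m ≤ p) :
    ∑ a : ZMod p, ‖∑ i ∈ Finset.range m, (ZMod.stdAddChar a : ℂ) ^ i‖ ≤ 5 * (p * Real.log p) := by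
  have hp0 := (Fact.out : p.Prime).pos
  obtain ⟨n, hn⟩ : ∃ n, p = n + 1 := ⟨p - 1, by omega⟩
  rw [sum_zmod_eq_sum_range]
  rw [show Finset.range p = Finset.range (n + 1) by rw [hn], Finset.sum_range_succ']
  have h0 : ‖∑ i ∈ Finset.range m, (ZMod.stdAddChar ((0 : ℕ) : ZMod p) : ℂ) ^ i‖ ≤ p := by
    rw [Nat.cast_zero, AddChar.map_zero_eq_one]
    simpa using hm
  have h1 : ∀ j ∈ Finset.range n, ‖∑ i ∈ Finset.range m,
      (ZMod.stdAddChar ((j + 1 : ℕ) : ZMod p) : ℂ) ^ i‖ ≤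
      p / 2 * ((((j + 1 : ℕ) : ℝ))⁻¹ + (((n - 1 - j + 1 : ℕ) : ℝ))⁻¹) := by
    intro j hj
    rw [Finset.mem_range] at hj
    have := norm_geom_sum_stdAddChar_le (p := p) (j := j + 1) (by omega) (by omega) m
    convert this using 4
    rw [eq_sub_iff_add_eq]
    norm_cast
    omega
  have hH : ∑ j ∈ Finset.range n, (((j + 1 : ℕ) : ℝ))⁻¹ ≤ 1 + Real.log p := by
    have h2 := harmonic_le_one_add_log n
    rw [harmonic] at h2
    push_cast at h2 ⊢
    refine h2.trans ?_
    rcases Nat.eq_zero_or_pos n with h3 | h3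
    · rw [h3, Nat.cast_zero, Real.log_zero]
      have := one_half_le_log_prime (p := p)
      linarith
    · gcongr
      omega
  have hrefl := Finset.sum_range_reflect (fun j : ℕ => (((j + 1 : ℕ) : ℝ))⁻¹) n
  have h4 := Finset.sum_le_sum h1
  rw [← Finset.mul_sum, Finset.sum_add_distrib, hrefl] at h4
  have hlog := one_half_le_log_prime (p := p)
  have hp : (0 : ℝ) ≤ p := Nat.cast_nonneg p
  have h5 : (p : ℝ) / 2 * (∑ j ∈ Finset.range n, (((j + 1 : ℕ) : ℝ))⁻¹ +
      ∑ j ∈ Finset.range n, (((j + 1 : ℕ) : ℝ))⁻¹) ≤ p / 2 * ((1 + Real.log p) + (1 + Real.log p)) := by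
    gcongr
  nlinarith

theorem sum_norm_sum_apImage_le {s r : ZMod p} (hr : r ≠ 0) {m : ℕ} (hm : m ≤ p) :
    ∑ a : ZMod p, ‖∑ u ∈ apImage p s r m, (ZMod.stdAddChar (-(a * u)) : ℂ)‖ ≤
      5 * (p * Real.log p) := by
  refine le_trans (le_of_eq ?_) (sum_norm_geom_sum_stdAddChar_le hm)
  refine Fintype.sum_equiv ((Equiv.mulRight₀ r hr).trans (Equiv.neg _)) _ _ fun a => ?_
  rw [apImage, Finset.sum_image]
  · have : ∀ i : ℕ, (ZMod.stdAddChar (-(a * (s + (i : ZMod p) * r))) : ℂ) =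
        ZMod.stdAddChar (-(a * s)) * ZMod.stdAddChar (-(a * r)) ^ i := fun i => by
      rw [← AddChar.map_nsmul_eq_pow, ← AddChar.map_add_eq_mul, nsmul_eq_mul]
      congr 1
      ring
    simp only [this]
    rw [← Finset.mul_sum, norm_mul, AddChar.norm_apply, one_mul]
    rfl
  · intro i hi j hj h
    have hi' : i < p := (Finset.mem_range.1 hi).trans_le hm
    have hj' : j < p := (Finset.mem_range.1 hj).trans_le hm
    have h1 := mul_right_cancel₀ hr (add_left_cancel h)
    rw [ZMod.natCast_eq_natCast_iff'] at h1
    rwa [Nat.mod_eq_of_lt hi', Nat.mod_eq_of_lt hj'] at h1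

theorem sum_sum_stdAddChar_eq_ite (I : Finset (ZMod p)) (x : ZMod p) :
    ∑ a : ZMod p, (∑ u ∈ I, (ZMod.stdAddChar (-(a * u)) : ℂ)) * ZMod.stdAddChar (a * x) =
      if x ∈ I then (p : ℂ) else 0 := by
  have h1 : ∀ a u : ZMod p, (ZMod.stdAddChar (-(a * u)) : ℂ) * ZMod.stdAddChar (a * x) =
      ZMod.stdAddChar (a * (x - u)) := fun a u => by
    rw [← AddChar.map_add_eq_mul]
    congr 1
    ring
  simp only [Finset.sum_mul, h1]
  rw [Finset.sum_comm]
  have h2 : ∀ u : ZMod p, ∑ a : ZMod p, (ZMod.stdAddChar (a * (x - u)) : ℂ) =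
      if x = u then (p : ℂ) else 0 := fun u => by
    rw [AddChar.sum_mulShift _ (ZMod.isPrimitive_stdAddChar p), ZMod.card]
    simp only [sub_eq_zero]
    split_ifs <;> simp
  simp only [h2]
  rw [Finset.sum_ite_eq]

theorem abs_card_filter_sub_le_of_norm_le (V : Finset (ZMod p × ZMod p)) (I : Finset (ZMod p))
    {B T : ℝ}
    (hB : ∀ a b : ZMod p, (a, b) ≠ (0, 0) →
      ‖∑ z ∈ V, (ZMod.stdAddChar (a * z.1 + b * z.2) : ℂ)‖ ≤ B)
    (hT : ∑ a : ZMod p, ‖∑ u ∈ I, (ZMod.stdAddChar (-(a * u)) : ℂ)‖ ≤ T) :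
    |((V.filter fun z => z.1 ∈ I ∧ z.2 ∈ I).card : ℝ) - (I.card : ℝ) ^ 2 / (p : ℝ) ^ 2 * V.card| ≤
      T ^ 2 * B / (p : ℝ) ^ 2 := by
  let F : ZMod p → ℂ := fun a => ∑ u ∈ I, (ZMod.stdAddChar (-(a * u)) : ℂ)
  let S : ZMod p × ZMod p → ℂ := fun c => ∑ z ∈ V, (ZMod.stdAddChar (c.1 * z.1 + c.2 * z.2) : ℂ)
  have hp : (0 : ℝ) < p := by exact_mod_cast (Fact.out : p.Prime).pos
  have hB0 : 0 ≤ B := (norm_nonneg _).trans (hB 1 0 (by simp))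
  have hmain : ((p : ℂ) ^ 2) * (V.filter fun z => z.1 ∈ I ∧ z.2 ∈ I).card =
      ∑ c : ZMod p × ZMod p, F c.1 * F c.2 * S c := by
    have h1 : ∀ z : ZMod p × ZMod p,
        ∑ c : ZMod p × ZMod p, F c.1 * F c.2 * ZMod.stdAddChar (c.1 * z.1 + c.2 * z.2) =
        if z.1 ∈ I ∧ z.2 ∈ I then (p : ℂ) ^ 2 else 0 := fun z => by
      have h2 := congrArg₂ (· * ·) (sum_sum_stdAddChar_eq_ite I z.1) (sum_sum_stdAddChar_eq_ite I z.2)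
      rw [Finset.sum_mul_sum, ← Finset.sum_product'] at h2
      rw [← Finset.univ_product_univ]
      refine Eq.trans (Finset.sum_congr rfl fun c _ => ?_) (h2.trans ?_)
      · rw [AddChar.map_add_eq_mul]
        ring
      · by_cases hz1 : z.1 ∈ I <;> by_cases hz2 : z.2 ∈ I <;> simp [hz1, hz2, sq]
    simp only [S, Finset.mul_sum]
    rw [Finset.sum_comm]
    simp only [h1]
    rw [← Finset.sum_filter, Finset.sum_const, nsmul_eq_mul, mul_comm]
  have hF0 : F 0 = I.card := by simp [F]
  have hS0 : S (0, 0) = V.card := by simp [S]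
  rw [← Finset.add_sum_erase _ _ (Finset.mem_univ ((0, 0) : ZMod p × ZMod p)), hS0] at hmain
  dsimp only at hmain
  rw [hF0] at hmain
  have hrest : ‖∑ c ∈ Finset.univ.erase ((0, 0) : ZMod p × ZMod p), F c.1 * F c.2 * S c‖ ≤ T ^ 2 * B := by
    calc _ ≤ ∑ c ∈ Finset.univ.erase ((0, 0) : ZMod p × ZMod p), ‖F c.1‖ * ‖F c.2‖ * B := by
          refine (norm_sum_le _ _).trans (Finset.sum_le_sum fun c hc => ?_)
          rw [norm_mul, norm_mul]
          gcongr
          exact hB c.1 c.2 (Finset.ne_of_mem_erase hc)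
      _ ≤ ∑ c : ZMod p × ZMod p, ‖F c.1‖ * ‖F c.2‖ * B :=
          Finset.sum_le_sum_of_subset_of_nonneg (Finset.subset_univ _) fun _ _ _ => by positivity
      _ = (∑ a, ‖F a‖) ^ 2 * B := by
          rw [← Finset.sum_mul, sq, Finset.sum_mul_sum, Fintype.sum_prod_type]
      _ ≤ T ^ 2 * B := by
          have h0 : 0 ≤ ∑ a, ‖F a‖ := Finset.sum_nonneg fun _ _ => norm_nonneg _
          gcongr
  have heq : (((((V.filter fun z => z.1 ∈ I ∧ z.2 ∈ I).card : ℝ) -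
      (I.card : ℝ) ^ 2 / (p : ℝ) ^ 2 * V.card : ℝ)) : ℂ) =
      (∑ c ∈ Finset.univ.erase ((0, 0) : ZMod p × ZMod p), F c.1 * F c.2 * S c) / (p : ℂ) ^ 2 := by
    have hpc : (p : ℂ) ≠ 0 := by exact_mod_cast hp.ne'
    push_cast
    rw [eq_div_iff (pow_ne_zero 2 hpc), sub_mul, mul_comm _ ((p : ℂ) ^ 2), hmain]
    field_simp
    ring
  rw [← Real.norm_eq_abs, ← Complex.norm_real, heq, norm_div, norm_pow, Complex.norm_natCast]
  gcongr

theorem MvPolynomial.card_zeros_le {φ : MvPolynomial (Fin 2) (ZMod p)} (h0 : φ ≠ 0) :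
    (Finset.univ.filter fun z : ZMod p × ZMod p => MvPolynomial.eval ![z.1, z.2] φ = 0).card ≤
      φ.totalDegree * p := by
  have hp : (0 : ℚ≥0) < p := by exact_mod_cast (Fact.out : p.Prime).pos
  have h1 := MvPolynomial.schwartz_zippel_totalDegree h0 (Finset.univ : Finset (ZMod p))
  rw [Finset.card_univ, ZMod.card, div_le_div_iff₀ (by positivity) hp] at h1
  have h2 : (Finset.univ.filter fun z : ZMod p × ZMod p => MvPolynomial.eval ![z.1, z.2] φ = 0).card ≤
      (Finset.filter (fun f => MvPolynomial.eval f φ = 0)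
        (Fintype.piFinset fun _ : Fin 2 => (Finset.univ : Finset (ZMod p)))).card := by
    refine Finset.card_le_card_of_injOn (fun z => ![z.1, z.2]) ?_ ?_
    · intro z hz
      simpa using hz
    · intro z _ w _ hzw
      exact Prod.ext (congrFun hzw 0) (congrFun hzw 1)
  have h3 : (Finset.filter (fun f => MvPolynomial.eval f φ = 0)
      (Fintype.piFinset fun _ : Fin 2 => (Finset.univ : Finset (ZMod p)))).card * p ≤
        φ.totalDegree * p ^ 2 := by exact_mod_cast h1
  refine h2.trans (Nat.le_of_mul_le_mul_right (h3.trans (le_of_eq ?_)) (Fact.out : p.Prime).pos)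
  ring

end CompletingSums

theorem ZMod.stdAddChar_ne_one_of_prime (p : ℕ) [Fact p.Prime] :
    (ZMod.stdAddChar : AddChar (ZMod p) ℂ) ≠ 1 := by
  intro h
  have h1 : (ZMod.stdAddChar (1 : ZMod p) : ℂ) = ZMod.stdAddChar (0 : ZMod p) := by
    rw [h]
    simp
  exact one_ne_zero (ZMod.injective_stdAddChar h1)

/-- **Lemma 5.** If `φ(P,Q)` (equal to `P(x) − Q(y)` when `P ≠ Q`, and to
`(P(x) − P(y))/(x − y)` when `P = Q`) has no linear divisors `b₁x + b₂y + c` with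
`(b₁, b₂) ≠ (0,0)`, and `I` is (the image of) a finite arithmetic progression, then
`|J_I(P,Q) − (|I|²/p²)·J(P,Q)| ≤ C·d²·√p·(log p)²`, where `d = deg φ(P,Q)`. -/
theorem card_zeros_on_progression :
    ∃ C : ℝ, C > 0 ∧ ∀ (p : ℕ) [Fact p.Prime], ∀ P Q : Polynomial (ZMod p),
      ∀ φ : MvPolynomial (Fin 2) (ZMod p),
      ((P ≠ Q ∧ φ = Polynomial.aeval (X 0 : MvPolynomial (Fin 2) (ZMod p)) P -
          Polynomial.aeval (X 1 : MvPolynomial (Fin 2) (ZMod p)) Q) ∨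
       (P = Q ∧ φ * (X 0 - X 1) =
          Polynomial.aeval (X 0 : MvPolynomial (Fin 2) (ZMod p)) P -
            Polynomial.aeval (X 1 : MvPolynomial (Fin 2) (ZMod p)) P)) →
      1 ≤ φ.totalDegree →
      (∀ b₁ b₂ c : ZMod p, (b₁, b₂) ≠ (0, 0) →
        ¬ ((MvPolynomial.C b₁ * X 0 + MvPolynomial.C b₂ * X 1 + MvPolynomial.C c : MvPolynomial (Fin 2) (ZMod p)) ∣ φ)) →
      ∀ (s r : ZMod p) (m : ℕ), r ≠ 0 → 1 ≤ m →
        |((Set.ncard {xy : ZMod p × ZMod p |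
              xy.1 ∈ apImage p s r m ∧ xy.2 ∈ apImage p s r m ∧
                MvPolynomial.eval ![xy.1, xy.2] φ = 0} : ℝ)) -
            (((apImage p s r m).card : ℝ) ^ 2 / (p : ℝ) ^ 2) *
              (Set.ncard {xy : ZMod p × ZMod p | MvPolynomial.eval ![xy.1, xy.2] φ = 0} : ℝ)| ≤
          C * (φ.totalDegree : ℝ) ^ 2 * Real.sqrt p * (Real.log p) ^ 2 := by
  refine ⟨200, by norm_num, ?_⟩
  intro p _ P Q φ _ hdeg hlin s r m hr _
  have hp := (Fact.out : p.Prime)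
  have hp0 : (0 : ℝ) < p := by exact_mod_cast hp.pos
  have hφ0 : φ ≠ 0 := by
    rintro rfl
    simp at hdeg
  let V : Finset (ZMod p × ZMod p) := Finset.univ.filter fun z => MvPolynomial.eval ![z.1, z.2] φ = 0
  let I := apImage p s r m
  have hJ : Set.ncard {xy : ZMod p × ZMod p | MvPolynomial.eval ![xy.1, xy.2] φ = 0} = V.card := by
    rw [← Set.ncard_coe_finset]
    congr 1
    ext z
    simp [V]
  have hJI : Set.ncard {xy : ZMod p × ZMod p | xy.1 ∈ apImage p s r m ∧ xy.2 ∈ apImage p s r m ∧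
      MvPolynomial.eval ![xy.1, xy.2] φ = 0} = (V.filter fun z => z.1 ∈ I ∧ z.2 ∈ I).card := by
    rw [← Set.ncard_coe_finset]
    congr 1
    ext z
    simp [V, I]
    tauto
  rw [hJ, hJI]
  change |_ - ((I.card : ℝ) ^ 2 / (p : ℝ) ^ 2) * (V.card : ℝ)| ≤ _
  have hlog := one_half_le_log_prime (p := p)
  have hlog2 : 1 / 4 ≤ Real.log p ^ 2 := by nlinarith
  have hd1 : (1 : ℝ) ≤ φ.totalDegree := by exact_mod_cast hdeg
  by_cases hd : φ.totalDegree ^ 2 ≤ p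
  · by_cases hm : m ≤ p
    · have h1 := abs_card_filter_sub_le_of_norm_le V I
        (fun a b hab => norm_sum_addChar_linear_le (ZMod.stdAddChar_ne_one_of_prime p) hφ0 hlin hd a b hab)
        (sum_norm_sum_apImage_le (s := s) hr hm)
      refine h1.trans ?_
      rw [div_le_iff₀ (by positivity)]
      have h2 : 0 ≤ (φ.totalDegree : ℝ) ^ 2 * √p * Real.log p ^ 2 * (p : ℝ) ^ 2 := by positivity
      nlinarith
    · have hI : I = Finset.univ := by
        refine Finset.eq_univ_of_forall fun x => Finset.mem_image.2 ⟨((x - s) * r⁻¹).val, ?_, ?_⟩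
        · rw [Finset.mem_range]
          exact (ZMod.val_lt _).trans (not_le.1 hm)
        · rw [ZMod.natCast_zmod_val, mul_assoc, inv_mul_cancel₀ hr]
          ring
      have h1 : (V.filter fun z => z.1 ∈ I ∧ z.2 ∈ I) = V :=
        Finset.filter_true_of_mem fun z _ => by simp [hI]
      rw [h1, hI, Finset.card_univ, ZMod.card, div_self (by positivity), one_mul, sub_self, abs_zero]
      positivity
  · have h1 : ((V.filter fun z => z.1 ∈ I ∧ z.2 ∈ I).card : ℝ) ≤ V.card := by
      exact_mod_cast Finset.card_filter_le _ _
    have hI : (I.card : ℝ) ≤ p := by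
      have := Finset.card_le_univ I
      rw [ZMod.card] at this
      exact_mod_cast this
    have h2 : (I.card : ℝ) ^ 2 / (p : ℝ) ^ 2 ≤ 1 := by
      rw [div_le_one (by positivity)]
      gcongr
    have h3 : (V.card : ℝ) ≤ φ.totalDegree * p := by exact_mod_cast MvPolynomial.card_zeros_le hφ0
    have h4 : √(p : ℝ) ≤ φ.totalDegree := by
      refine Real.sqrt_le_iff.2 ⟨by positivity, ?_⟩
      exact_mod_cast (not_le.1 hd).le
    have h5 : |((V.filter fun z => z.1 ∈ I ∧ z.2 ∈ I).card : ℝ) -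
        (I.card : ℝ) ^ 2 / (p : ℝ) ^ 2 * V.card| ≤ V.card := by
      have h6 : (I.card : ℝ) ^ 2 / (p : ℝ) ^ 2 * V.card ≤ V.card :=
        mul_le_of_le_one_left (Nat.cast_nonneg _) h2
      have h7 : 0 ≤ (I.card : ℝ) ^ 2 / (p : ℝ) ^ 2 * V.card := by positivity
      have h8 : (0 : ℝ) ≤ ((V.filter fun z => z.1 ∈ I ∧ z.2 ∈ I).card : ℝ) := Nat.cast_nonneg _
      rw [abs_le]
      constructor <;> linarith
    refine h5.trans (h3.trans ?_)
    calc (φ.totalDegree : ℝ) * p = φ.totalDegree * (√p * √p) := by rw [Real.mul_self_sqrt hp0.le]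
      _ ≤ φ.totalDegree * (φ.totalDegree * √p) := by gcongr
      _ = 4 * (φ.totalDegree : ℝ) ^ 2 * √p * (1 / 4) := by ring
      _ ≤ 200 * (φ.totalDegree : ℝ) ^ 2 * √p * Real.log p ^ 2 := by
        gcongr
        norm_num
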